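/- arXiv:2311.15234 — 2 statements merged into one kernel-verified Lean document; each statement's English description precedes it below -/
import Mathlib

section
/- There exist a computable map T on the Cantor space X over the alphabet {0,1} and a closed T-invariant set A ⊆ X such that: (i) the inner collection {w : [w] ∩ A ≠ ∅} is Σ₂ and Fin many-one reduces to it; and (ii) for every shift-ergodic fully supported Borel probability measure λ on X, A is a statistical attractor of T with respect to λ. -/
open Filter Topology MeasureTheory Set
open scoped ENNReal NNReal

/-- Cylinder of a finite word in Cantor space: the set of sequences beginning with `w`. -/
def cyl {𝒜 : Type*} (w : List 𝒜) : Set (ℕ → 𝒜) :=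
  {x | ∀ i : Fin w.length, x i = w.get i}

/-- The shift map on Cantor space. -/
def shiftMap {𝒜 : Type*} (x : ℕ → 𝒜) : ℕ → 𝒜 := fun i => x (i + 1)

/-- ω-limit set of `x` under iteration of `T`: the set of accumulation points of the orbit. -/
def omegaSet {X : Type*} [TopologicalSpace X] (T : X → X) (x : X) : Set X :=
  {y | MapClusterPt y Filter.atTop fun n => T^[n] x}

/-- Realm of attraction `ρ(A) = {x : ω(x) ⊆ A}`. -/
def realm {X : Type*} [TopologicalSpace X] (T : X → X) (A : Set X) : Set X :=
  {x | omegaSet T x ⊆ A}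

/-- `A` is a topological attractor of `T`: a closed invariant set whose realm of attraction is
residual, and such that no strictly smaller closed subset has nonmeager realm of attraction. -/
def IsTopAttractor {X : Type*} [TopologicalSpace X] (T : X → X) (A : Set X) : Prop :=
  IsClosed A ∧ Set.MapsTo T A A ∧ realm T A ∈ residual X ∧
    ∀ A' : Set X, IsClosed A' → A' ⊂ A → IsMeagre (realm T A')

/-- `A` is a metric attractor of `T` w.r.t. `lam`: a closed invariant set whose realm of
attraction has full measure, and no strictly smaller closed subset has realm of positive
measure. -/
def IsMetricAttractor {X : Type*} [TopologicalSpace X] [MeasurableSpace X]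
    (T : X → X) (lam : Measure X) (A : Set X) : Prop :=
  IsClosed A ∧ Set.MapsTo T A A ∧ lam (realm T A) = 1 ∧
    ∀ A' : Set X, IsClosed A' → A' ⊂ A → lam (realm T A') = 0

/-- Empirical (Birkhoff) measures `ν_n(x) = (1/n) ∑_{i<n} δ_{T^i x}`. -/
noncomputable def empMeasure {X : Type*} [MeasurableSpace X] (T : X → X) (x : X) (n : ℕ) :
    Measure X :=
  (n : ℝ≥0∞)⁻¹ • ∑ i ∈ Finset.range n, Measure.dirac (T^[i] x)

/-- Weak-* convergence of a sequence of measures: integrals of continuous functions converge. -/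
def WeakTendsto {X : Type*} [TopologicalSpace X] [MeasurableSpace X]
    (μs : ℕ → Measure X) (μ : Measure X) : Prop :=
  ∀ φ : C(X, ℝ), Filter.Tendsto (fun n => ∫ x, φ x ∂(μs n)) Filter.atTop (nhds (∫ x, φ x ∂μ))

/-- Topological support of a measure: points all of whose open neighbourhoods have positive
measure. -/
def measSupport {X : Type*} [TopologicalSpace X] [MeasurableSpace X]
    (μ : Measure X) : Set X :=
  {x | ∀ U : Set X, IsOpen U → x ∈ U → 0 < μ U}

/-- `A` is a statistical (physical) attractor of `T` w.r.t. `lam`: there is a `T`-invariant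
probability measure `μ` with support `A` such that for `lam`-a.e. `x` the empirical measures
converge weak-* to `μ`. -/
def IsStatAttractor {X : Type*} [TopologicalSpace X] [MeasurableSpace X]
    (T : X → X) (lam : Measure X) (A : Set X) : Prop :=
  IsClosed A ∧ ∃ μ : Measure X, IsProbabilityMeasure μ ∧
    Measure.map T μ = μ ∧ measSupport μ = A ∧
    ∀ᵐ x ∂lam, WeakTendsto (empMeasure T x) μ

/-- `A` is strongly attracting: there is an open `U ⊇ A` with `T (closure U) ⊆ U` and
`A = ⋂ₙ Tⁿ(U)`. -/
def StronglyAttracting {X : Type*} [TopologicalSpace X] (T : X → X) (A : Set X) : Prop :=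
  ∃ U : Set X, IsOpen U ∧ A ⊆ U ∧ T '' (closure U) ⊆ U ∧ A = ⋂ n : ℕ, T^[n] '' U

/-- `S` is Σ₁ (recursively enumerable). -/
def SigmaOne {I : Type*} [Primcodable I] (S : Set I) : Prop :=
  ∃ f : I × ℕ → Bool, Computable f ∧ ∀ i, i ∈ S ↔ ∃ a, f (i, a) = true

/-- `S` is Π₁ (co-r.e.). -/
def PiOne {I : Type*} [Primcodable I] (S : Set I) : Prop := SigmaOne Sᶜ

/-- `S` is Σ₂. -/
def SigmaTwo {I : Type*} [Primcodable I] (S : Set I) : Prop :=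
  ∃ f : I × ℕ × ℕ → Bool, Computable f ∧ ∀ i, i ∈ S ↔ ∃ a, ∀ b, f (i, a, b) = true

/-- `S` is Π₂. -/
def PiTwo {I : Type*} [Primcodable I] (S : Set I) : Prop :=
  ∃ f : I × ℕ × ℕ → Bool, Computable f ∧ ∀ i, i ∈ S ↔ ∀ a, ∃ b, f (i, a, b) = true

/-- A map of Cantor space is computable if `(T x) n` is computed by a computable function from
`n` and the finite prefix `[x 0, …, x (α n)]` of `x`, for a computable modulus `α`. -/
def CantorComputable {𝒜 : Type} [Primcodable 𝒜] (T : (ℕ → 𝒜) → (ℕ → 𝒜)) : Prop :=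
  ∃ (α : ℕ → ℕ) (β : ℕ → List 𝒜 → 𝒜), Computable α ∧ Computable₂ β ∧
    ∀ (x : ℕ → 𝒜) (n : ℕ), T x n = β n (List.ofFn fun i : Fin (α n + 1) => x i)

/-- A Borel probability measure on Cantor space is computable if the measures of finite unions
of cylinders are uniformly lower-computable: `lam(⋃_{w ∈ W} [w]) = sup_k q (W, k)` for a
computable `q`. -/
def ComputableCantorMeasure {𝒜 : Type} [Primcodable 𝒜] [MeasurableSpace 𝒜]
    (lam : Measure (ℕ → 𝒜)) : Prop :=
  ∃ q : List (List 𝒜) × ℕ → ℚ, Computable q ∧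
    ∀ W : List (List 𝒜), (lam (⋃ w ∈ W, cyl w)).toReal = ⨆ k, (q (W, k) : ℝ)

/-- Indices of machines halting on input 0. -/
def HaltSet : Set ℕ := {e | ((Denumerable.ofNat Nat.Partrec.Code e).eval 0).Dom}

/-- Indices of total machines. -/
def TotSet : Set ℕ := {e | ∀ n, ((Denumerable.ofNat Nat.Partrec.Code e).eval n).Dom}

/-- Indices of machines with finite domain. -/
def FinSet : Set ℕ := {e | {n | ((Denumerable.ofNat Nat.Partrec.Code e).eval n).Dom}.Finite}

/-- The running maximum `max (0, S₁, …, Sₙ)` of the Birkhoff sums of `g`. -/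
noncomputable def birkhoffMax {α : Type*} (S : α → α) (g : α → ℝ) : ℕ → α → ℝ
  | 0 => fun _ => 0
  | n + 1 => fun x => max 0 (g x + birkhoffMax S g n (S x))

section birkhoffMax

variable {α : Type*} {S : α → α} {g : α → ℝ}

theorem birkhoffMax_nonneg (n : ℕ) (x : α) : 0 ≤ birkhoffMax S g n x := by
  cases n <;> simp [birkhoffMax]

theorem birkhoffMax_le_succ (n : ℕ) (x : α) :
    birkhoffMax S g n x ≤ birkhoffMax S g (n + 1) x := by
  induction n generalizing x with
  | zero => simp [birkhoffMax]
  | succ n ih =>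
    simp only [birkhoffMax] at ih ⊢
    gcongr
    exact ih _

theorem birkhoffMax_monotone (x : α) : Monotone fun n => birkhoffMax S g n x :=
  monotone_nat_of_le_succ fun n => birkhoffMax_le_succ n x

theorem birkhoffSum_le_birkhoffMax (n : ℕ) (x : α) :
    birkhoffSum S g n x ≤ birkhoffMax S g n x := by
  induction n generalizing x with
  | zero => simp [birkhoffMax]
  | succ n ih =>
    rw [birkhoffSum_succ', birkhoffMax]
    exact le_max_of_le_right (by linarith [ih (S x)])

theorem birkhoffMax_le {C : ℝ} (hC : ∀ x, |g x| ≤ C) (n : ℕ) (x : α) :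
    birkhoffMax S g n x ≤ n * C := by
  induction n generalizing x with
  | zero => simp [birkhoffMax]
  | succ n ih =>
    have h0 := (abs_nonneg _).trans (hC x)
    have h1 := (le_abs_self _).trans (hC x)
    have h2 := ih (S x)
    have h3 := birkhoffMax_nonneg (S := S) (g := g) n (S x)
    simp only [birkhoffMax]
    push_cast
    exact max_le (by nlinarith) (by nlinarith)

theorem measurable_birkhoffMax [MeasurableSpace α] (hS : Measurable S) (hg : Measurable g)
    (n : ℕ) : Measurable (birkhoffMax S g n) := by
  induction n with
  | zero => exact measurable_const
  | succ n ih => exact measurable_const.max (hg.add (ih.comp hS))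

theorem birkhoffMax_succ_sub (n : ℕ) (x : α) :
    birkhoffMax S g (n + 1) x - birkhoffMax S g n (S x) = max (-birkhoffMax S g n (S x)) (g x) := by
  simp only [birkhoffMax]
  rw [max_sub_sub_right _ _ _ |>.symm]
  congr 1 <;> ring

end birkhoffMax

theorem Ergodic.ae_bddAbove_birkhoffSum {α : Type*} [MeasurableSpace α] {μ : Measure α}
    [IsProbabilityMeasure μ] {S : α → α} (hS : Ergodic S μ) {g : α → ℝ} (hg : Measurable g)
    {C : ℝ} (hC : ∀ x, |g x| ≤ C) (hneg : ∫ x, g x ∂μ < 0) :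
    ∀ᵐ x ∂μ, ∃ B : ℝ, ∀ n, birkhoffSum S g n x ≤ B := by
  set M := birkhoffMax S g with hM
  set E : Set α := {x | ∃ B : ℕ, ∀ n, M n x ≤ B} with hE
  have hMmeas : ∀ n, Measurable (M n) := measurable_birkhoffMax hS.measurable hg
  have hEmeas : MeasurableSet E := by
    simp only [hE, ofPred_exists, ofPred_forall]
    exact .iUnion fun B => .iInter fun n => measurableSet_le (hMmeas n) measurable_const
  have hinv : S ⁻¹' E = E := by
    ext x
    constructor
    · rintro ⟨B, hB⟩
      obtain ⟨B', hB'⟩ := exists_nat_ge (max 0 (g x + B))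
      refine ⟨B', fun n => ?_⟩
      cases n with
      | zero => exact (Nat.cast_nonneg _ : (0 : ℝ) ≤ B')
      | succ n => exact (max_le_max le_rfl (by simpa using hB n)).trans hB'
    · rintro ⟨B, hB⟩
      obtain ⟨B', hB'⟩ := exists_nat_ge ((B : ℝ) - g x)
      refine ⟨B', fun n => ?_⟩
      have := (le_max_right _ _).trans (hB (n + 1))
      exact (by linarith : M n (S x) ≤ B - g x).trans hB'
  have hgood : ∀ᵐ x ∂μ, x ∈ E := by
    rcases hS.toPreErgodic.ae_mem_or_ae_notMem hEmeas hinv with h | h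
    · exact h
    · exfalso
      have hlim : Tendsto (fun n => ∫ x, (M (n + 1) x - M n (S x)) ∂μ) atTop
          (𝓝 (∫ x, g x ∂μ)) := by
        refine tendsto_integral_of_dominated_convergence (fun _ => C) (fun n => ?_)
          (integrable_const C) (fun n => .of_forall fun x => ?_) ?_
        · exact ((hMmeas _).sub ((hMmeas n).comp hS.measurable)).aestronglyMeasurable
        · rw [hM, birkhoffMax_succ_sub, Real.norm_eq_abs, abs_le]
          have h1 := abs_le.1 (hC x)
          have h2 := birkhoffMax_nonneg (S := S) (g := g) n (S x)
          exact ⟨h1.1.trans (le_max_right _ _), max_le (by linarith) h1.2⟩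
        · filter_upwards [h] with x hx
          have hx' : S x ∉ E := fun h' => hx (hinv ▸ h')
          obtain ⟨B, hB⟩ := exists_nat_ge (-g x)
          simp only [hE, mem_ofPred_eq, not_exists, not_forall, not_le] at hx'
          obtain ⟨N, hN⟩ := hx' B
          refine tendsto_const_nhds.congr' ?_
          filter_upwards [eventually_ge_atTop N] with n hn
          have := birkhoffMax_monotone (S := S) (g := g) (S x) hn
          simp only at this
          rw [hM, birkhoffMax_succ_sub, max_eq_right]
          rw [hM] at hN
          linarith
      have hInt : ∀ n, Integrable (M n) μ := fun n =>
        Integrable.of_bound (hMmeas n).aestronglyMeasurable (n * C) (.of_forall fun x => by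
          rw [Real.norm_eq_abs, abs_of_nonneg (birkhoffMax_nonneg n x)]
          exact birkhoffMax_le hC n x)
      have hpos : ∀ n, 0 ≤ ∫ x, (M (n + 1) x - M n (S x)) ∂μ := by
        intro n
        have h1 : ∫ x, M n (S x) ∂μ = ∫ x, M n x ∂μ := by
          conv_rhs => rw [← hS.map_eq]
          rw [integral_map hS.measurable.aemeasurable (hMmeas n).aestronglyMeasurable]
        have h2 : Integrable (fun x => M n (S x)) μ :=
          hS.toMeasurePreserving.integrable_comp_of_integrable (hInt n)
        rw [integral_sub (hInt _) h2, h1, sub_nonneg]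
        exact integral_mono (hInt _) (hInt _) fun x => birkhoffMax_le_succ n x
      exact absurd (ge_of_tendsto' hlim hpos) (not_le.2 hneg)
  filter_upwards [hgood] with x ⟨B, hB⟩
  exact ⟨B, fun n => (birkhoffSum_le_birkhoffMax n x).trans (hB n)⟩

theorem Ergodic.ae_eventually_average_le {α : Type*} [MeasurableSpace α] {μ : Measure α}
    [IsProbabilityMeasure μ] {S : α → α} (hS : Ergodic S μ) {f : ℕ → α → ℝ} {f' : α → ℝ}
    (hf : ∀ n, Measurable (f n)) {C : ℝ} (hC : ∀ n x, |f n x| ≤ C)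
    (hlim : ∀ x, Tendsto (fun n => f n x) atTop (𝓝 (f' x))) {c : ℝ} (hc : ∫ x, f' x ∂μ < c) :
    ∀ᵐ x ∂μ, ∀ᶠ n : ℕ in atTop, (n : ℝ)⁻¹ * ∑ i ∈ Finset.range n, f i (S^[i] x) ≤ c := by
  obtain ⟨c', hc1, hc2⟩ := exists_between hc
  set u : ℕ → α → ℝ := fun N x => ⨆ n, f (N + n) x with hu
  have hbdd : ∀ N x, BddAbove (range fun n => f (N + n) x) := fun N x =>
    ⟨C, by rintro _ ⟨n, rfl⟩; exact (abs_le.1 (hC _ x)).2⟩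
  have hle : ∀ N x m, N ≤ m → f m x ≤ u N x := fun N x m hm => by
    simpa [Nat.add_sub_cancel' hm] using le_ciSup (hbdd N x) (m - N)
  have humeas : ∀ N, Measurable (u N) := fun N => Measurable.iSup fun n => hf _
  have huC : ∀ N x, |u N x| ≤ C := fun N x => abs_le.2
    ⟨(abs_le.1 (hC N x)).1.trans (hle N x N le_rfl), ciSup_le fun n => (abs_le.1 (hC _ x)).2⟩
  have hulim : ∀ x, Tendsto (fun N => u N x) atTop (𝓝 (f' x)) := by
    intro x
    rw [Metric.tendsto_atTop]
    intro ε hε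
    obtain ⟨N, hN⟩ := Metric.tendsto_atTop.1 (hlim x) (ε / 2) (by positivity)
    refine ⟨N, fun n hn => ?_⟩
    have h1 := abs_lt.1 (Real.dist_eq _ _ ▸ hN n hn)
    have h2 : u n x ≤ f' x + ε / 2 := ciSup_le fun k => by
      have := abs_lt.1 (Real.dist_eq _ _ ▸ hN (n + k) (by omega))
      linarith
    have h3 := hle n x n le_rfl
    rw [Real.dist_eq, abs_lt]
    constructor <;> linarith
  have hInt : Tendsto (fun N => ∫ x, u N x ∂μ) atTop (𝓝 (∫ x, f' x ∂μ)) :=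
    tendsto_integral_of_dominated_convergence (fun _ => C)
      (fun N => (humeas N).aestronglyMeasurable) (integrable_const C)
      (fun N => .of_forall fun x => huC N x) (.of_forall hulim)
  obtain ⟨N, hN⟩ := (hInt.eventually_lt_const hc1).exists
  have huint : Integrable (u N) μ := Integrable.of_bound (humeas N).aestronglyMeasurable C
    (.of_forall fun x => huC N x)
  have hneg : ∫ x, (u N x - c') ∂μ < 0 := by
    rw [integral_sub huint (integrable_const _)]
    simpa using hN
  have hgC : ∀ x, |u N x - c'| ≤ C + |c'| := fun x =>
    (abs_sub _ _).trans (add_le_add (huC N x) le_rfl)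
  filter_upwards [hS.ae_bddAbove_birkhoffSum ((humeas N).sub_const c') hgC hneg] with x ⟨B, hB⟩
  have hsum : ∀ n : ℕ, ∑ i ∈ Finset.range n, f i (S^[i] x) ≤ n * c' + (B + N * (2 * C)) := by
    intro n
    have hC0 : 0 ≤ C := (abs_nonneg _).trans (hC 0 x)
    have h1 : ∀ i ∈ Finset.range n, f i (S^[i] x) ≤
        (u N (S^[i] x) - c') + (c' + if i < N then 2 * C else 0) := by
      intro i _
      split_ifs with h
      · linarith [(abs_le.1 (hC i (S^[i] x))).2, (abs_le.1 (huC N (S^[i] x))).1]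
      · linarith [hle N (S^[i] x) i (not_lt.1 h)]
    refine (Finset.sum_le_sum h1).trans ?_
    rw [Finset.sum_add_distrib, Finset.sum_add_distrib]
    have h2 := hB n
    rw [birkhoffSum] at h2
    have h3 : ∑ i ∈ Finset.range n, (if i < N then 2 * C else 0) ≤ N * (2 * C) := by
      rw [← Finset.sum_filter, Finset.sum_const, nsmul_eq_mul]
      gcongr
      calc _ ≤ (Finset.range N).card := Finset.card_le_card fun i hi => by simp at hi ⊢; omega
        _ = N := Finset.card_range N
    simp only [Finset.sum_const, Finset.card_range, nsmul_eq_mul]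
    linarith
  have hconst : Tendsto (fun n : ℕ => c' + (B + N * (2 * C)) / (n : ℝ)) atTop (𝓝 (c' + 0)) :=
    tendsto_const_nhds.add (tendsto_const_div_atTop_nhds_zero_nat _)
  rw [add_zero] at hconst
  filter_upwards [hconst.eventually_lt_const hc2, eventually_gt_atTop 0] with n hn hn0
  have hn0' : (0 : ℝ) < n := by exact_mod_cast hn0
  refine le_trans ?_ hn.le
  rw [inv_mul_le_iff₀ hn0', mul_add, mul_div_cancel₀ _ hn0'.ne']
  exact hsum n

/-- A pointwise ergodic theorem along a converging bounded sequence of observables. -/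
theorem Ergodic.ae_tendsto_average {α : Type*} [MeasurableSpace α] {μ : Measure α}
    [IsProbabilityMeasure μ] {S : α → α} (hS : Ergodic S μ) {f : ℕ → α → ℝ} {f' : α → ℝ}
    (hf : ∀ n, Measurable (f n)) {C : ℝ} (hC : ∀ n x, |f n x| ≤ C)
    (hlim : ∀ x, Tendsto (fun n => f n x) atTop (𝓝 (f' x))) :
    ∀ᵐ x ∂μ, Tendsto (fun n : ℕ => (n : ℝ)⁻¹ * ∑ i ∈ Finset.range n, f i (S^[i] x)) atTop
      (𝓝 (∫ x, f' x ∂μ)) := by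
  have hup : ∀ᵐ x ∂μ, ∀ k : ℕ, ∀ᶠ n : ℕ in atTop,
      (n : ℝ)⁻¹ * ∑ i ∈ Finset.range n, f i (S^[i] x) ≤ ∫ x, f' x ∂μ + 1 / ((k : ℝ) + 1) :=
    ae_all_iff.2 fun k => hS.ae_eventually_average_le hf hC hlim
      (lt_add_of_pos_right _ Nat.one_div_pos_of_nat)
  have hlo : ∀ᵐ x ∂μ, ∀ k : ℕ, ∀ᶠ n : ℕ in atTop,
      (n : ℝ)⁻¹ * ∑ i ∈ Finset.range n, -f i (S^[i] x) ≤
        ∫ x, -f' x ∂μ + 1 / ((k : ℝ) + 1) :=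
    ae_all_iff.2 fun k => hS.ae_eventually_average_le (f := fun n x => -f n x)
      (fun n => (hf n).neg) (fun n x => (abs_neg _).trans_le (hC n x)) (fun x => (hlim x).neg)
      (lt_add_of_pos_right _ Nat.one_div_pos_of_nat)
  filter_upwards [hup, hlo] with x h1 h2
  rw [Metric.tendsto_nhds]
  intro ε hε
  obtain ⟨k, hk⟩ := exists_nat_one_div_lt hε
  filter_upwards [h1 k, h2 k] with n hn1 hn2
  rw [integral_neg, Finset.sum_neg_distrib] at hn2
  rw [Real.dist_eq, abs_lt]
  constructor <;> linarith

/-- The word `0 0 1 c 1^{e+1} 0 1^k 0`, with `c` arbitrary, occurs in `y` at position `s`. -/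
def HasClaim (y : ℕ → Bool) (s e k : ℕ) : Prop :=
  y s = false ∧ y (s + 1) = false ∧ y (s + 2) = true ∧ (∀ r < e + 1, y (s + 4 + r) = true) ∧
    y (s + 5 + e) = false ∧ (∀ r < k, y (s + 6 + e + r) = true) ∧ y (s + 6 + e + k) = false

theorem HasClaim.congr {y z : ℕ → Bool} {s e k : ℕ} (hy : HasClaim y s e k)
    (h : ∀ p, s ≤ p → p ≤ s + 6 + e + k → z p = y p ∨ p = s + 3) : HasClaim z s e k := by
  obtain ⟨h0, h1, h2, h3, h4, h5, h6⟩ := hy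
  have key : ∀ p, s ≤ p → p ≤ s + 6 + e + k → p ≠ s + 3 → z p = y p := fun p a b c =>
    (h p a b).resolve_right c
  refine ⟨?_, ?_, ?_, fun r hr => ?_, ?_, fun r hr => ?_, ?_⟩
  · rw [key _ (by omega) (by omega) (by omega), h0]
  · rw [key _ (by omega) (by omega) (by omega), h1]
  · rw [key _ (by omega) (by omega) (by omega), h2]
  · rw [key _ (by omega) (by omega) (by omega), h3 r hr]
  · rw [key _ (by omega) (by omega) (by omega), h4]
  · rw [key _ (by omega) (by omega) (by omega), h5 r hr]
  · rw [key _ (by omega) (by omega) (by omega), h6]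

/-- The claims occurring in a sequence do not overlap. -/
theorem HasClaim.eq_of_mem {y : ℕ → Bool} {s e k s' e' k' : ℕ} (h : HasClaim y s e k)
    (h' : HasClaim y s' e' k') (h1 : s ≤ s' + 3) (h2 : s' + 3 ≤ s + 6 + e + k) : s' = s := by
  obtain ⟨a0, a1, a2, a3, a4, a5, a6⟩ := h
  obtain ⟨b0, b1, b2, b3, b4, b5, b6⟩ := h'
  have b3 := b3 0 (by omega)
  by_contra hne
  rcases Nat.lt_or_gt_of_ne hne with hlt | hlt
  · obtain rfl | rfl | rfl : s = s' + 1 ∨ s = s' + 2 ∨ s = s' + 3 := by omega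
    · simp_all
    · simp_all
    · simp_all
  · obtain ⟨t, rfl⟩ := Nat.exists_eq_add_of_lt hlt
    obtain rfl | rfl | rfl | ht : t = 0 ∨ t = 1 ∨ t = 2 ∨ 3 ≤ t := by omega
    · simp_all
    · simp_all
    · have := a3 0 (by omega)
      simp_all
    rcases le_or_gt t (e + 3) with h4 | h4
    · have := a3 (t - 3) (by omega)
      rw [show s + 4 + (t - 3) = s + t + 1 by omega, b0] at this
      cases this
    rcases Nat.eq_or_lt_of_le h4 with h5 | h5
    · have := a5 0 (by omega)
      rw [show s + 6 + e + 0 = s + t + 1 + 1 by omega, b1] at this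
      cases this
    · have := a5 (t - (e + 5)) (by omega)
      rw [show s + 6 + e + (t - (e + 5)) = s + t + 1 by omega, b0] at this
      cases this

theorem HasClaim.of_modify {y z : ℕ → Bool}
    (h : ∀ p, z p = y p ∨ ∃ s e k, p = s + 3 ∧ HasClaim y s e k) {s e k : ℕ}
    (hy : HasClaim y s e k) : HasClaim z s e k := by
  refine hy.congr fun p hp1 hp2 => ?_
  rcases h p with h | ⟨s', e', k', rfl, h⟩
  · exact .inl h
  · exact .inr (by rw [hy.eq_of_mem h hp1 hp2])

theorem hasClaim_modify_iff {y z : ℕ → Bool}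
    (h : ∀ p, z p = y p ∨ ∃ s e k, p = s + 3 ∧ HasClaim y s e k) {s e k : ℕ} :
    HasClaim z s e k ↔ HasClaim y s e k := by
  refine ⟨HasClaim.of_modify fun p => ?_, HasClaim.of_modify h⟩
  rcases h p with h' | ⟨s', e', k', rfl, h'⟩
  · exact .inl h'.symm
  · exact .inr ⟨s', e', k', rfl, h'.of_modify h⟩

theorem hasClaim_shiftMap {y : ℕ → Bool} {s e k : ℕ} :
    HasClaim (shiftMap y) s e k ↔ HasClaim y (s + 1) e k := by
  simp only [HasClaim, shiftMap, Nat.add_right_comm _ _ 1]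

/-- The claim at position `s` of `y` is refuted at stage `i`, where `K` says which stages refute
which claims. -/
def RefutedAt (K : ℕ → ℕ → Prop) (y : ℕ → Bool) (s i : ℕ) : Prop :=
  2 ≤ i ∧ ∃ e < i + 1, ∃ k < i + 1, HasClaim y s e k ∧ K e i

open Classical in
/-- Shift by three places, erasing the distinguished bit of every claim (now in place `j`) refuted
at a stage in `I j`. -/
noncomputable def claimFilter (K : ℕ → ℕ → Prop) (I : ℕ → Set ℕ) (y : ℕ → Bool) (j : ℕ) : Bool :=
  y (j + 3) && !decide (∃ i ∈ I j, RefutedAt K y j i)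

open Classical in
/-- Shift, erasing the distinguished bit of the claim in place `j` if it is refuted at stage `j`. -/
noncomputable def claimMap (K : ℕ → ℕ → Prop) (x : ℕ → Bool) (j : ℕ) : Bool :=
  x (j + 1) && !decide (RefutedAt K x (j - 2) j)

/-- The stages at which the content of place `j` has been inspected after `n` steps. -/
def passedStages (n j : ℕ) : Set ℕ := Ico j (j + n)

section claims

variable {K : ℕ → ℕ → Prop} {I : ℕ → Set ℕ} {y : ℕ → Bool}

theorem claimFilter_eq_true {j : ℕ} : claimFilter K I y j = true ↔
    y (j + 3) = true ∧ ∀ i ∈ I j, ¬ RefutedAt K y j i := by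
  simp [claimFilter]

theorem claimMap_eq_true {j : ℕ} : claimMap K y j = true ↔
    y (j + 1) = true ∧ ¬ RefutedAt K y (j - 2) j := by
  simp [claimMap]

theorem claimFilter_eq_or (p : ℕ) :
    claimFilter K I y p = y (p + 3) ∨ ∃ e k, HasClaim y p e k := by
  by_cases h : ∃ i ∈ I p, RefutedAt K y p i
  · obtain ⟨i, _, _, e, _, k, _, h, _⟩ := h
    exact .inr ⟨e, k, h⟩
  · left
    simp [claimFilter, h]

theorem hasClaim_claimFilter {s e k : ℕ} :
    HasClaim (claimFilter K I y) s e k ↔ HasClaim y (s + 3) e k := by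
  set z : ℕ → Bool := fun p => if p < 3 then y p else claimFilter K I y (p - 3) with hz
  have h1 : claimFilter K I y = shiftMap (shiftMap (shiftMap z)) := by
    ext p
    simp [shiftMap, hz]
  rw [h1, hasClaim_shiftMap, hasClaim_shiftMap, hasClaim_shiftMap]
  refine hasClaim_modify_iff fun p => ?_
  by_cases hp : p < 3
  · exact .inl (by simp [hz, hp])
  · obtain ⟨q, rfl⟩ := Nat.exists_eq_add_of_le' (not_lt.1 hp)
    rcases claimFilter_eq_or (K := K) (I := I) (y := y) q with h | ⟨e, k, h⟩
    · exact .inl (by simp [hz, h])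
    · exact .inr ⟨q, e, k, rfl, h⟩

theorem refutedAt_shiftMap {s i : ℕ} :
    RefutedAt K (shiftMap y) s i ↔ RefutedAt K y (s + 1) i := by
  simp only [RefutedAt, hasClaim_shiftMap]

theorem refutedAt_claimFilter {s i : ℕ} :
    RefutedAt K (claimFilter K I y) s i ↔ RefutedAt K y (s + 3) i := by
  simp only [RefutedAt, hasClaim_claimFilter]

theorem claimMap_claimFilter (n : ℕ) (y : ℕ → Bool) :
    claimMap K (claimFilter K (passedStages n) y) =
      claimFilter K (passedStages (n + 1)) (shiftMap y) := by
  ext j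
  rw [Bool.eq_iff_iff, claimMap_eq_true, claimFilter_eq_true, claimFilter_eq_true]
  simp only [refutedAt_claimFilter, refutedAt_shiftMap, passedStages, mem_Ico, shiftMap]
  rw [and_assoc]
  refine and_congr (by rw [Nat.add_right_comm]) ⟨?_, ?_⟩
  · rintro ⟨h1, h2⟩ i hi h
    rcases hi.1.eq_or_lt with rfl | hlt
    · have := h.1
      rw [show j - 2 + 3 = j + 1 by omega] at h2
      exact h2 h
    · exact h1 i ⟨hlt, by omega⟩ h
  · refine fun h => ⟨fun i hi => h i ⟨by omega, by omega⟩, fun h' => ?_⟩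
    have := h'.1
    rw [show j - 2 + 3 = j + 1 by omega] at h'
    exact h j ⟨le_rfl, by omega⟩ h'

theorem claimMap_iterate_claimFilter (n : ℕ) (y : ℕ → Bool) :
    (claimMap K)^[n] (shiftMap^[3] y) = claimFilter K (passedStages n) (shiftMap^[n] y) := by
  induction n with
  | zero =>
    ext j
    rw [Bool.eq_iff_iff, claimFilter_eq_true]
    simp [passedStages, shiftMap]
  | succ n ih =>
    rw [Function.iterate_succ_apply', ih, claimMap_claimFilter, Function.iterate_succ_apply']

theorem iterate_shiftMap_apply (n : ℕ) (y : ℕ → Bool) (j : ℕ) :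
    shiftMap^[n] y j = y (j + n) := by
  induction n generalizing j with
  | zero => rfl
  | succ n ih =>
    rw [Function.iterate_succ_apply', shiftMap, ih]
    congr 1
    omega

theorem claimMap_iterate_add (n : ℕ) (x : ℕ → Bool) :
    (claimMap K)^[n + 3] x = claimFilter K (passedStages (n + 3)) (shiftMap^[n] x) := by
  have h : shiftMap^[3] (fun j => if j < 3 then false else x (j - 3)) = x := by
    ext j
    simp [iterate_shiftMap_apply]
  conv_lhs => rw [← h]
  rw [claimMap_iterate_claimFilter, Function.iterate_add_apply, h]

theorem claimFilter_eventually_eq (y : ℕ → Bool) (j : ℕ) :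
    ∀ᶠ n in atTop, claimFilter K (passedStages n) y j = claimFilter K Ici y j := by
  by_cases h : ∃ i ∈ Ici j, RefutedAt K y j i
  · obtain ⟨i, hi, h⟩ := h
    filter_upwards [eventually_gt_atTop i] with n hn
    have h1 : ∃ i ∈ Ici j, RefutedAt K y j i := ⟨i, hi, h⟩
    have h2 : ∃ i ∈ passedStages n j, RefutedAt K y j i := ⟨i, ⟨hi, by omega⟩, h⟩
    simp only [claimFilter, h1, h2]
  · refine .of_forall fun n => ?_
    have h2 : ¬ ∃ i ∈ passedStages n j, RefutedAt K y j i :=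
      fun ⟨i, hi, h'⟩ => h ⟨i, hi.1, h'⟩
    simp only [claimFilter, h, h2]

theorem tendsto_claimFilter (y : ℕ → Bool) :
    Tendsto (fun n => claimFilter K (passedStages n) y) atTop (𝓝 (claimFilter K Ici y)) := by
  rw [tendsto_pi_nhds]
  exact fun j => tendsto_const_nhds.congr' ((claimFilter_eventually_eq y j).mono fun n h => h.symm)

theorem claimMap_congr {x x' : ℕ → Bool} {j : ℕ} (h : ∀ p < 3 * j + 7, x p = x' p) :
    claimMap K x j = claimMap K x' j := by
  have key : ∀ {x x' : ℕ → Bool}, (∀ p < 3 * j + 7, x p = x' p) →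
      RefutedAt K x (j - 2) j → RefutedAt K x' (j - 2) j := by
    rintro x x' h ⟨h2, e, he, k, hk, hc, hK⟩
    exact ⟨h2, e, he, k, hk, hc.congr fun p _ hp => .inl (h p (by omega)).symm, hK⟩
  rw [Bool.eq_iff_iff, claimMap_eq_true, claimMap_eq_true, h (j + 1) (by omega),
    show RefutedAt K x (j - 2) j ↔ RefutedAt K x' (j - 2) j from
      ⟨key h, key fun p hp => (h p hp).symm⟩]

theorem eventually_eq_below (y : ℕ → Bool) (M : ℕ) : ∀ᶠ z in 𝓝 y, ∀ p < M, y p = z p := by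
  have : ∀ᶠ z in 𝓝 y, ∀ p ∈ Finset.range M, y p = z p := by
    rw [Filter.eventually_all_finset]
    intro p _
    have := (continuous_apply p).tendsto y (show {y p} ∈ 𝓝 (y p) from mem_nhds_discrete.2 rfl)
    filter_upwards [this] with z hz
    exact (hz : z p = y p).symm
  filter_upwards [this] with z hz p hp
  exact hz p (Finset.mem_range.2 hp)

theorem continuousAt_of_locally_determined {f : (ℕ → Bool) → (ℕ → Bool)} {y : ℕ → Bool}
    (h : ∀ j, ∃ M, ∀ z, (∀ p < M, y p = z p) → f y j = f z j) : ContinuousAt f y := by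
  refine tendsto_pi_nhds.2 fun j => ?_
  obtain ⟨M, hM⟩ := h j
  exact tendsto_const_nhds.congr' ((eventually_eq_below y M).mono fun z hz => hM z hz)

theorem continuous_claimMap : Continuous (claimMap K) :=
  continuous_iff_continuousAt.2 fun _ =>
    continuousAt_of_locally_determined fun _ => ⟨_, fun _ hz => claimMap_congr hz⟩

theorem HasClaim.end_le {y : ℕ → Bool} {s e k q₁ q₂ : ℕ} (h : HasClaim y s e k)
    (h1 : s + 4 ≤ q₁) (h2 : q₁ < q₂) (hq1 : y q₁ = false) (hq2 : y q₂ = false) :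
    s + 6 + e + k ≤ q₂ := by
  obtain ⟨-, -, -, h3, -, h5, -⟩ := h
  by_contra hlt
  rcases le_or_gt q₁ (s + 4 + e) with h | h
  · have := h3 (q₁ - (s + 4)) (by omega)
    rw [show s + 4 + (q₁ - (s + 4)) = q₁ by omega, hq1] at this
    cases this
  · have := h5 (q₂ - (s + 6 + e)) (by omega)
    rw [show s + 6 + e + (q₂ - (s + 6 + e)) = q₂ by omega, hq2] at this
    cases this

theorem continuousAt_claimFilter {y : ℕ → Bool} (hy : ∃ᶠ i in atTop, y i = false) :
    ContinuousAt (claimFilter K Ici) y := by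
  refine continuousAt_of_locally_determined fun j => ?_
  obtain ⟨q₁, h1, hq1⟩ := frequently_atTop.1 hy (j + 4)
  obtain ⟨q₂, h2, hq2⟩ := frequently_atTop.1 hy (q₁ + 1)
  refine ⟨q₂ + 1, fun z hz => ?_⟩
  have key : ∀ {y z : ℕ → Bool}, (∀ p < q₂ + 1, y p = z p) → y q₁ = false → y q₂ = false →
      ∀ i, RefutedAt K y j i → RefutedAt K z j i := by
    rintro y z hz hq1 hq2 i ⟨hi, e, he, k, hk, hc, hK⟩
    have := hc.end_le h1 (by omega) hq1 hq2
    exact ⟨hi, e, he, k, hk, hc.congr fun p _ hp => .inl (hz p (by omega)).symm, hK⟩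
  have hiff : ∀ i, RefutedAt K y j i ↔ RefutedAt K z j i := fun i =>
    ⟨key hz hq1 hq2 i, key (fun p hp => (hz p hp).symm) (by rw [← hz _ (by omega), hq1])
      (by rw [← hz _ (by omega), hq2]) i⟩
  rw [Bool.eq_iff_iff, claimFilter_eq_true, claimFilter_eq_true, hz (j + 3) (by omega)]
  simp only [hiff]

theorem claimMap_claimFilter_Ici (y : ℕ → Bool) :
    claimMap K (claimFilter K Ici y) = claimFilter K Ici (shiftMap y) := by
  have h1 := (continuous_claimMap (K := K)).continuousAt.tendsto.comp (tendsto_claimFilter (K := K) y)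
  have h2 := (tendsto_add_atTop_iff_nat 1).2 (tendsto_claimFilter (K := K) (shiftMap y))
  refine tendsto_nhds_unique h1 (h2.congr fun n => ?_)
  exact (claimMap_claimFilter n y).symm

theorem measurableSet_hasClaim (s e k : ℕ) : MeasurableSet {y | HasClaim y s e k} := by
  unfold HasClaim
  measurability

theorem measurable_claimFilter : Measurable (claimFilter K I) := by
  refine measurable_pi_iff.2 fun j => measurable_to_bool ?_
  have : (fun y => claimFilter K I y j) ⁻¹' {true} =
      {y | y (j + 3) = true} ∩ ⋂ i ∈ I j, {y | RefutedAt K y j i}ᶜ := by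
    ext y
    simp [claimFilter_eq_true]
  rw [this]
  refine .inter ?_ (.biInter (to_countable _) fun i _ => .compl ?_)
  · have h : Measurable fun y : ℕ → Bool => y (j + 3) := measurable_pi_apply _
    exact h (measurableSet_singleton true)
  · have : {y | RefutedAt K y j i} = ⋃ (_ : 2 ≤ i), ⋃ e ∈ Iio (i + 1), ⋃ k ∈ Iio (i + 1),
        {y | HasClaim y j e k} ∩ {_y | K e i} := by
      ext y
      simp only [RefutedAt, mem_iUnion, mem_Iio, exists_prop, mem_inter_iff, mem_ofPred_eq]
    rw [this]
    exact .iUnion fun _ => .biUnion (to_countable _) fun e _ =>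
      .biUnion (to_countable _) fun k _ => (measurableSet_hasClaim j e k).inter (.const _)

/-- The extension of a finite word by zeros. -/
def padZeros (v : List Bool) (i : ℕ) : Bool := v.getD i false

theorem primrecPred_exists_lt {α : Type*} [Primcodable α] {p : ℕ × α → Prop} {f : α → ℕ}
    (hp : PrimrecPred p) (hf : Primrec f) : PrimrecPred fun a => ∃ x < f a, p (x, a) :=
  ((PrimrecRel.exists_mem_list (R := fun x a => p (x, a)) hp).comp (Primrec.list_range.comp hf)
    .id).of_eq (by simp)

theorem primrecPred_forall_lt {α : Type*} [Primcodable α] {p : ℕ × α → Prop} {f : α → ℕ}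
    (hp : PrimrecPred p) (hf : Primrec f) : PrimrecPred fun a => ∀ x < f a, p (x, a) :=
  ((PrimrecRel.forall_mem_list (R := fun x a => p (x, a)) hp).comp (Primrec.list_range.comp hf)
    .id).of_eq (by simp)

theorem primrecPred_padZeros {α : Type*} [Primcodable α] {v : α → List Bool} {p : α → ℕ}
    {c : Bool} (hv : Primrec v) (hp : Primrec p) : PrimrecPred fun a => padZeros (v a) (p a) = c :=
  Primrec.eq.comp ((Primrec.list_getD false).comp hv hp) (.const c)

theorem primrecPred_hasClaim :
    PrimrecPred fun a : List Bool × ℕ × ℕ × ℕ => HasClaim (padZeros a.1) a.2.1 a.2.2.1 a.2.2.2 := by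
  have hv : Primrec fun a : List Bool × ℕ × ℕ × ℕ => a.1 := .fst
  have hs : Primrec fun a : List Bool × ℕ × ℕ × ℕ => a.2.1 := Primrec.fst.comp .snd
  have he : Primrec fun a : List Bool × ℕ × ℕ × ℕ => a.2.2.1 :=
    Primrec.fst.comp (Primrec.snd.comp .snd)
  have hk : Primrec fun a : List Bool × ℕ × ℕ × ℕ => a.2.2.2 :=
    Primrec.snd.comp (Primrec.snd.comp .snd)
  have hadd : ∀ {β : Type} [Primcodable β] {f g : β → ℕ}, Primrec f → Primrec g →
      Primrec fun a => f a + g a := fun hf hg => Primrec.nat_add.comp hf hg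
  refine (primrecPred_padZeros hv hs).and <| (primrecPred_padZeros hv (hadd hs (.const 1))).and <|
    (primrecPred_padZeros hv (hadd hs (.const 2))).and <| PrimrecPred.and
    (primrecPred_forall_lt (p := fun b => padZeros b.2.1 (b.2.2.1 + 4 + b.1) = true) ?_
      (hadd he (.const 1))) <|
    (primrecPred_padZeros hv (hadd (hadd hs (.const 5)) he)).and <| PrimrecPred.and
    (primrecPred_forall_lt (p := fun b => padZeros b.2.1 (b.2.2.1 + 6 + b.2.2.2.1 + b.1) = true) ?_
      hk) <|
    primrecPred_padZeros hv (hadd (hadd (hadd hs (.const 6)) he) hk)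
  · exact primrecPred_padZeros (hv.comp .snd) (hadd (hadd (hs.comp .snd) (.const 4)) .fst)
  · exact primrecPred_padZeros (hv.comp .snd)
      (hadd (hadd (hadd (hs.comp .snd) (.const 6)) (he.comp .snd)) .fst)

theorem primrecPred_refutedAt (hK : PrimrecRel K) :
    PrimrecPred fun a : List Bool × ℕ × ℕ => RefutedAt K (padZeros a.1) a.2.1 a.2.2 := by
  have hi : Primrec fun a : List Bool × ℕ × ℕ => a.2.2 := Primrec.snd.comp .snd
  refine (Primrec.nat_le.comp (.const 2) hi).and ?_
  refine primrecPred_exists_lt (p := fun b : ℕ × List Bool × ℕ × ℕ => ∃ k < b.2.2.2 + 1,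
    HasClaim (padZeros b.2.1) b.2.2.1 b.1 k ∧ K b.1 b.2.2.2) ?_ (Primrec.succ.comp hi)
  refine primrecPred_exists_lt (p := fun c : ℕ × ℕ × List Bool × ℕ × ℕ =>
    HasClaim (padZeros c.2.2.1) c.2.2.2.1 c.2.1 c.1 ∧ K c.2.1 c.2.2.2.2) ?_
    (Primrec.succ.comp (hi.comp .snd))
  have hv : Primrec fun c : ℕ × ℕ × List Bool × ℕ × ℕ => c.2.2 := Primrec.snd.comp .snd
  have he : Primrec fun c : ℕ × ℕ × List Bool × ℕ × ℕ => c.2.1 := Primrec.fst.comp .snd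
  refine PrimrecPred.and ?_ (hK.comp he (hi.comp hv))
  exact primrecPred_hasClaim.comp (Primrec.pair (Primrec.fst.comp hv) (Primrec.pair
    (Primrec.fst.comp (Primrec.snd.comp hv)) (Primrec.pair he .fst)))

theorem primrec_claimFilter (hK : PrimrecRel K) :
    Primrec fun a : List Bool × ℕ × ℕ =>
      claimFilter K (passedStages a.2.1) (padZeros a.1) a.2.2 := by
  classical
  have hn : Primrec fun a : List Bool × ℕ × ℕ => a.2.1 := Primrec.fst.comp .snd
  have hj : Primrec fun a : List Bool × ℕ × ℕ => a.2.2 := Primrec.snd.comp .snd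
  refine Primrec.and.comp ((Primrec.list_getD false).comp .fst
    (Primrec.nat_add.comp hj (.const 3))) (Primrec.not.comp (PrimrecPred.decide ?_))
  have : PrimrecPred fun a : List Bool × ℕ × ℕ => ∃ i < a.2.2 + a.2.1,
      a.2.2 ≤ i ∧ RefutedAt K (padZeros a.1) a.2.2 i := by
    refine primrecPred_exists_lt (p := fun b : ℕ × List Bool × ℕ × ℕ =>
      b.2.2.2 ≤ b.1 ∧ RefutedAt K (padZeros b.2.1) b.2.2.2 b.1) ?_ (Primrec.nat_add.comp hj hn)
    refine (Primrec.nat_le.comp (hj.comp .snd) .fst).and ?_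
    exact (primrecPred_refutedAt hK).comp (Primrec.pair (Primrec.fst.comp .snd)
      (Primrec.pair (hj.comp .snd) .fst))
  refine this.of_eq fun a => exists_congr fun i => ?_
  rw [passedStages, mem_Ico]
  tauto

theorem cantorComputable_claimMap (hK : PrimrecRel K) : CantorComputable (claimMap K) := by
  classical
  refine ⟨fun n => 3 * n + 6, fun n l => claimMap K (padZeros l) n, ?_, ?_, fun x n => ?_⟩
  · exact (Primrec.nat_add.comp (Primrec.nat_mul.comp (.const 3) .id) (.const 6)).to_comp
  · refine Primrec.to_comp ?_
    refine Primrec.and.comp ((Primrec.list_getD false).comp .snd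
      (Primrec.succ.comp .fst)) (Primrec.not.comp (PrimrecPred.decide ?_))
    exact (primrecPred_refutedAt hK).comp (Primrec.pair .snd
      (Primrec.pair (Primrec.nat_sub.comp .fst (.const 2)) .fst))
  · refine claimMap_congr fun p hp => ?_
    simp only [padZeros]
    rw [List.getD_eq_getElem _ _ (by rw [List.length_ofFn]; omega), List.getElem_ofFn]

/-- Some element enters the domain of the machine of index `e` at stage `i`. -/
def EntersAt (e i : ℕ) : Prop :=
  (((Denumerable.ofNat Nat.Partrec.Code e).evaln (i.unpair.2 + 1) i.unpair.1).isSome = true) ∧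
    ((Denumerable.ofNat Nat.Partrec.Code e).evaln i.unpair.2 i.unpair.1).isSome = false

theorem primrecRel_entersAt : PrimrecRel EntersAt := by
  have hc : Primrec fun a : ℕ × ℕ => Denumerable.ofNat Nat.Partrec.Code a.1 :=
    (Primrec.ofNat _).comp .fst
  have h1 : Primrec fun a : ℕ × ℕ => a.2.unpair.1 := Primrec.fst.comp (Primrec.unpair.comp .snd)
  have h2 : Primrec fun a : ℕ × ℕ => a.2.unpair.2 := Primrec.snd.comp (Primrec.unpair.comp .snd)
  have h : ∀ {t : ℕ × ℕ → ℕ}, Primrec t → Primrec fun a : ℕ × ℕ =>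
      ((Denumerable.ofNat Nat.Partrec.Code a.1).evaln (t a) a.2.unpair.1).isSome := fun ht =>
    Primrec.option_isSome.comp
      (Nat.Partrec.Code.primrec_evaln.comp (Primrec.pair (Primrec.pair ht hc) h1))
  exact PrimrecPred.and (Primrec.eq.comp (h (Primrec.succ.comp h2)) (.const true))
    (Primrec.eq.comp (h h2) (.const false))

theorem finite_setOf_entersAt_iff (e : ℕ) : {i | EntersAt e i}.Finite ↔ e ∈ FinSet := by
  set c := Denumerable.ofNat Nat.Partrec.Code e with hc
  have hmono : ∀ {m n t₁ t₂ : ℕ}, t₁ ≤ t₂ → m = n → (c.evaln t₁ m).isSome = true →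
      (c.evaln t₂ n).isSome = true := by
    rintro m _ t₁ t₂ ht rfl h
    obtain ⟨x, hx⟩ := Option.isSome_iff_exists.1 h
    exact Option.isSome_iff_exists.2 ⟨x, Nat.Partrec.Code.evaln_mono ht hx⟩
  have hinj : InjOn (fun i : ℕ => i.unpair.1) {i | EntersAt e i} := by
    have key : ∀ {i j : ℕ}, EntersAt e i → EntersAt e j → i.unpair.1 = j.unpair.1 →
        i.unpair.2 ≤ j.unpair.2 := by
      intro i j hi hj hij
      by_contra! hlt
      have h1 := hmono (Nat.succ_le_of_lt hlt) hij.symm hj.1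
      rw [← hc] at *
      exact absurd (hi.2.symm.trans (hc ▸ h1)) (by simp)
    intro i hi j hj hij
    rw [← Nat.pair_unpair i, ← Nat.pair_unpair j, show i.unpair.1 = j.unpair.1 from hij,
      le_antisymm (key hi hj hij) (key hj hi hij.symm)]
  have himg : (fun i : ℕ => i.unpair.1) '' {i | EntersAt e i} = {n | (c.eval n).Dom} := by
    ext n
    constructor
    · rintro ⟨i, hi, rfl⟩
      obtain ⟨x, hx⟩ := Option.isSome_iff_exists.1 hi.1
      exact Part.dom_iff_mem.2 ⟨x, Nat.Partrec.Code.evaln_sound hx⟩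
    · intro h
      obtain ⟨x, hx⟩ := Part.dom_iff_mem.1 (show (c.eval n).Dom from h)
      obtain ⟨t, ht⟩ := Nat.Partrec.Code.evaln_complete.1 hx
      have hex : ∃ t, (c.evaln t n).isSome = true := ⟨t, Option.isSome_iff_exists.2 ⟨x, ht⟩⟩
      have h0 : Nat.find hex ≠ 0 := fun h0 => by
        have := Nat.find_spec hex
        rw [h0] at this
        simp [Nat.Partrec.Code.evaln] at this
      obtain ⟨t', ht'⟩ := Nat.exists_eq_succ_of_ne_zero h0
      refine ⟨Nat.pair n t', ⟨?_, ?_⟩, by simp⟩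
      · rw [Nat.unpair_pair, ← Nat.succ_eq_add_one, ← ht']
        exact Nat.find_spec hex
      · rw [Nat.unpair_pair, Bool.eq_false_iff]
        exact Nat.find_min hex (by omega)
  rw [← finite_image_iff hinj, himg]
  rfl

/-- The limit set of the map `claimMap K`. -/
noncomputable def claimAttractor (K : ℕ → ℕ → Prop) : Set (ℕ → Bool) :=
  closure (range fun v => claimFilter K Ici (padZeros v))

theorem frequently_padZeros (v : List Bool) : ∃ᶠ i in atTop, padZeros v i = false := by
  refine Eventually.frequently ?_
  filter_upwards [eventually_ge_atTop v.length] with i hi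
  exact List.getD_eq_default _ _ hi

theorem denseRange_padZeros : DenseRange padZeros := by
  intro y
  rw [mem_closure_iff_frequently, Filter.frequently_iff]
  intro U hU
  obtain ⟨W, hWU, hW, hyW⟩ := mem_nhds_iff.1 hU
  have hlim : Tendsto (fun M => padZeros ((List.range M).map y)) atTop (𝓝 y) := by
    refine tendsto_pi_nhds.2 fun j => tendsto_const_nhds.congr' ?_
    filter_upwards [eventually_gt_atTop j] with M hM
    simp [padZeros, List.getD_eq_getElem?_getD, hM]
  obtain ⟨M, hM⟩ := (hlim.eventually (hW.mem_nhds hyW)).exists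
  exact ⟨_, hWU hM, mem_range_self _⟩

theorem mapsTo_claimAttractor : MapsTo (claimMap K) (claimAttractor K) (claimAttractor K) := by
  refine MapsTo.closure ?_ continuous_claimMap
  rintro _ ⟨v, rfl⟩
  refine ⟨v.tail, ?_⟩
  dsimp only
  rw [claimMap_claimFilter_Ici]
  congr 1
  ext i
  simp [padZeros, shiftMap, List.getD_eq_getElem?_getD]

theorem mem_cyl_iff {w : List Bool} {x : ℕ → Bool} :
    x ∈ cyl w ↔ ∀ j < w.length, x j = padZeros w j := by
  constructor
  · intro h j hj
    rw [padZeros, List.getD_eq_getElem _ _ hj]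
    exact h ⟨j, hj⟩
  · intro h j
    rw [h j j.2, padZeros, List.getD_eq_getElem _ _ j.2]
    rfl

theorem isOpen_cyl (w : List Bool) : IsOpen (cyl w) := by
  have : cyl w = ⋂ i : Fin w.length, (fun x : ℕ → Bool => x i) ⁻¹' {w.get i} := by
    ext
    simp [cyl]
  rw [this]
  exact isOpen_iInter_of_finite fun i =>
    (isOpen_discrete _).preimage (continuous_apply (A := fun _ : ℕ => Bool) (i : ℕ))

theorem cyl_inter_claimAttractor_nonempty_iff {w : List Bool} :
    (cyl w ∩ claimAttractor K).Nonempty ↔ ∃ v, claimFilter K Ici (padZeros v) ∈ cyl w := by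
  rw [inter_comm, claimAttractor, closure_inter_open_nonempty_iff (isOpen_cyl w)]
  constructor
  · rintro ⟨_, ⟨v, rfl⟩, h⟩
    exact ⟨v, h⟩
  · rintro ⟨v, h⟩
    exact ⟨_, ⟨v, rfl⟩, h⟩

theorem sigmaTwo_claimAttractor (hK : PrimrecRel K) :
    SigmaTwo {w : List Bool | (cyl w ∩ claimAttractor K).Nonempty} := by
  classical
  set D : ℕ → List Bool × ℕ := fun a => (Encodable.decode (α := List Bool × ℕ) a).getD ([], 0)
  have hD : Primrec D := Primrec.option_getD.comp Primrec.decode (.const ([], 0))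
  refine ⟨fun q => decide (∀ j < q.1.length,
    claimFilter K (passedStages ((D q.2.1).2 + q.2.2)) (padZeros (D q.2.1).1) j = padZeros q.1 j),
    Primrec.to_comp (PrimrecPred.decide ?_), fun w => ?_⟩
  · refine primrecPred_forall_lt (p := fun b : ℕ × List Bool × ℕ × ℕ =>
      claimFilter K (passedStages ((D b.2.2.1).2 + b.2.2.2)) (padZeros (D b.2.2.1).1) b.1 =
        padZeros b.2.1 b.1) ?_ (Primrec.list_length.comp .fst)
    have hw : Primrec fun b : ℕ × List Bool × ℕ × ℕ => b.2.1 := Primrec.fst.comp .snd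
    have ha : Primrec fun b : ℕ × List Bool × ℕ × ℕ => D b.2.2.1 :=
      hD.comp (Primrec.fst.comp (Primrec.snd.comp .snd))
    have hb : Primrec fun b : ℕ × List Bool × ℕ × ℕ => b.2.2.2 :=
      Primrec.snd.comp (Primrec.snd.comp .snd)
    exact Primrec.eq.comp ((primrec_claimFilter hK).comp (Primrec.pair (Primrec.fst.comp ha)
      (Primrec.pair (Primrec.nat_add.comp (Primrec.snd.comp ha) hb) .fst)))
      ((Primrec.list_getD false).comp hw .fst)
  · simp only [decide_eq_true_eq, ← mem_cyl_iff]
    rw [mem_ofPred_eq, cyl_inter_claimAttractor_nonempty_iff]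
    constructor
    · rintro ⟨v, hv⟩
      obtain ⟨N, hN⟩ := eventually_atTop.1
        ((tendsto_claimFilter (padZeros v)).eventually ((isOpen_cyl w).mem_nhds hv))
      refine ⟨Encodable.encode (v, N), fun b => ?_⟩
      have hDe : D (Encodable.encode (v, N)) = (v, N) := by simp [D]
      rw [hDe]
      exact hN (N + b) (Nat.le_add_right _ _)
    · rintro ⟨a, ha⟩
      refine ⟨(D a).1, mem_cyl_iff.2 fun j hj => ?_⟩
      obtain ⟨N, hN⟩ := eventually_atTop.1 (claimFilter_eventually_eq (K := K) (padZeros (D a).1) j)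
      rw [← hN ((D a).2 + N) (Nat.le_add_left _ _)]
      exact mem_cyl_iff.1 (ha N) j hj

/-- The common prefix `0 0 1 1 1^{e+1} 0` of the claims with parameter `e`. -/
def claimStem (e : ℕ) : List Bool :=
  (List.range (e + 6)).map fun p => decide (2 ≤ p ∧ p ≠ e + 5)

theorem primrec_claimStem : Primrec claimStem := by
  refine Primrec.list_map (Primrec.list_range.comp (Primrec.nat_add.comp .id (.const 6))) ?_
  refine PrimrecPred.decide (PrimrecPred.and ?_ (PrimrecPred.not ?_))
  · exact Primrec.nat_le.comp (.const 2) .snd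
  · exact Primrec.eq.comp .snd (Primrec.nat_add.comp .fst (.const 5))

theorem mem_cyl_claimStem {e : ℕ} {x : ℕ → Bool} :
    x ∈ cyl (claimStem e) ↔ ∀ p < e + 6, x p = decide (2 ≤ p ∧ p ≠ e + 5) := by
  rw [mem_cyl_iff]
  simp only [claimStem, List.length_map, List.length_range]
  refine forall₂_congr fun p hp => ?_
  simp [padZeros, List.getD_eq_getElem?_getD, hp]

theorem cyl_claimStem_inter_nonempty_iff {e : ℕ} :
    (cyl (claimStem e) ∩ claimAttractor K).Nonempty ↔ {i | K e i}.Finite := by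
  rw [cyl_inter_claimAttractor_nonempty_iff]
  constructor
  · rintro ⟨v, hv⟩
    by_contra hinf
    set y := padZeros v
    rw [mem_cyl_claimStem] at hv
    have hex : ∃ k, claimFilter K Ici y (6 + e + k) = false := by
      refine ⟨v.length, Bool.eq_false_iff.2 fun h => ?_⟩
      rw [claimFilter_eq_true] at h
      have : y (6 + e + v.length + 3) = false := List.getD_eq_default _ _ (by omega)
      exact absurd (this.symm.trans h.1) (by simp)
    have hclaim : HasClaim (claimFilter K Ici y) 0 e (Nat.find hex) := by
      refine ⟨?_, ?_, ?_, fun r hr => ?_, ?_, fun r hr => ?_, ?_⟩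
      · simpa using hv 0 (by omega)
      · simpa using hv 1 (by omega)
      · simpa using hv 2 (by omega)
      · rw [hv _ (by omega)]
        simp
        omega
      · rw [hv _ (by omega)]
        simp
        omega
      · rw [Nat.zero_add]
        simpa using Nat.find_min hex hr
      · rw [Nat.zero_add]
        exact Nat.find_spec hex
    rw [hasClaim_claimFilter] at hclaim
    obtain ⟨i, hi, hgt⟩ := (Set.not_finite.1 hinf).exists_gt (e + Nat.find hex + 3)
    have h3 := (hv 3 (by omega)).trans (decide_eq_true (by omega))
    rw [claimFilter_eq_true] at h3
    exact h3.2 i (show 3 ≤ i by omega)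
      ⟨by omega, e, by omega, Nat.find hex, by omega, hclaim, hi⟩
  · intro hfin
    obtain ⟨N, hN⟩ := hfin.bddAbove
    set v := (List.range (e + 10 + N)).map fun p =>
      decide (p < 3 ∨ (5 ≤ p ∧ p ≠ e + 8)) with hv
    have hy : ∀ p, padZeros v p = true ↔
        p < e + 10 + N ∧ (p < 3 ∨ (5 ≤ p ∧ p ≠ e + 8)) := by
      intro p
      by_cases hp : p < e + 10 + N <;> simp [padZeros, List.getD_eq_getElem?_getD, hv, hp]
    have hy' : ∀ p, padZeros v p = false ↔
        ¬ (p < e + 10 + N ∧ (p < 3 ∨ (5 ≤ p ∧ p ≠ e + 8))) := by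
      intro p
      rw [← hy, Bool.not_eq_true]
    refine ⟨v, mem_cyl_claimStem.2 fun p hp => ?_⟩
    rw [Bool.eq_iff_iff, claimFilter_eq_true, hy, decide_eq_true_iff]
    refine ⟨fun h => by omega, fun h => ⟨by omega, ?_⟩⟩
    rintro i - ⟨-, e', he', k, hk, hc, hK⟩
    obtain ⟨h0, h1, h2, h3, h4, h5, h6⟩ := hc
    simp only [hy, hy'] at h0 h1 h2 h3 h4 h5 h6
    obtain rfl : p = 3 := by omega
    obtain rfl : e' = e := by
      by_contra hne
      have := h3 (e + 1)
      omega
    have : i ≤ N := hN hK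
    omega

theorem tendsto_average_of_shift {u : ℕ → ℝ} {L : ℝ} (k : ℕ)
    (h : Tendsto (fun n : ℕ => (n : ℝ)⁻¹ * ∑ i ∈ Finset.range n, u (i + k)) atTop (𝓝 L)) :
    Tendsto (fun n : ℕ => (n : ℝ)⁻¹ * ∑ i ∈ Finset.range n, u i) atTop (𝓝 L) := by
  rw [← tendsto_add_atTop_iff_nat k]
  have h1 : Tendsto (fun n : ℕ => (n : ℝ) / (n + k)) atTop (𝓝 1) :=
    tendsto_natCast_div_add_atTop (k : ℝ)
  have h2 : Tendsto (fun n : ℕ => (∑ i ∈ Finset.range k, u i) / ((n + k : ℕ) : ℝ)) atTop (𝓝 0) :=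
    (tendsto_add_atTop_iff_nat k).2 (tendsto_const_div_atTop_nhds_zero_nat _)
  have h3 := (h1.mul h).add h2
  rw [one_mul, add_zero] at h3
  refine h3.congr' ?_
  filter_upwards [eventually_gt_atTop 0] with n hn
  have hn' : (0 : ℝ) < n := by exact_mod_cast hn
  rw [add_comm n k, Finset.sum_range_add]
  simp only [add_comm k]
  push_cast
  field_simp
  ring

theorem integral_empMeasure {X : Type*} [TopologicalSpace X] [MeasurableSpace X] [BorelSpace X]
    [CompactSpace X] (T : X → X) (x : X) (n : ℕ) (φ : C(X, ℝ)) :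
    ∫ z, φ z ∂(empMeasure T x n) = (n : ℝ)⁻¹ * ∑ i ∈ Finset.range n, φ (T^[i] x) := by
  rw [empMeasure, integral_smul_measure, integral_finsetSum_measure]
  · simp [integral_dirac' _ _ φ.continuous.stronglyMeasurable]
  · exact fun i _ => Integrable.of_bound φ.continuous.aestronglyMeasurable ‖φ‖
      (.of_forall φ.norm_coe_le_norm)

/-- Weak convergence of empirical measures can be tested on a dense set of observables. -/
theorem weakTendsto_empMeasure_of_dense {X : Type*} [TopologicalSpace X] [MeasurableSpace X]
    [BorelSpace X] [CompactSpace X] {T : X → X} {x : X} {μ : Measure X} [IsProbabilityMeasure μ]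
    {s : Set C(X, ℝ)} (hs : Dense s)
    (h : ∀ φ ∈ s, Tendsto (fun n : ℕ => (n : ℝ)⁻¹ * ∑ i ∈ Finset.range n, φ (T^[i] x)) atTop
      (𝓝 (∫ z, φ z ∂μ))) :
    WeakTendsto (empMeasure T x) μ := by
  intro φ
  simp only [integral_empMeasure]
  rw [Metric.tendsto_atTop]
  intro ε hε
  obtain ⟨ψ, hψs, hψ⟩ := Metric.dense_iff.1 hs φ (ε / 3) (by positivity)
  |>.imp fun ψ h => And.intro h.2 h.1
  obtain ⟨N, hN⟩ := Metric.tendsto_atTop.1 (h ψ hψs) (ε / 3) (by positivity)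
  have hd : ∀ z, |φ z - ψ z| ≤ ε / 3 := fun z => by
    rw [← Real.dist_eq, dist_comm]
    exact (ContinuousMap.dist_apply_le_dist z).trans (Metric.mem_ball.1 hψ).le
  have hInt : ∀ φ : C(X, ℝ), Integrable φ μ := fun φ =>
    Integrable.of_bound φ.continuous.aestronglyMeasurable ‖φ‖ (.of_forall φ.norm_coe_le_norm)
  have hi : |∫ z, φ z ∂μ - ∫ z, ψ z ∂μ| ≤ ε / 3 := by
    rw [← integral_sub (hInt φ) (hInt ψ)]
    have := norm_integral_le_of_norm_le_const (μ := μ) (f := fun z => φ z - ψ z)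
      (.of_forall hd)
    simpa using this
  refine ⟨N, fun n hn => ?_⟩
  have ha : |(n : ℝ)⁻¹ * ∑ i ∈ Finset.range n, φ (T^[i] x) -
      (n : ℝ)⁻¹ * ∑ i ∈ Finset.range n, ψ (T^[i] x)| ≤ ε / 3 := by
    rw [← mul_sub, ← Finset.sum_sub_distrib, abs_mul, abs_of_nonneg (by positivity)]
    rcases Nat.eq_zero_or_pos n with rfl | hn0
    · simpa using (div_pos hε three_pos).le
    · rw [inv_mul_le_iff₀ (by exact_mod_cast hn0)]
      refine (Finset.abs_sum_le_sum_abs _ _).trans ((Finset.sum_le_sum fun i _ => hd _).trans ?_)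
      simp
  have hb := hN n hn
  rw [Real.dist_eq] at hb ⊢
  rw [abs_le] at ha hi
  rw [abs_lt] at hb ⊢
  constructor <;> linarith

theorem ae_frequently_eq_false {lam : Measure (ℕ → Bool)} [IsProbabilityMeasure lam]
    (herg : Ergodic shiftMap lam) (hsupp : measSupport lam = univ) :
    ∀ᵐ y ∂lam, ∃ᶠ i in atTop, y i = false := by
  set o : ℕ → Bool := fun _ => true with ho
  have hle : ({o} : Set (ℕ → Bool)) ≤ᵐ[lam] shiftMap ⁻¹' {o} := by
    refine LE.le.eventuallyLE ?_
    rintro _ rfl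
    rfl
  have ho0 : lam {o} = 0 := by
    rcases herg.ae_empty_or_univ_of_ae_le_preimage (measurableSet_singleton o).nullMeasurableSet
      hle with h | h
    · rwa [ae_eq_empty] at h
    · exfalso
      have hc : IsOpen ({o}ᶜ : Set (ℕ → Bool)) := isOpen_compl_singleton
      have hmem : (fun _ => false : ℕ → Bool) ∈ measSupport lam := hsupp ▸ mem_univ _
      have := hmem _ hc (fun h => by simpa [ho] using congrFun h 0)
      rw [ae_eq_univ] at h
      exact this.ne' h
  have hn : ∀ n : ℕ, ∀ᵐ y ∂lam, shiftMap^[n] y ≠ o := fun n => by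
    have := (herg.toMeasurePreserving.iterate n).measure_preimage
      (measurableSet_singleton o).nullMeasurableSet
    rw [ho0] at this
    exact measure_eq_zero_iff_ae_notMem.1 this
  filter_upwards [ae_all_iff.2 hn] with y hy
  rw [frequently_atTop]
  intro n
  by_contra! hcon
  refine hy n (funext fun i => ?_)
  rw [iterate_shiftMap_apply]
  simpa using hcon (i + n) (Nat.le_add_left _ _)

theorem measSupport_map_claimFilter {lam : Measure (ℕ → Bool)} [IsProbabilityMeasure lam]
    (herg : Ergodic shiftMap lam) (hsupp : measSupport lam = univ) :
    measSupport (lam.map (claimFilter K Ici)) = claimAttractor K := by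
  ext z
  constructor
  · intro hz
    rw [claimAttractor, mem_closure_iff]
    intro U hU hzU
    have hpos := hz U hU hzU
    rw [Measure.map_apply measurable_claimFilter hU.measurableSet] at hpos
    obtain ⟨y, hyU, hy⟩ : ∃ y ∈ claimFilter K Ici ⁻¹' U, ∃ᶠ i in atTop, y i = false := by
      by_contra hcon
      refine hpos.ne' (measure_mono_null (fun y hyU => ?_) (ae_frequently_eq_false herg hsupp))
      exact fun h => hcon ⟨y, hyU, h⟩
    obtain ⟨v, hv⟩ := mem_closure_iff_nhds.1 (denseRange_padZeros y) _
      ((continuousAt_claimFilter hy).preimage_mem_nhds (hU.mem_nhds hyU))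
    obtain ⟨hvU, v, rfl⟩ := hv
    exact ⟨_, hvU, v, rfl⟩
  · intro hz U hU hzU
    obtain ⟨_, hvU, v, rfl⟩ := mem_closure_iff.1 hz U hU hzU
    obtain ⟨V, hVU, hV, hvV⟩ := mem_nhds_iff.1
      ((continuousAt_claimFilter (frequently_padZeros v)).preimage_mem_nhds (hU.mem_nhds hvU))
    have hmem : padZeros v ∈ measSupport lam := hsupp ▸ mem_univ _
    rw [Measure.map_apply measurable_claimFilter hU.measurableSet]
    exact (hmem V hV hvV).trans_le (measure_mono hVU)

theorem isStatAttractor_claimAttractor {lam : Measure (ℕ → Bool)} [IsProbabilityMeasure lam]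
    (herg : Ergodic shiftMap lam) (hsupp : measSupport lam = univ) :
    IsStatAttractor (claimMap K) lam (claimAttractor K) := by
  have hprob : IsProbabilityMeasure (lam.map (claimFilter K Ici)) :=
    Measure.isProbabilityMeasure_map measurable_claimFilter.aemeasurable
  refine ⟨isClosed_closure, lam.map (claimFilter K Ici), hprob, ?_,
    measSupport_map_claimFilter herg hsupp, ?_⟩
  · rw [Measure.map_map continuous_claimMap.measurable measurable_claimFilter]
    have : claimMap K ∘ claimFilter K Ici = claimFilter K Ici ∘ shiftMap :=
      funext claimMap_claimFilter_Ici
    rw [this, ← Measure.map_map measurable_claimFilter herg.measurable, herg.map_eq]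
  · obtain ⟨s, hsc, hsd⟩ := TopologicalSpace.exists_countable_dense C(ℕ → Bool, ℝ)
    have hall : ∀ᵐ x ∂lam, ∀ φ ∈ s, Tendsto (fun n : ℕ => (n : ℝ)⁻¹ *
        ∑ i ∈ Finset.range n, φ (claimFilter K (passedStages (i + 3)) (shiftMap^[i] x))) atTop
        (𝓝 (∫ y, φ (claimFilter K Ici y) ∂lam)) := by
      rw [ae_ball_iff hsc]
      intro φ _
      exact herg.ae_tendsto_average
        (f := fun n y => φ (claimFilter K (passedStages (n + 3)) y))
        (fun n => φ.continuous.measurable.comp measurable_claimFilter)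
        (fun n y => φ.norm_coe_le_norm _)
        (fun y => (φ.continuous.tendsto _).comp
          ((tendsto_add_atTop_iff_nat 3).2 (tendsto_claimFilter y)))
    filter_upwards [hall] with x hx
    refine weakTendsto_empMeasure_of_dense hsd fun φ hφ => tendsto_average_of_shift 3 ?_
    rw [integral_map measurable_claimFilter.aemeasurable φ.continuous.aestronglyMeasurable]
    simpa only [claimMap_iterate_add] using hx φ hφ

end claims

/-- A Σ₂-complete statistical attractor: a computable map of the Cantor space `{0,1}^ℕ` with a
closed invariant set `A` whose inner collection is Σ₂ and Σ₂-complete (`Fin` many-one reduces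
to it), and which is a statistical attractor w.r.t. every shift-ergodic fully supported
reference measure. -/
theorem stmt16 :
    ∃ (T : (ℕ → Bool) → (ℕ → Bool)) (A : Set (ℕ → Bool)),
      CantorComputable T ∧ IsClosed A ∧ Set.MapsTo T A A ∧
      -- (i)
      SigmaTwo {w : List Bool | (cyl w ∩ A).Nonempty} ∧
      ((fun e : ℕ => e ∈ FinSet) ≤₀ fun w : List Bool => (cyl w ∩ A).Nonempty) ∧
      -- (ii)
      (∀ lam : Measure (ℕ → Bool), IsProbabilityMeasure lam → Ergodic shiftMap lam →
        measSupport lam = Set.univ → IsStatAttractor T lam A) := by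
  refine ⟨claimMap EntersAt, claimAttractor EntersAt, cantorComputable_claimMap primrecRel_entersAt,
    isClosed_closure, mapsTo_claimAttractor, sigmaTwo_claimAttractor primrecRel_entersAt,
    ⟨claimStem, primrec_claimStem.to_comp, fun e => ?_⟩,
    fun lam _ herg hsupp => isStatAttractor_claimAttractor herg hsupp⟩
  exact (cyl_claimStem_inter_nonempty_iff.trans (finite_setOf_entersAt_iff e)).symm
end

section
/- Let T : X → X be a computable map of the Cantor space X over the alphabet {0,1}. Then there exist a Cantor set (nonempty, compact, perfect, totally disconnected) 𝒞 ⊆ [0,1] which is a computable closed subset of [0,1], a homeomorphism φ : X → 𝒞 which is computable, and a computable map f : [0,1] → [0,1] with f(𝒞) ⊆ 𝒞, such that: (1) φ(T(x)) = f(φ(x)) for all x ∈ X; (2) for Lebesgue-almost every x ∈ [0,1], ω_f(x) ⊆ 𝒞; (3) if A ⊆ X is a metric attractor of T with respect to the uniform Bernoulli(1/2,1/2) measure on X, then φ(A) is a metric attractor of f with respect to Lebesgue measure on [0,1], and if A ⊆ X is a statistical attractor of T with respect to the uniform Bernoulli(1/2,1/2) measure, then φ(A) is a statistical attractor of f with respect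 to Lebesgue measure. -/
open Filter Topology MeasureTheory Set
open scoped ENNReal NNReal

/-- A map `f : [0,1] → [0,1]` is computable: there are computable `m : ℕ → ℕ` and
`ψ : ℚ × ℕ → ℚ` such that whenever `x ∈ [0,1]` and `|x - q| ≤ 2^{-m n}`,
`|f x - ψ (q, n)| ≤ 2^{-n}`. -/
def ComputableRealMap (f : ℝ → ℝ) : Prop :=
  ∃ (m : ℕ → ℕ) (ψ : ℚ × ℕ → ℚ), Computable m ∧ Computable ψ ∧
    ∀ x ∈ Set.Icc (0:ℝ) 1, ∀ (q : ℚ) (n : ℕ),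
      |x - (q : ℝ)| ≤ 1 / 2 ^ (m n) → |f x - (ψ (q, n) : ℝ)| ≤ 1 / 2 ^ n

/-- A map `φ` from Cantor space to ℝ is computable: a rational `2^{-n}`-approximation of `φ x`
is computed from `n` and the finite prefix `[x 0, …, x (k n)]` of `x`. -/
def ComputableCantorRealMap (φ : (ℕ → Bool) → ℝ) : Prop :=
  ∃ (k : ℕ → ℕ) (Φ : ℕ × List Bool → ℚ), Computable k ∧ Computable Φ ∧
    ∀ (x : ℕ → Bool) (n : ℕ),
      |φ x - (Φ (n, List.ofFn fun i : Fin (k n + 1) => x i) : ℝ)| ≤ 1 / 2 ^ n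

/-- A closed `K ⊆ [0,1]` is a computable closed set: both the rational open intervals meeting
`K` and the rational closed intervals missing `K` are Σ₁. -/
def ComputableClosedReal (K : Set ℝ) : Prop :=
  SigmaOne {p : ℚ × ℚ | p.1 < p.2 ∧ (Set.Ioo (p.1 : ℝ) (p.2 : ℝ) ∩ K).Nonempty} ∧
  SigmaOne {p : ℚ × ℚ | p.1 < p.2 ∧ Set.Icc (p.1 : ℝ) (p.2 : ℝ) ∩ K = ∅}

/-- A Borel probability measure on `[0,1] ⊆ ℝ` is computable if the measures of finite unions
of rational open intervals are uniformly lower-computable. -/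
def ComputableIntervalMeasure (μ : MeasureTheory.Measure ℝ) : Prop :=
  ∃ q : List (ℚ × ℚ) × ℕ → ℚ, Computable q ∧
    ∀ W : List (ℚ × ℚ),
      (μ (⋃ p ∈ W, Set.Ioo (p.1 : ℝ) (p.2 : ℝ))).toReal = ⨆ k, (q (W, k) : ℝ)

/-! ### Computable functions by search -/

theorem exists_computable_choice {A B : Type*} [Primcodable A] [Primcodable B]
    {R : A → B → Bool} (hR : Computable₂ R) (h : ∀ a, ∃ b, R a b = true) :
    ∃ g : A → B, Computable g ∧ ∀ a, R a (g a) = true := by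
  let F : A → ℕ → Option B := fun a n =>
    (Encodable.decode (α := B) n).bind fun b => bif R a b then some b else none
  have hF : Computable₂ F := by
    refine Computable.option_bind (Computable.decode.comp Computable.snd) ?_
    exact Computable.cond (hR.comp (Computable.fst.comp Computable.fst) Computable.snd)
      (Computable.option_some.comp Computable.snd) (Computable.const none)
  have hdom : ∀ a, (Nat.rfindOpt (F a)).Dom := by
    intro a
    obtain ⟨b, hb⟩ := h a
    refine Nat.rfindOpt_dom.2 ⟨Encodable.encode b, b, ?_⟩
    simp [F, hb]
  refine ⟨fun a => (Nat.rfindOpt (F a)).get (hdom a), ?_, ?_⟩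
  · exact (Partrec.rfindOpt hF).of_eq fun a => by simp
  · intro a
    obtain ⟨n, hn⟩ := Nat.rfindOpt_spec (Part.get_mem (hdom a))
    simp only [F, Option.mem_def, Option.bind_eq_some_iff] at hn
    obtain ⟨b, -, hb⟩ := hn
    cases hRb : R a b <;> simp [hRb] at hb
    change R a ((Nat.rfindOpt (F a)).get (hdom a)) = true
    rw [← hb, hRb]

theorem computable_of_graph {A B : Type*} [Primcodable A] [Primcodable B] [DecidableEq B]
    {f : A → B} (hf : Computable fun p : A × B => decide (f p.1 = p.2)) : Computable f := by
  obtain ⟨g, hg, h⟩ := exists_computable_choice (R := fun a b => decide (f a = b)) hf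
    fun a => ⟨f a, by simp⟩
  exact hg.of_eq fun a => (by simpa using h a : f a = g a).symm

theorem computable_ite {A B : Type*} [Primcodable A] [Primcodable B] {c : A → Prop}
    [DecidablePred c] {f g : A → B} (hc : Computable fun a => decide (c a)) (hf : Computable f)
    (hg : Computable g) : Computable fun a => if c a then f a else g a :=
  (Computable.cond hc hf hg).of_eq fun a => by by_cases h : c a <;> simp [h]

theorem computable_decide_and {A : Type*} [Primcodable A] {c d : A → Prop} [DecidablePred c]
    [DecidablePred d] (hc : Computable fun a => decide (c a))
    (hd : Computable fun a => decide (d a)) : Computable fun a => decide (c a ∧ d a) :=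
  (Primrec.and.to_comp.comp hc hd).of_eq fun a => by simp

theorem computable_decide_or {A : Type*} [Primcodable A] {c d : A → Prop} [DecidablePred c]
    [DecidablePred d] (hc : Computable fun a => decide (c a))
    (hd : Computable fun a => decide (d a)) : Computable fun a => decide (c a ∨ d a) :=
  (Primrec.or.to_comp.comp hc hd).of_eq fun a => by simp

theorem computable_nat_le {A : Type*} [Primcodable A] {f g : A → ℕ} (hf : Computable f)
    (hg : Computable g) : Computable fun a => decide (f a ≤ g a) :=
  Primrec.nat_le.decide.to_comp.comp hf hg

theorem computable_nat_lt {A : Type*} [Primcodable A] {f g : A → ℕ} (hf : Computable f)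
    (hg : Computable g) : Computable fun a => decide (f a < g a) :=
  Primrec.nat_lt.decide.to_comp.comp hf hg

theorem computable_nat_eq {A : Type*} [Primcodable A] {f g : A → ℕ} (hf : Computable f)
    (hg : Computable g) : Computable fun a => decide (f a = g a) :=
  Primrec.eq.decide.to_comp.comp hf hg

/-! ### Computability of rational arithmetic -/

/-- The code of a rational number for the encoding by numerator and denominator. -/
def ratCode (q : ℚ) : ℕ := @Encodable.encode ℚ Rat.instEncodable q

theorem ratCode_eq (q : ℚ) : ratCode q = Nat.pair (Encodable.encode q.num) q.den := rfl

theorem primrecPred_coprime : PrimrecPred fun p : ℕ × ℕ => p.1.Coprime p.2 := by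
  have hdvd : PrimrecRel fun x y : ℕ => x ∣ y := by
    refine ((Primrec.eq.comp (Primrec.nat_mod.comp Primrec.snd Primrec.fst)
      (Primrec.const 0)) : PrimrecPred fun p : ℕ × ℕ => p.2 % p.1 = 0).of_eq fun p => ?_
    exact (Nat.dvd_iff_mod_eq_zero).symm
  have h1 : PrimrecRel fun (x : ℕ) (p : ℕ × ℕ) => ¬ (x ∣ p.1 ∧ x ∣ p.2 ∧ x ≠ 1) := by
    refine PrimrecPred.not (PrimrecPred.and ?_ (PrimrecPred.and ?_ (PrimrecPred.not ?_)))
    · exact hdvd.comp Primrec.fst (Primrec.fst.comp Primrec.snd)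
    · exact hdvd.comp Primrec.fst (Primrec.snd.comp Primrec.snd)
    · exact Primrec.eq.comp Primrec.fst (Primrec.const 1)
  have h2 := h1.forall_mem_list.comp
    (Primrec.list_range.comp (Primrec.nat_add.comp
      (Primrec.nat_add.comp Primrec.fst Primrec.snd) (Primrec.const 3))) Primrec.id
  refine h2.of_eq fun p => ?_
  simp only [id, List.mem_range]
  constructor
  · intro h
    have := h (p.1.gcd p.2)
    by_contra hc
    by_cases h0 : p.1 = 0 ∧ p.2 = 0
    · exact h 2 (by omega) ⟨by simp [h0.1], by simp [h0.2], by norm_num⟩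
    · refine this ?_ ⟨Nat.gcd_dvd_left _ _, Nat.gcd_dvd_right _ _, hc⟩
      by_cases h1 : p.1 = 0
      · have : p.2 ≠ 0 := fun h => h0 ⟨h1, h⟩
        have := Nat.gcd_le_right p.1 (Nat.pos_of_ne_zero this)
        omega
      · have := Nat.gcd_le_left p.2 (Nat.pos_of_ne_zero h1)
        omega
  · rintro h x - ⟨h1, h2, h3⟩
    exact h3 (Nat.eq_one_of_dvd_coprimes h h1 h2)

theorem mem_range_ratCode (k : ℕ) : k ∈ Set.range ratCode ↔
    0 < k.unpair.2 ∧ (k.unpair.1 / 2 + k.unpair.1 % 2).Coprime k.unpair.2 := by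
  have key : ∀ z : ℤ, (Encodable.encode z) / 2 + (Encodable.encode z) % 2 = z.natAbs := by
    intro z
    cases z with
    | ofNat n => change (2 * n) / 2 + (2 * n) % 2 = n; omega
    | negSucc n => change (2 * n + 1) / 2 + (2 * n + 1) % 2 = n + 1; omega
  constructor
  · rintro ⟨q, rfl⟩
    rw [ratCode_eq, Nat.unpair_pair, key]
    exact ⟨q.pos, q.reduced⟩
  · rintro ⟨h1, h2⟩
    obtain ⟨z, hz⟩ : ∃ z : ℤ, Encodable.encode z = k.unpair.1 :=
      ⟨Denumerable.ofNat ℤ k.unpair.1, Denumerable.encode_ofNat _⟩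
    rw [← hz, key] at h2
    refine ⟨⟨z, k.unpair.2, h1.ne', h2⟩, ?_⟩
    rw [ratCode_eq]
    simp [hz]

theorem ratCode_ofNat : ∃ h : ℕ → ℕ, StrictMono h ∧ Set.range h = Set.range ratCode ∧
    ∀ n, ratCode (Denumerable.ofNat ℚ n) = h n := by
  let _ := @Encodable.decidableRangeEncode ℚ Rat.instEncodable
  have hinf : Infinite (Set.range (@Encodable.encode ℚ Rat.instEncodable)) :=
    Infinite.of_injective _ (Equiv.ofInjective _ Encodable.encode_injective).injective
  refine ⟨fun n => (Nat.Subtype.ofNat (Set.range (@Encodable.encode ℚ Rat.instEncodable)) n : ℕ),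
    strictMono_nat_of_lt_succ fun n => Nat.Subtype.lt_succ_self _,
    Nat.Subtype.coe_comp_ofNat_range, fun n => ?_⟩
  have h := (@Encodable.equivRangeEncode ℚ Rat.instEncodable).apply_symm_apply
    (Nat.Subtype.ofNat (Set.range (@Encodable.encode ℚ Rat.instEncodable)) n)
  exact congrArg Subtype.val h

theorem computable_ratCode : Computable ratCode := by
  obtain ⟨h, hmono, hrange, hh⟩ := ratCode_ofNat
  have hmem : PrimrecPred fun k : ℕ => k ∈ Set.range ratCode := by
    have h1 : Primrec fun k : ℕ => k.unpair.1 := Primrec.fst.comp Primrec.unpair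
    have h2 : Primrec fun k : ℕ => k.unpair.2 := Primrec.snd.comp Primrec.unpair
    refine (PrimrecPred.and (Primrec.nat_lt.comp (Primrec.const 0) h2)
      (primrecPred_coprime.comp (Primrec.pair (Primrec.nat_add.comp
        (Primrec.nat_div.comp h1 (Primrec.const 2)) (Primrec.nat_mod.comp h1 (Primrec.const 2)))
        h2))).of_eq fun k => (mem_range_ratCode k).symm
  classical
  have hcount : Computable fun k => Nat.count (· ∈ Set.range ratCode) k := by
    refine (Computable.nat_rec (f := fun k : ℕ => k) (g := fun _ => 0)
      (h := fun _ p => if p.1 ∈ Set.range ratCode then p.2 + 1 else p.2)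
      Computable.id (Computable.const 0) ?_).of_eq ?_
    · have : Primrec fun p : ℕ × ℕ × ℕ => if p.2.1 ∈ Set.range ratCode then p.2.2 + 1 else p.2.2 :=
        Primrec.ite (hmem.comp (Primrec.fst.comp Primrec.snd))
          (Primrec.succ.comp (Primrec.snd.comp Primrec.snd)) (Primrec.snd.comp Primrec.snd)
      exact this.to_comp.to₂
    · intro k
      induction k with
      | zero => simp
      | succ k ih =>
        rw [Nat.count_succ, ← ih]
        change ite _ _ _ = _
        split_ifs <;> rfl
  have hcount_h : ∀ n, Nat.count (· ∈ Set.range ratCode) (h n) = n := by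
    intro n
    rw [Nat.count_eq_card_filter_range]
    have : (Finset.range (h n)).filter (· ∈ Set.range ratCode) = (Finset.range n).image h := by
      ext k
      simp only [Finset.mem_filter, Finset.mem_range, Finset.mem_image, ← hrange]
      constructor
      · rintro ⟨hk, m, rfl⟩
        exact ⟨m, hmono.lt_iff_lt.1 hk, rfl⟩
      · rintro ⟨m, hm, rfl⟩
        exact ⟨hmono hm, m, rfl⟩
    rw [this, Finset.card_image_of_injective _ hmono.injective, Finset.card_range]
  have hcomp : Computable h := by
    refine computable_of_graph ?_
    refine (computable_decide_and (c := fun p : ℕ × ℕ => p.2 ∈ Set.range ratCode)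
      (d := fun p => Nat.count (· ∈ Set.range ratCode) p.2 = p.1)
      (hmem.decide.to_comp.comp Computable.snd)
      (computable_nat_eq (hcount.comp Computable.snd) Computable.fst)).of_eq fun p => ?_
    rw [decide_eq_decide]
    constructor
    · rintro ⟨h1, h2⟩
      rw [← hrange] at h1
      obtain ⟨m, hm⟩ := h1
      rw [← hm, hcount_h] at h2
      rw [← h2, hm]
    · intro h1
      rw [← h1]
      exact ⟨hrange ▸ ⟨p.1, rfl⟩, hcount_h _⟩
  refine (hcomp.comp Computable.encode).of_eq fun q => ?_
  rw [← hh, Denumerable.ofNat_encode]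

theorem computable_rat_num_toNat : Computable fun q : ℚ => q.num.toNat := by
  have h : Primrec fun k : ℕ => if k.unpair.1 % 2 = 0 then k.unpair.1 / 2 else 0 := by
    have h1 : Primrec fun k : ℕ => k.unpair.1 := Primrec.fst.comp Primrec.unpair
    exact Primrec.ite (Primrec.eq.comp (Primrec.nat_mod.comp h1 (Primrec.const 2))
      (Primrec.const 0)) (Primrec.nat_div.comp h1 (Primrec.const 2)) (Primrec.const 0)
  refine (h.to_comp.comp computable_ratCode).of_eq fun q => ?_
  rw [ratCode_eq, Nat.unpair_pair]
  cases q.num with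
  | ofNat n => change (if (2 * n) % 2 = 0 then (2 * n) / 2 else 0) = n; simp
  | negSucc n =>
    change (if (2 * n + 1) % 2 = 0 then (2 * n + 1) / 2 else 0) = 0
    rw [if_neg (by omega)]

theorem computable_rat_neg_num_toNat : Computable fun q : ℚ => (-q.num).toNat := by
  have h : Primrec fun k : ℕ => if k.unpair.1 % 2 = 0 then 0 else k.unpair.1 / 2 + 1 := by
    have h1 : Primrec fun k : ℕ => k.unpair.1 := Primrec.fst.comp Primrec.unpair
    exact Primrec.ite (Primrec.eq.comp (Primrec.nat_mod.comp h1 (Primrec.const 2))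
      (Primrec.const 0)) (Primrec.const 0)
        (Primrec.succ.comp (Primrec.nat_div.comp h1 (Primrec.const 2)))
  refine (h.to_comp.comp computable_ratCode).of_eq fun q => ?_
  rw [ratCode_eq, Nat.unpair_pair]
  cases q.num with
  | ofNat n =>
    change (if (2 * n) % 2 = 0 then 0 else (2 * n) / 2 + 1) = (-(n : ℤ)).toNat
    rw [if_pos (by omega)]
    omega
  | negSucc n =>
    change (if (2 * n + 1) % 2 = 0 then 0 else (2 * n + 1) / 2 + 1) = n + 1
    rw [if_neg (by omega)]
    omega

theorem computable_rat_den : Computable fun q : ℚ => q.den := by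
  refine ((Primrec.snd.comp Primrec.unpair).to_comp.comp computable_ratCode).of_eq fun q => ?_
  rw [ratCode_eq, Nat.unpair_pair]

theorem rat_eq_toNat_sub_div (q : ℚ) :
    q = ((q.num.toNat : ℚ) - ((-q.num).toNat : ℚ)) / (q.den : ℚ) := by
  have h : ((q.num.toNat : ℤ) - ((-q.num).toNat : ℤ)) = q.num := Int.toNat_sub_toNat_neg _
  have h' : (q.num.toNat : ℚ) - ((-q.num).toNat : ℚ) = (q.num : ℚ) := by
    rw [← h]; push_cast; simp
  rw [h', Rat.num_div_den]

section RatArith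

variable {A : Type*} [Primcodable A]

theorem computable_nat_add {f g : A → ℕ} (hf : Computable f) (hg : Computable g) :
    Computable fun a => f a + g a := Primrec.nat_add.to_comp.comp hf hg

theorem computable_nat_mul {f g : A → ℕ} (hf : Computable f) (hg : Computable g) :
    Computable fun a => f a * g a := Primrec.nat_mul.to_comp.comp hf hg

theorem computable_rat_le {f g : A → ℚ} (hf : Computable f) (hg : Computable g) :
    Computable fun a => decide (f a ≤ g a) := by
  have hfp := computable_rat_num_toNat.comp hf
  have hfn := computable_rat_neg_num_toNat.comp hf
  have hfd := computable_rat_den.comp hf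
  have hgp := computable_rat_num_toNat.comp hg
  have hgn := computable_rat_neg_num_toNat.comp hg
  have hgd := computable_rat_den.comp hg
  refine (computable_nat_le
    (computable_nat_add (computable_nat_mul hfp hgd) (computable_nat_mul hgn hfd))
    (computable_nat_add (computable_nat_mul hgp hfd) (computable_nat_mul hfn hgd))).of_eq
    fun a => ?_
  rw [decide_eq_decide]
  have h1 : (0 : ℚ) < (f a).den := by exact_mod_cast (f a).pos
  have h2 : (0 : ℚ) < (g a).den := by exact_mod_cast (g a).pos
  conv_rhs => rw [rat_eq_toNat_sub_div (f a), rat_eq_toNat_sub_div (g a), div_le_div_iff₀ h1 h2]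
  rw [← Nat.cast_le (α := ℚ)]
  push_cast
  constructor <;> intro h <;> linarith

theorem computable_rat_eq {f g : A → ℚ} (hf : Computable f) (hg : Computable g) :
    Computable fun a => decide (f a = g a) :=
  (computable_decide_and (computable_rat_le hf hg) (computable_rat_le hg hf)).of_eq fun a => by
    simp [le_antisymm_iff]

theorem computable_rat_lt {f g : A → ℚ} (hf : Computable f) (hg : Computable g) :
    Computable fun a => decide (f a < g a) :=
  (Primrec.not.to_comp.comp (computable_rat_le hg hf)).of_eq fun a => by
    by_cases h : g a ≤ f a
    · simp [h, not_lt.2 h]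
    · simp [h, not_le.1 h]

theorem computable_rat_add {f g : A → ℚ} (hf : Computable f) (hg : Computable g) :
    Computable fun a => f a + g a := by
  refine computable_of_graph ?_
  have hf' := hf.comp (Computable.fst (α := A) (β := ℚ))
  have hg' := hg.comp (Computable.fst (α := A) (β := ℚ))
  have hfp := computable_rat_num_toNat.comp hf'
  have hfn := computable_rat_neg_num_toNat.comp hf'
  have hfd := computable_rat_den.comp hf'
  have hgp := computable_rat_num_toNat.comp hg'
  have hgn := computable_rat_neg_num_toNat.comp hg'
  have hgd := computable_rat_den.comp hg'
  have hp := computable_rat_num_toNat.comp (Computable.snd (α := A) (β := ℚ))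
  have hn := computable_rat_neg_num_toNat.comp (Computable.snd (α := A) (β := ℚ))
  have hd := computable_rat_den.comp (Computable.snd (α := A) (β := ℚ))
  refine (computable_nat_eq
    (computable_nat_add (computable_nat_mul (computable_nat_add (computable_nat_mul hfp hgd)
      (computable_nat_mul hgp hfd)) hd) (computable_nat_mul hn (computable_nat_mul hfd hgd)))
    (computable_nat_add (computable_nat_mul (computable_nat_add (computable_nat_mul hfn hgd)
      (computable_nat_mul hgn hfd)) hd) (computable_nat_mul hp (computable_nat_mul hfd hgd)))).of_eq
    fun p => ?_
  rw [decide_eq_decide]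
  have h1 : (0 : ℚ) < (f p.1).den := by exact_mod_cast (f p.1).pos
  have h2 : (0 : ℚ) < (g p.1).den := by exact_mod_cast (g p.1).pos
  have h3 : (0 : ℚ) < p.2.den := by exact_mod_cast p.2.pos
  conv_rhs =>
    rw [rat_eq_toNat_sub_div (f p.1), rat_eq_toNat_sub_div (g p.1), rat_eq_toNat_sub_div p.2,
      div_add_div _ _ h1.ne' h2.ne', div_eq_div_iff (mul_pos h1 h2).ne' h3.ne']
  rw [← Nat.cast_inj (R := ℚ)]
  push_cast
  constructor <;> intro h <;> linarith

theorem computable_rat_mul {f g : A → ℚ} (hf : Computable f) (hg : Computable g) :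
    Computable fun a => f a * g a := by
  refine computable_of_graph ?_
  have hf' := hf.comp (Computable.fst (α := A) (β := ℚ))
  have hg' := hg.comp (Computable.fst (α := A) (β := ℚ))
  have hfp := computable_rat_num_toNat.comp hf'
  have hfn := computable_rat_neg_num_toNat.comp hf'
  have hfd := computable_rat_den.comp hf'
  have hgp := computable_rat_num_toNat.comp hg'
  have hgn := computable_rat_neg_num_toNat.comp hg'
  have hgd := computable_rat_den.comp hg'
  have hp := computable_rat_num_toNat.comp (Computable.snd (α := A) (β := ℚ))
  have hn := computable_rat_neg_num_toNat.comp (Computable.snd (α := A) (β := ℚ))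
  have hd := computable_rat_den.comp (Computable.snd (α := A) (β := ℚ))
  refine (computable_nat_eq
    (computable_nat_add (computable_nat_mul (computable_nat_add (computable_nat_mul hfp hgp)
      (computable_nat_mul hfn hgn)) hd) (computable_nat_mul hn (computable_nat_mul hfd hgd)))
    (computable_nat_add (computable_nat_mul (computable_nat_add (computable_nat_mul hfp hgn)
      (computable_nat_mul hfn hgp)) hd) (computable_nat_mul hp (computable_nat_mul hfd hgd)))).of_eq
    fun p => ?_
  rw [decide_eq_decide]
  have h1 : (0 : ℚ) < (f p.1).den := by exact_mod_cast (f p.1).pos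
  have h2 : (0 : ℚ) < (g p.1).den := by exact_mod_cast (g p.1).pos
  have h3 : (0 : ℚ) < p.2.den := by exact_mod_cast p.2.pos
  conv_rhs =>
    rw [rat_eq_toNat_sub_div (f p.1), rat_eq_toNat_sub_div (g p.1), rat_eq_toNat_sub_div p.2,
      div_mul_div_comm, div_eq_div_iff (mul_pos h1 h2).ne' h3.ne']
  rw [← Nat.cast_inj (R := ℚ)]
  push_cast
  constructor <;> intro h <;> linarith

theorem computable_rat_sub {f g : A → ℚ} (hf : Computable f) (hg : Computable g) :
    Computable fun a => f a - g a :=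
  (computable_rat_add hf (computable_rat_mul (Computable.const (-1)) hg)).of_eq fun a => by ring

theorem computable_rat_div {f g : A → ℚ} (hf : Computable f) (hg : Computable g) :
    Computable fun a => f a / g a := by
  have hinv : Computable fun a => (g a)⁻¹ := by
    refine computable_of_graph ?_
    have hg' := hg.comp (Computable.fst (α := A) (β := ℚ))
    refine (computable_decide_or
      (computable_decide_and (computable_rat_eq hg' (Computable.const 0))
        (computable_rat_eq Computable.snd (Computable.const 0)))
      (computable_rat_eq (computable_rat_mul hg' Computable.snd) (Computable.const 1))).of_eq
      fun p => ?_
    rw [decide_eq_decide]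
    by_cases h : g p.1 = 0
    · simp [h, eq_comm]
    · have : g p.1 * p.2 = 1 ↔ (g p.1)⁻¹ = p.2 := by
        constructor
        · exact fun h' => inv_eq_of_mul_eq_one_right h'
        · rintro h'
          rw [← h', mul_inv_cancel₀ h]
      simp [h, this]
  exact (computable_rat_mul hf hinv).of_eq fun a => (div_eq_mul_inv _ _).symm

theorem computable_rat_abs {f : A → ℚ} (hf : Computable f) : Computable fun a => |f a| :=
  (computable_ite (computable_rat_le (Computable.const 0) hf) hf
    (computable_rat_sub (Computable.const 0) hf)).of_eq fun a => by
      split_ifs with h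
      · exact (abs_of_nonneg h).symm
      · rw [abs_of_neg (not_le.1 h), zero_sub]

theorem computable_rat_pow (r : ℚ) {f : A → ℕ} (hf : Computable f) :
    Computable fun a => r ^ f a := by
  have h : Computable fun n : ℕ => r ^ n := by
    refine (Computable.nat_rec (f := fun k : ℕ => k) (g := fun _ => (1 : ℚ))
      (h := fun _ p => p.2 * r) Computable.id (Computable.const 1) ?_).of_eq fun n => ?_
    · exact computable_rat_mul (Computable.snd.comp Computable.snd) (Computable.const r)
    · induction n with
      | zero => simp
      | succ n ih => rw [pow_succ, ← ih]
  exact h.comp hf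

theorem computable_rat_sum {f : A → ℕ → ℚ} (hf : Computable₂ f) :
    Computable₂ fun a n => ∑ i ∈ Finset.range n, f a i := by
  refine (Computable.nat_rec (f := fun p : A × ℕ => p.2) (g := fun _ => (0 : ℚ))
    (h := fun p k => k.2 + f p.1 k.1) Computable.snd (Computable.const 0) ?_).of_eq fun p => ?_
  · exact computable_rat_add (Computable.snd.comp Computable.snd)
      (hf.comp (Computable.fst.comp Computable.fst) (Computable.fst.comp Computable.snd))
  · obtain ⟨a, n⟩ := p
    induction n with
    | zero => simp
    | succ n ih =>
      change _ = ∑ i ∈ Finset.range (n + 1), f a i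
      rw [Finset.sum_range_succ]
      exact congrArg (· + f a n) ih

end RatArith
/-! ### A fat Cantor set -/

/-- Length of the cells of level `n` of the fat Cantor set. -/
def fatLen (n : ℕ) : ℚ := (15 * (1 / 2) ^ n + (1 / 4) ^ n) / 16

/-- Distance between the left endpoints of the two children of a cell of level `n`. -/
def fatStep (n : ℕ) : ℚ := fatLen n - fatLen (n + 1)

/-- Left endpoint of the cell of level `n` containing the point of address `x`. -/
def fatLeft (x : ℕ → Bool) (n : ℕ) : ℚ :=
  ∑ i ∈ Finset.range n, if x i = true then fatStep i else 0

/-- The cell of level `n` containing the point of address `x`. -/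
def fatCell (x : ℕ → Bool) (n : ℕ) : Set ℝ :=
  Icc (fatLeft x n : ℝ) (fatLeft x n + fatLen n)

/-- The open gap between the two children of `fatCell x n`. -/
def fatGap (x : ℕ → Bool) (n : ℕ) : Set ℝ :=
  Ioo (fatLeft x n + fatLen (n + 1) : ℝ) (fatLeft x n + fatStep n)

/-- The point of the fat Cantor set of address `x`. -/
noncomputable def fatPoint (x : ℕ → Bool) : ℝ := ⨆ n, (fatLeft x n : ℝ)

/-- Position of `y` relative to the cell of level `n` selected greedily. -/
noncomputable def fatRem (y : ℝ) : ℕ → ℝ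
  | 0 => y
  | n + 1 => if (fatLen (n + 1) : ℝ) < fatRem y n then fatRem y n - fatStep n
      else fatRem y n

/-- Greedy address of a real number. -/
noncomputable def fatAddr (y : ℝ) (n : ℕ) : Bool :=
  decide ((fatLen (n + 1) : ℝ) < fatRem y n)

theorem fatLen_cast (n : ℕ) :
    (fatLen n : ℝ) = (15 * (1 / 2) ^ n + (1 / 4) ^ n) / 16 := by
  simp [fatLen]

theorem fatLen_zero : fatLen 0 = 1 := by norm_num [fatLen]

theorem fatLen_pos (n : ℕ) : (0 : ℝ) < fatLen n := by
  rw [fatLen_cast]; positivity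

theorem fatLen_le (n : ℕ) : (fatLen n : ℝ) ≤ (1 / 2) ^ n := by
  rw [fatLen_cast]
  have : (1 / 4 : ℝ) ^ n ≤ (1 / 2) ^ n := by gcongr; norm_num
  linarith

theorem le_fatLen (n : ℕ) : 15 / 16 * (1 / 2 : ℝ) ^ n ≤ fatLen n := by
  rw [fatLen_cast]
  have : (0 : ℝ) < (1 / 4) ^ n := by positivity
  linarith

theorem fatLen_sub (n : ℕ) :
    (fatLen n : ℝ) - 2 * fatLen (n + 1) = (1 / 32) * (1 / 4) ^ n := by
  rw [fatLen_cast, fatLen_cast, pow_succ, pow_succ]; ring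

theorem fatStep_cast (n : ℕ) : (fatStep n : ℝ) = fatLen n - fatLen (n + 1) := by
  simp [fatStep]

theorem fatLen_succ_lt_step (n : ℕ) : (fatLen (n + 1) : ℝ) < fatStep n := by
  have h := fatLen_sub n
  have : (0 : ℝ) < (1 / 4) ^ n := by positivity
  rw [fatStep_cast]; linarith

theorem fatStep_pos (n : ℕ) : (0 : ℝ) < fatStep n :=
  (fatLen_pos _).trans (fatLen_succ_lt_step n)

theorem fatLen_le_quarter (n : ℕ) : (fatLen (n + 4) : ℝ) ≤ fatLen n / 16 := by
  rw [fatLen_cast, fatLen_cast, pow_add, pow_add]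
  have : (0 : ℝ) < (1 / 4) ^ n := by positivity
  linarith

theorem tendsto_fatLen : Tendsto (fun n => (fatLen n : ℝ)) atTop (𝓝 0) :=
  squeeze_zero (fun n => (fatLen_pos n).le) fatLen_le
    (tendsto_pow_atTop_nhds_zero_of_lt_one (by norm_num) (by norm_num))

theorem fatLeft_succ (x : ℕ → Bool) (n : ℕ) :
    (fatLeft x (n + 1) : ℝ) = fatLeft x n + if x n = true then (fatStep n : ℝ) else 0 := by
  rw [fatLeft, Finset.sum_range_succ, ← fatLeft]
  split_ifs <;> simp

theorem fatLeft_zero (x : ℕ → Bool) : fatLeft x 0 = 0 := by simp [fatLeft]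

theorem fatLeft_congr {x z : ℕ → Bool} {n : ℕ} (h : ∀ i < n, x i = z i) :
    fatLeft x n = fatLeft z n :=
  Finset.sum_congr rfl fun i hi => by rw [h i (Finset.mem_range.1 hi)]

theorem fatCell_congr {x z : ℕ → Bool} {n : ℕ} (h : ∀ i < n, x i = z i) :
    fatCell x n = fatCell z n := by
  rw [fatCell, fatCell, fatLeft_congr h]

theorem fatGap_congr {x z : ℕ → Bool} {n : ℕ} (h : ∀ i < n, x i = z i) :
    fatGap x n = fatGap z n := by
  rw [fatGap, fatGap, fatLeft_congr h]

theorem fatCell_zero (x : ℕ → Bool) : fatCell x 0 = Icc 0 1 := by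
  simp [fatCell, fatLeft_zero, fatLen_zero]

theorem fatLeft_le_succ (x : ℕ → Bool) (n : ℕ) :
    (fatLeft x n : ℝ) ≤ fatLeft x (n + 1) := by
  rw [fatLeft_succ]
  have := fatStep_pos n
  split_ifs <;> linarith

theorem fatLeft_add_len_succ_le (x : ℕ → Bool) (n : ℕ) :
    (fatLeft x (n + 1) : ℝ) + fatLen (n + 1) ≤ fatLeft x n + fatLen n := by
  rw [fatLeft_succ]
  have := fatLen_succ_lt_step n
  have := fatStep_cast n
  have := fatLen_pos (n + 1)
  split_ifs <;> linarith

theorem fatCell_antitone (x : ℕ → Bool) : Antitone (fatCell x) :=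
  antitone_nat_of_succ_le fun n =>
    Icc_subset_Icc (fatLeft_le_succ x n) (fatLeft_add_len_succ_le x n)

theorem fatLeft_mem_cell (x : ℕ → Bool) (n : ℕ) : (fatLeft x n : ℝ) ∈ fatCell x n :=
  ⟨le_rfl, by linarith [fatLen_pos n]⟩

theorem fatLeft_mono (x : ℕ → Bool) : Monotone fun n => (fatLeft x n : ℝ) :=
  monotone_nat_of_le_succ (fatLeft_le_succ x)

theorem fatLeft_le_add_len (x : ℕ → Bool) (m n : ℕ) :
    (fatLeft x m : ℝ) ≤ fatLeft x n + fatLen n := by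
  have h := fatCell_antitone x (le_max_right m n) (fatLeft_mem_cell x (max m n))
  exact (fatLeft_mono x (le_max_left m n)).trans h.2

theorem fatPoint_mem_cell (x : ℕ → Bool) (n : ℕ) : fatPoint x ∈ fatCell x n :=
  ⟨le_ciSup (f := fun n => (fatLeft x n : ℝ))
    ⟨fatLeft x 0 + fatLen 0, by rintro _ ⟨m, rfl⟩; exact fatLeft_le_add_len x m 0⟩ n,
    ciSup_le fun m => fatLeft_le_add_len x m n⟩

theorem abs_sub_le_of_mem_cell {x : ℕ → Bool} {n : ℕ} {y z : ℝ} (hy : y ∈ fatCell x n)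
    (hz : z ∈ fatCell x n) : |y - z| ≤ fatLen n := by
  rw [abs_le]
  constructor <;> linarith [hy.1, hy.2, hz.1, hz.2]

theorem eq_fatPoint_of_forall_mem_cell {x : ℕ → Bool} {y : ℝ} {N : ℕ}
    (h : ∀ n ≥ N, y ∈ fatCell x n) : y = fatPoint x := by
  have h0 : |y - fatPoint x| ≤ 0 := ge_of_tendsto tendsto_fatLen
    (eventually_atTop.2 ⟨N, fun n hn => abs_sub_le_of_mem_cell (h n hn) (fatPoint_mem_cell x n)⟩)
  exact sub_eq_zero.1 (abs_nonpos_iff.1 h0)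

theorem fatRem_eq (y : ℝ) (n : ℕ) : fatRem y n = y - fatLeft (fatAddr y) n := by
  induction n with
  | zero => simp [fatRem, fatLeft_zero]
  | succ n ih =>
    rw [fatRem, fatLeft_succ]
    by_cases h : (fatLen (n + 1) : ℝ) < fatRem y n
    · rw [if_pos h, if_pos (by simp [fatAddr, h]), ih]; ring
    · rw [if_neg h, if_neg (by simp [fatAddr] at h ⊢; exact h), ih]; ring

theorem fatAddr_eq_true_iff (y : ℝ) (n : ℕ) : fatAddr y n = true ↔
    (fatLeft (fatAddr y) n : ℝ) + fatLen (n + 1) < y := by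
  rw [fatAddr, decide_eq_true_iff, fatRem_eq]
  constructor <;> intro h <;> linarith

theorem fatAddr_eq_of_mem_cell {x : ℕ → Bool} {y : ℝ} {n : ℕ} (h : y ∈ fatCell x n) :
    ∀ i < n, fatAddr y i = x i := by
  induction n with
  | zero => simp
  | succ n ih =>
    have ih := ih (fatCell_antitone x n.le_succ h)
    intro i hi
    rcases Nat.lt_succ_iff_lt_or_eq.1 hi with hi | rfl
    · exact ih i hi
    · rw [Bool.eq_iff_iff, fatAddr_eq_true_iff, fatLeft_congr ih]
      obtain ⟨h1, h2⟩ := h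
      rw [fatLeft_succ] at h1 h2
      have h3 := fatLen_succ_lt_step i
      constructor
      · intro h4
        by_contra h5
        rw [if_neg h5] at h2
        linarith
      · intro h4
        rw [if_pos h4] at h1
        linarith

theorem agree_of_mem_cell {x z : ℕ → Bool} {y : ℝ} {n m : ℕ} (h : y ∈ fatCell x n)
    (h' : y ∈ fatCell z m) {i : ℕ} (hn : i < n) (hm : i < m) : x i = z i := by
  rw [← fatAddr_eq_of_mem_cell h i hn, fatAddr_eq_of_mem_cell h' i hm]

theorem fatAddr_point (x : ℕ → Bool) : fatAddr (fatPoint x) = x :=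
  funext fun i => fatAddr_eq_of_mem_cell (fatPoint_mem_cell x (i + 1)) i i.lt_succ_self

theorem fatPoint_injective : Function.Injective fatPoint :=
  Function.LeftInverse.injective fatAddr_point

theorem fatGap_subset_cell (x : ℕ → Bool) (n : ℕ) : fatGap x n ⊆ fatCell x n := by
  rintro y ⟨h1, h2⟩
  have := fatLen_pos (n + 1)
  have := fatStep_cast n
  constructor <;> linarith

theorem notMem_cell_of_mem_gap {x z : ℕ → Bool} {y : ℝ} {n m : ℕ} (h : y ∈ fatGap x n)
    (hm : n < m) : y ∉ fatCell z m := by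
  intro h'
  have h' := fatCell_antitone z (Nat.succ_le_iff.2 hm) h'
  have he : fatLeft x n = fatLeft z n := fatLeft_congr fun i hi =>
    agree_of_mem_cell (fatGap_subset_cell x n h) h' hi (hi.trans n.lt_succ_self)
  obtain ⟨h1, h2⟩ := h
  obtain ⟨h3, h4⟩ := h'
  rw [Nat.succ_eq_add_one, fatLeft_succ] at h3 h4
  rw [he] at h1 h2
  split_ifs at h3 h4 <;> linarith

theorem gap_level_ge {x z : ℕ → Bool} {y : ℝ} {n m : ℕ} (h : y ∈ fatGap x n)
    (h' : y ∈ fatCell z m) : m ≤ n :=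
  not_lt.1 fun hlt => notMem_cell_of_mem_gap h hlt h'

theorem gap_unique {x z : ℕ → Bool} {y : ℝ} {n m : ℕ} (h : y ∈ fatGap x n)
    (h' : y ∈ fatGap z m) : n = m ∧ ∀ i < n, x i = z i := by
  have hc := fatGap_subset_cell x n h
  have hc' := fatGap_subset_cell z m h'
  have hnm : n = m := le_antisymm (gap_level_ge h' hc) (gap_level_ge h hc')
  subst hnm
  exact ⟨rfl, fun i hi => agree_of_mem_cell hc hc' hi hi⟩

theorem notMem_range_of_mem_gap {x : ℕ → Bool} {y : ℝ} {n : ℕ} (h : y ∈ fatGap x n) :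
    y ∉ range fatPoint := by
  rintro ⟨z, rfl⟩
  exact notMem_cell_of_mem_gap h n.lt_succ_self (fatPoint_mem_cell z (n + 1))

theorem mem_cell_or_gap {y : ℝ} (hy : y ∈ Icc (0 : ℝ) 1) (n : ℕ) :
    y ∈ fatCell (fatAddr y) n ∨ ∃ m < n, y ∈ fatGap (fatAddr y) m := by
  induction n with
  | zero => left; rwa [fatCell_zero]
  | succ n ih =>
    rcases ih with ih | ⟨m, hm, h⟩
    · by_cases hg : y ∈ fatGap (fatAddr y) n
      · exact Or.inr ⟨n, n.lt_succ_self, hg⟩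
      · left
        have hstep := fatStep_cast n
        rw [fatCell, fatLeft_succ]
        by_cases ha : fatAddr y n = true
        · rw [if_pos ha]
          rw [fatAddr_eq_true_iff] at ha
          have : (fatLeft (fatAddr y) n : ℝ) + fatStep n ≤ y :=
            not_lt.1 fun h => hg ⟨ha, h⟩
          exact ⟨this, by linarith [ih.2]⟩
        · rw [if_neg ha]
          rw [fatAddr_eq_true_iff, not_lt] at ha
          exact ⟨by linarith [ih.1], by linarith⟩
    · exact Or.inr ⟨m, hm.trans n.lt_succ_self, h⟩

theorem mem_range_or_gap {y : ℝ} (hy : y ∈ Icc (0 : ℝ) 1) :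
    y = fatPoint (fatAddr y) ∨ ∃ n, y ∈ fatGap (fatAddr y) n := by
  by_cases h : ∃ n, y ∈ fatGap (fatAddr y) n
  · exact Or.inr h
  · refine Or.inl (eq_fatPoint_of_forall_mem_cell (N := 0) fun n _ => ?_)
    exact (mem_cell_or_gap hy n).resolve_right fun ⟨m, _, hm⟩ => h ⟨m, hm⟩

theorem fatPoint_mem_Icc (x : ℕ → Bool) : fatPoint x ∈ Icc (0 : ℝ) 1 := by
  rw [← fatCell_zero x]; exact fatPoint_mem_cell x 0

/-- The address agreeing with `x` below `n`, equal to `b` at `n`, and to `!b` beyond. -/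
def splice (x : ℕ → Bool) (n : ℕ) (b : Bool) : ℕ → Bool :=
  fun i => if i < n then x i else if i = n then b else !b

theorem splice_of_lt (x : ℕ → Bool) {n i : ℕ} (b : Bool) (h : i < n) : splice x n b i = x i :=
  if_pos h

theorem splice_congr {x z : ℕ → Bool} {n : ℕ} (h : ∀ i < n, x i = z i) (b : Bool) :
    splice x n b = splice z n b := by
  funext i
  rw [splice, splice]
  split_ifs with h1
  exacts [h i h1, rfl, rfl]

theorem fatPoint_splice_true (x : ℕ → Bool) (n : ℕ) :
    fatPoint (splice x n true) = fatLeft x n + fatStep n := by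
  have h : ∀ m, (fatLeft (splice x n true) (n + 1 + m) : ℝ) = fatLeft x n + fatStep n := by
    intro m
    induction m with
    | zero =>
      rw [add_zero, fatLeft_succ, fatLeft_congr fun i hi => splice_of_lt x true hi]
      simp [splice]
    | succ m ih =>
      rw [← add_assoc, fatLeft_succ, ih, if_neg, add_zero]
      rw [splice, if_neg (by omega), if_neg (by omega)]
      simp
  refine (eq_fatPoint_of_forall_mem_cell (N := n + 1) fun k hk => ?_).symm
  obtain ⟨m, rfl⟩ := Nat.exists_eq_add_of_le hk
  rw [fatCell, h]
  exact ⟨le_rfl, by linarith [fatLen_pos (n + 1 + m)]⟩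

theorem fatPoint_splice_false (x : ℕ → Bool) (n : ℕ) :
    fatPoint (splice x n false) = fatLeft x n + fatLen (n + 1) := by
  have h : ∀ m, (fatLeft (splice x n false) (n + 1 + m) : ℝ) =
      fatLeft x n + fatLen (n + 1) - fatLen (n + 1 + m) := by
    intro m
    induction m with
    | zero =>
      rw [add_zero, fatLeft_succ, fatLeft_congr fun i hi => splice_of_lt x false hi]
      simp [splice]
    | succ m ih =>
      rw [← add_assoc, fatLeft_succ, ih, if_pos, fatStep_cast]
      · ring
      · rw [splice, if_neg (by omega), if_neg (by omega)]
        simp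
  refine (eq_fatPoint_of_forall_mem_cell (N := n + 1) fun k hk => ?_).symm
  obtain ⟨m, rfl⟩ := Nat.exists_eq_add_of_le hk
  rw [fatCell, h]
  exact ⟨by linarith [fatLen_pos (n + 1 + m)], by linarith⟩

theorem exists_cylinder_subset {x : ℕ → Bool} {U : Set (ℕ → Bool)} (hU : U ∈ 𝓝 x) :
    ∃ n, ∀ z : ℕ → Bool, (∀ i < n, x i = z i) → z ∈ U := by
  rw [nhds_pi, Filter.mem_pi] at hU
  obtain ⟨I, hI, t, ht, hsub⟩ := hU
  obtain ⟨n, hn⟩ := hI.bddAbove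
  refine ⟨n + 1, fun z hz => hsub fun i hi => ?_⟩
  rw [← hz i (Nat.lt_succ_of_le (hn hi))]
  exact mem_of_mem_nhds (ht i)

theorem cylinder_mem_nhds (x : ℕ → Bool) (n : ℕ) :
    {z : ℕ → Bool | ∀ i < n, x i = z i} ∈ 𝓝 x := by
  have : {z : ℕ → Bool | ∀ i < n, x i = z i} = (Set.Iio n).pi fun i => {x i} := by
    ext z; simp [Set.mem_pi, eq_comm]
  rw [this]
  exact set_pi_mem_nhds (Set.finite_Iio n) fun i _ => by simp

theorem continuous_fatPoint : Continuous fatPoint := by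
  rw [continuous_iff_continuousAt]
  intro x
  rw [ContinuousAt, Metric.tendsto_nhds]
  intro ε hε
  obtain ⟨n, hn⟩ := ((tendsto_order.1 tendsto_fatLen).2 ε hε).exists
  filter_upwards [cylinder_mem_nhds x n] with z hz
  refine lt_of_le_of_lt (abs_sub_le_of_mem_cell (x := x) (n := n) ?_ (fatPoint_mem_cell x n)) hn
  rw [fatCell_congr hz]
  exact fatPoint_mem_cell z n

theorem isClosedEmbedding_fatPoint : IsClosedEmbedding fatPoint :=
  continuous_fatPoint.isClosedEmbedding fatPoint_injective

/-! ### The interval map extending a map of Cantor space -/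

/-- `κ n` digits of `T x` are determined by the first `n` digits of `x`, and `κ` increases to
infinity. -/
structure IsModulus (T : (ℕ → Bool) → (ℕ → Bool)) (κ : ℕ → ℕ) : Prop where
  agree : ∀ (n : ℕ) (x z : ℕ → Bool), (∀ i < n, x i = z i) → ∀ j < κ n, T x j = T z j
  mono : Monotone κ
  unbounded : ∀ m, ∃ n, m ≤ κ n

/-- A point of `[lo, lo + len]` at distance at least `len / 4` from both `a` and `b`. -/
def farFrom (lo len a b : ℚ) : ℚ :=
  if len / 4 ≤ |a - lo| ∧ len / 4 ≤ |b - lo| then lo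
  else if len / 4 ≤ |a - (lo + len / 2)| ∧ len / 4 ≤ |b - (lo + len / 2)| then lo + len / 2
  else lo + len

/-- The piecewise affine function with values `a`, `e`, `b` at `-1`, `0`, `1`. -/
def tentValue {K : Type*} [Field K] [LinearOrder K] (e a b u : K) : K :=
  e + (a - e) * ((|u| - u) / 2) + (b - e) * ((|u| + u) / 2)

/-- Half of the length of a gap of level `n`. -/
def halfGap (n : ℕ) : ℚ := 1 / 64 * (1 / 4) ^ n

/-- Midpoint of the gap `fatGap x n`. -/
def gapMid (x : ℕ → Bool) (n : ℕ) : ℚ := fatLeft x n + fatLen n / 2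

section Extension

variable (T : (ℕ → Bool) → (ℕ → Bool)) (κ : ℕ → ℕ)

/-- Value of the extended map at the midpoint of the gap `fatGap x n`. -/
def peak (x : ℕ → Bool) (n : ℕ) : ℚ :=
  farFrom (fatLeft (T (splice x n false)) (κ n)) (fatLen (κ n))
    (fatLeft (T (splice x n false)) (κ n + 4)) (fatLeft (T (splice x n true)) (κ n + 4))

/-- The extended map on the gap `fatGap x n`. -/
noncomputable def tent (x : ℕ → Bool) (n : ℕ) (y : ℝ) : ℝ :=
  tentValue (peak T κ x n : ℝ) (fatPoint (T (splice x n false)))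
    (fatPoint (T (splice x n true))) ((y - gapMid x n) / halfGap n)

open Classical in
/-- The map of `[0, 1]` extending `T` through the fat Cantor set. -/
noncomputable def fatMap (y : ℝ) : ℝ :=
  if h : ∃ n, y ∈ fatGap (fatAddr y) n then tent T κ (fatAddr y) (Nat.find h) y
  else fatPoint (T (fatAddr y))

end Extension

theorem tentValue_cast (e a b u : ℚ) :
    ((tentValue e a b u : ℚ) : ℝ) = tentValue (e : ℝ) a b u := by
  simp [tentValue]

theorem tentValue_of_nonpos {e a b u : ℝ} (h : u ≤ 0) :
    tentValue e a b u = e - (a - e) * u := by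
  rw [tentValue, abs_of_nonpos h]; ring

theorem tentValue_of_nonneg {e a b u : ℝ} (h : 0 ≤ u) :
    tentValue e a b u = e + (b - e) * u := by
  rw [tentValue, abs_of_nonneg h]; ring

theorem tentValue_mem {e a b u l r : ℝ} (he : e ∈ Icc l r) (ha : a ∈ Icc l r)
    (hb : b ∈ Icc l r) (hu : |u| ≤ 1) : tentValue e a b u ∈ Icc l r := by
  obtain ⟨h1, h2⟩ := abs_le.1 hu
  obtain ⟨he1, he2⟩ := he
  obtain ⟨ha1, ha2⟩ := ha
  obtain ⟨hb1, hb2⟩ := hb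
  rcases le_total u 0 with h | h
  · rw [tentValue_of_nonpos h]
    constructor <;> nlinarith
  · rw [tentValue_of_nonneg h]
    constructor <;> nlinarith

theorem abs_tentValue_sub_le {e a b u v c : ℝ} (ha : |a - e| ≤ c) (hb : |b - e| ≤ c) :
    |tentValue e a b u - tentValue e a b v| ≤ 2 * c * |u - v| := by
  have h1 : |(|u| - u) / 2 - (|v| - v) / 2| ≤ |u - v| := by
    have h2 := abs_le.1 (abs_abs_sub_abs_le u v)
    have h3 := le_abs_self (u - v)
    have h4 := neg_abs_le (u - v)
    rw [abs_le]; constructor <;> linarith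
  have h1' : |(|u| + u) / 2 - (|v| + v) / 2| ≤ |u - v| := by
    have h2 := abs_le.1 (abs_abs_sub_abs_le u v)
    have h3 := le_abs_self (u - v)
    have h4 := neg_abs_le (u - v)
    rw [abs_le]; constructor <;> linarith
  have hc : 0 ≤ c := (abs_nonneg _).trans ha
  have : tentValue e a b u - tentValue e a b v =
      (a - e) * ((|u| - u) / 2 - (|v| - v) / 2) + (b - e) * ((|u| + u) / 2 - (|v| + v) / 2) := by
    rw [tentValue, tentValue]; ring
  rw [this]
  calc _ ≤ |(a - e) * ((|u| - u) / 2 - (|v| - v) / 2)|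
        + |(b - e) * ((|u| + u) / 2 - (|v| + v) / 2)| := abs_add_le _ _
    _ ≤ c * |u - v| + c * |u - v| := by
        rw [abs_mul, abs_mul]
        gcongr
    _ = _ := by ring

theorem abs_tentValue_sub_le_of_endpoints {e a b a' b' u c : ℝ} (ha : |a - a'| ≤ c)
    (hb : |b - b'| ≤ c) (hu : |u| ≤ 1) : |tentValue e a b u - tentValue e a' b' u| ≤ c := by
  have hc : 0 ≤ c := (abs_nonneg _).trans ha
  rcases le_total u 0 with h | h
  · rw [tentValue_of_nonpos h, tentValue_of_nonpos h]
    have : e - (a - e) * u - (e - (a' - e) * u) = (a - a') * (-u) := by ring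
    rw [this, abs_mul, abs_neg]
    calc _ ≤ c * 1 := by gcongr
      _ = c := mul_one c
  · rw [tentValue_of_nonneg h, tentValue_of_nonneg h]
    have : e + (b - e) * u - (e + (b' - e) * u) = (b - b') * u := by ring
    rw [this, abs_mul]
    calc _ ≤ c * 1 := by gcongr
      _ = c := mul_one c

theorem farFrom_mem {lo len a b : ℚ} (h : 0 ≤ len) :
    lo ≤ farFrom lo len a b ∧ farFrom lo len a b ≤ lo + len := by
  rw [farFrom]; split_ifs <;> constructor <;> linarith

theorem le_abs_sub_farFrom (lo len a b : ℚ) :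
    len / 4 ≤ |a - farFrom lo len a b| ∧ len / 4 ≤ |b - farFrom lo len a b| := by
  rw [farFrom]
  split_ifs with h1 h2
  · exact h1
  · exact h2
  · rw [not_and_or, not_le, not_le] at h1 h2
    simp only [le_abs]
    rcases h1 with h1 | h1 <;> rcases h2 with h2 | h2 <;> rw [abs_lt] at h1 h2 <;>
      constructor <;> first | (left; linarith) | (right; linarith)

theorem halfGap_cast (n : ℕ) : (halfGap n : ℝ) = 1 / 64 * (1 / 4) ^ n := by
  simp [halfGap]

theorem halfGap_pos (n : ℕ) : (0 : ℝ) < halfGap n := by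
  rw [halfGap_cast]; positivity

theorem fatGap_eq (x : ℕ → Bool) (n : ℕ) :
    fatGap x n = Ioo (gapMid x n - halfGap n : ℝ) (gapMid x n + halfGap n) := by
  have h := fatLen_sub n
  have h1 : (gapMid x n : ℝ) = fatLeft x n + fatLen n / 2 := by simp [gapMid]
  rw [fatGap, fatStep_cast, h1, halfGap_cast]
  congr 1 <;> linarith

/-- The closure of the gap `fatGap x n`. -/
def closedGap (x : ℕ → Bool) (n : ℕ) : Set ℝ :=
  Icc (gapMid x n - halfGap n : ℝ) (gapMid x n + halfGap n)

theorem fatGap_subset_closedGap (x : ℕ → Bool) (n : ℕ) : fatGap x n ⊆ closedGap x n := by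
  rw [fatGap_eq]; exact Ioo_subset_Icc_self

theorem gapMid_sub (x : ℕ → Bool) (n : ℕ) :
    (gapMid x n - halfGap n : ℝ) = fatPoint (splice x n false) := by
  have h := fatLen_sub n
  have h1 : (gapMid x n : ℝ) = fatLeft x n + fatLen n / 2 := by simp [gapMid]
  rw [fatPoint_splice_false, h1, halfGap_cast]
  linarith

theorem gapMid_add (x : ℕ → Bool) (n : ℕ) :
    (gapMid x n + halfGap n : ℝ) = fatPoint (splice x n true) := by
  have h := fatLen_sub n
  have h1 : (gapMid x n : ℝ) = fatLeft x n + fatLen n / 2 := by simp [gapMid]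
  rw [fatPoint_splice_true, h1, halfGap_cast, fatStep_cast]
  linarith

theorem gapMid_congr {x z : ℕ → Bool} {n : ℕ} (h : ∀ i < n, x i = z i) :
    gapMid x n = gapMid z n := by
  rw [gapMid, gapMid, fatLeft_congr h]

theorem abs_rescale_le {x : ℕ → Bool} {n : ℕ} {y : ℝ} (hy : y ∈ closedGap x n) :
    |(y - gapMid x n) / halfGap n| ≤ 1 := by
  rw [abs_div, abs_of_pos (halfGap_pos n), div_le_one (halfGap_pos n), abs_le]
  constructor <;> linarith [hy.1, hy.2]

section Extension

variable {T : (ℕ → Bool) → (ℕ → Bool)} {κ : ℕ → ℕ}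

theorem peak_congr {x z : ℕ → Bool} {n : ℕ} (h : ∀ i < n, x i = z i) :
    peak T κ x n = peak T κ z n := by
  rw [peak, peak, splice_congr h, splice_congr h]

theorem tent_congr {x z : ℕ → Bool} {n : ℕ} (h : ∀ i < n, x i = z i) :
    tent T κ x n = tent T κ z n := by
  funext y
  rw [tent, tent, splice_congr h, splice_congr h, peak_congr h, gapMid_congr h]

theorem fatMap_of_gap {x : ℕ → Bool} {n : ℕ} {y : ℝ} (hy : y ∈ fatGap x n) :
    fatMap T κ y = tent T κ x n y := by
  classical
  have hx := fatAddr_eq_of_mem_cell (fatGap_subset_cell x n hy)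
  have h : ∃ n, y ∈ fatGap (fatAddr y) n := ⟨n, by rwa [fatGap_congr hx]⟩
  obtain ⟨h1, h2⟩ := gap_unique (Nat.find_spec h) hy
  rw [fatMap, dif_pos h]
  have h3 : ∀ m, m = n → tent T κ (fatAddr y) m y = tent T κ x n y := by
    rintro m rfl
    rw [tent_congr hx]
  convert h3 _ h1

theorem fatMap_point (x : ℕ → Bool) : fatMap T κ (fatPoint x) = fatPoint (T x) := by
  have h : ¬ ∃ n, fatPoint x ∈ fatGap (fatAddr (fatPoint x)) n := by
    rintro ⟨n, hn⟩
    exact notMem_range_of_mem_gap hn ⟨x, rfl⟩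
  rw [fatMap, dif_neg h, fatAddr_point]

theorem fatMap_of_closedGap {x : ℕ → Bool} {n : ℕ} {y : ℝ} (hy : y ∈ closedGap x n) :
    fatMap T κ y = tent T κ x n y := by
  have hpos := halfGap_pos n
  rcases hy.1.eq_or_lt with h1 | h1
  · have hu : (y - gapMid x n) / halfGap n = -1 := by
      rw [← h1]; field_simp; ring
    rw [tent, hu, tentValue_of_nonpos (by norm_num), ← h1, gapMid_sub, fatMap_point]
    ring
  · rcases hy.2.eq_or_lt with h2 | h2
    · have hu : (y - gapMid x n) / halfGap n = 1 := by
        rw [h2]; field_simp; ring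
      rw [tent, hu, tentValue_of_nonneg (by norm_num), h2, gapMid_add, fatMap_point]
      ring
    · exact fatMap_of_gap (by rw [fatGap_eq]; exact ⟨h1, h2⟩)

theorem IsModulus.splice_agree (hκ : IsModulus T κ) (x : ℕ → Bool) (n : ℕ) (b : Bool) :
    ∀ j < κ n, T (splice x n b) j = T x j :=
  hκ.agree n _ _ fun _ hi => splice_of_lt x b hi

theorem IsModulus.peak_mem (hκ : IsModulus T κ) (x : ℕ → Bool) (n : ℕ) :
    (peak T κ x n : ℝ) ∈ fatCell (T x) (κ n) := by
  have h : (0 : ℚ) ≤ fatLen (κ n) := by exact_mod_cast (fatLen_pos (κ n)).le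
  rw [← fatCell_congr (hκ.splice_agree x n false), fatCell, peak]
  have h := farFrom_mem (lo := fatLeft (T (splice x n false)) (κ n)) h
    (a := fatLeft (T (splice x n false)) (κ n + 4)) (b := fatLeft (T (splice x n true)) (κ n + 4))
  exact ⟨by exact_mod_cast h.1, by exact_mod_cast h.2⟩

theorem IsModulus.point_mem (hκ : IsModulus T κ) (x : ℕ → Bool) (n : ℕ) (b : Bool) :
    fatPoint (T (splice x n b)) ∈ fatCell (T x) (κ n) := by
  rw [← fatCell_congr (hκ.splice_agree x n b)]
  exact fatPoint_mem_cell _ _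

theorem le_abs_point_sub_peak (x : ℕ → Bool) (n : ℕ) (b : Bool) :
    3 / 16 * (fatLen (κ n) : ℝ) ≤ |fatPoint (T (splice x n b)) - peak T κ x n| := by
  have h : (fatLen (κ n) : ℝ) / 4 ≤
      |(fatLeft (T (splice x n b)) (κ n + 4) : ℝ) - peak T κ x n| := by
    have h := le_abs_sub_farFrom (fatLeft (T (splice x n false)) (κ n)) (fatLen (κ n))
      (fatLeft (T (splice x n false)) (κ n + 4)) (fatLeft (T (splice x n true)) (κ n + 4))
    rw [← peak] at h
    cases b
    · exact_mod_cast h.1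
    · exact_mod_cast h.2
  have h1 := abs_sub_le_of_mem_cell (fatLeft_mem_cell (T (splice x n b)) (κ n + 4))
    (fatPoint_mem_cell (T (splice x n b)) (κ n + 4))
  have h2 := fatLen_le_quarter (κ n)
  have h3 := abs_sub_le (fatLeft (T (splice x n b)) (κ n + 4) : ℝ)
    (fatPoint (T (splice x n b))) (peak T κ x n)
  linarith

theorem IsModulus.tent_mem (hκ : IsModulus T κ)
    {x : ℕ → Bool} {n : ℕ} {y : ℝ} (hy : y ∈ closedGap x n) :
    tent T κ x n y ∈ fatCell (T x) (κ n) :=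
  tentValue_mem (hκ.peak_mem x n) (hκ.point_mem x n false) (hκ.point_mem x n true)
    (abs_rescale_le hy)

theorem IsModulus.fatMap_mem_cell (hκ : IsModulus T κ)
    {x : ℕ → Bool} {n : ℕ} {y : ℝ} (hy : y ∈ fatCell x n) :
    fatMap T κ y ∈ fatCell (T x) (κ n) := by
  have hx := fatAddr_eq_of_mem_cell hy
  rw [← fatCell_congr (hκ.agree n _ _ hx)]
  have h01 : y ∈ Icc (0 : ℝ) 1 := by
    rw [← fatCell_zero x]; exact fatCell_antitone x n.zero_le hy
  rcases mem_range_or_gap h01 with h | ⟨m, h⟩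
  · rw [h, fatMap_point, fatAddr_point]
    exact fatPoint_mem_cell _ _
  · rw [fatMap_of_gap h]
    exact fatCell_antitone _ (hκ.mono (gap_level_ge h hy))
      (hκ.tent_mem (fatGap_subset_closedGap _ _ h))

theorem IsModulus.fatMap_mem_Icc (hκ : IsModulus T κ) {y : ℝ} (hy : y ∈ Icc (0 : ℝ) 1) :
    fatMap T κ y ∈ Icc (0 : ℝ) 1 := by
  rw [← fatCell_zero fun _ => true] at hy
  have h := fatCell_antitone _ (κ 0).zero_le (hκ.fatMap_mem_cell hy)
  rwa [fatCell_zero] at h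

theorem IsModulus.abs_tent_sub_le (hκ : IsModulus T κ) (x : ℕ → Bool) (n : ℕ) (y z : ℝ) :
    |tent T κ x n y - tent T κ x n z| ≤ 128 * 4 ^ n * |y - z| := by
  have hc : (fatLen (κ n) : ℝ) ≤ 1 := (fatLen_le _).trans (pow_le_one₀ (by norm_num) (by norm_num))
  have h := abs_tentValue_sub_le (e := peak T κ x n) (u := (y - gapMid x n) / halfGap n)
    (v := (z - gapMid x n) / halfGap n)
    ((abs_sub_le_of_mem_cell (hκ.point_mem x n false) (hκ.peak_mem x n)).trans hc)
    ((abs_sub_le_of_mem_cell (hκ.point_mem x n true) (hκ.peak_mem x n)).trans hc)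
  refine h.trans (le_of_eq ?_)
  rw [← sub_div, sub_sub_sub_cancel_right, abs_div, abs_of_pos (halfGap_pos n), halfGap_cast,
    one_div_pow]
  field_simp
  ring

theorem IsModulus.abs_fatMap_sub_le_aux (hκ : IsModulus T κ)
    {N : ℕ} {δ : ℝ} (hδ : δ < 1 / 32 * (1 / 4) ^ N) (j : ℕ) :
    ∀ k, k + j = N → ∀ (x : ℕ → Bool) (y z : ℝ), y ∈ fatCell x k → z ∈ fatCell x k → y ≤ z →
      z - y ≤ δ → |fatMap T κ y - fatMap T κ z| ≤ fatLen (κ N) + j * (128 * 4 ^ N * δ) := by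
  induction j with
  | zero =>
    rintro k rfl x y z hy hz - -
    simpa using abs_sub_le_of_mem_cell (hκ.fatMap_mem_cell hy) (hκ.fatMap_mem_cell hz)
  | succ j ih =>
    intro k hk x y z hy hz hyz hd
    have ih := ih (k + 1) (by omega)
    have hpos : (0 : ℝ) ≤ δ := by linarith
    have hL : (0 : ℝ) ≤ 128 * 4 ^ N * δ := by positivity
    have hJ : (0 : ℝ) ≤ j * (128 * 4 ^ N * δ) := by positivity
    have he := (fatLen_pos (κ N)).le
    push_cast
    rw [add_mul, one_mul]
    have hpow : (4 : ℝ) ^ k ≤ 4 ^ N := pow_le_pow_right₀ (by norm_num) (by omega)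
    have hgap : ∀ p q, p ∈ closedGap x k → q ∈ closedGap x k → p ≤ q → q - p ≤ δ →
        |fatMap T κ p - fatMap T κ q| ≤ 128 * 4 ^ N * δ := by
      intro p q hp hq hpq hd
      rw [fatMap_of_closedGap hp, fatMap_of_closedGap hq]
      refine (hκ.abs_tent_sub_le x k p q).trans ?_
      rw [abs_sub_comm, abs_of_nonneg (by linarith)]
      gcongr
    have hlen : (2 : ℝ) * halfGap k > δ := by
      refine hδ.trans_le ?_
      rw [halfGap_cast]
      have : (1 / 4 : ℝ) ^ N ≤ (1 / 4) ^ k :=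
        pow_le_pow_of_le_one (by norm_num) (by norm_num) (by omega)
      linarith
    have hcell : ∀ b, (fatLeft (splice x k b) (k + 1) : ℝ) =
        fatLeft x k + if b = true then (fatStep k : ℝ) else 0 := by
      intro b
      rw [fatLeft_succ, fatLeft_congr fun i hi => splice_of_lt x b hi]
      simp [splice]
    have hp1 := gapMid_sub x k
    have hp2 := gapMid_add x k
    rw [fatPoint_splice_false] at hp1
    rw [fatPoint_splice_true] at hp2
    have hl : ∀ p, p ∈ fatCell x k → p ≤ gapMid x k - halfGap k →
        p ∈ fatCell (splice x k false) (k + 1) := by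
      intro p hp hpl
      rw [fatCell, hcell]
      simp only [Bool.false_eq_true, if_false, add_zero]
      exact ⟨hp.1, by linarith⟩
    have hr : ∀ p, p ∈ fatCell x k → gapMid x k + halfGap k ≤ p →
        p ∈ fatCell (splice x k true) (k + 1) := by
      intro p hp hpl
      rw [fatCell, hcell]
      simp only [if_true]
      have := fatStep_cast k
      exact ⟨by linarith, by linarith [hp.2]⟩
    have hpos' := halfGap_pos k
    have hl1 : (gapMid x k - halfGap k : ℝ) ∈ fatCell x k := by
      rw [hp1]; exact ⟨by linarith [fatLen_pos (k + 1)], by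
        linarith [fatLen_succ_lt_step k, fatStep_cast k, fatLen_pos (k + 1)]⟩
    have hr1 : (gapMid x k + halfGap k : ℝ) ∈ fatCell x k := by
      rw [hp2]; exact ⟨by linarith [fatStep_pos k], by
        linarith [fatStep_cast k, fatLen_pos (k + 1)]⟩
    rcases le_or_gt z (gapMid x k - halfGap k) with h1 | h1
    · linarith [ih _ y z (hl y hy (hyz.trans h1)) (hl z hz h1) hyz hd]
    rcases le_or_gt (gapMid x k + halfGap k : ℝ) y with h2 | h2
    · linarith [ih _ y z (hr y hy h2) (hr z hz (h2.trans hyz)) hyz hd]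
    rcases le_or_gt (gapMid x k - halfGap k : ℝ) y with h3 | h3
    · rcases le_or_gt z (gapMid x k + halfGap k) with h4 | h4
      · linarith [hgap y z ⟨h3, h2.le⟩ ⟨h1.le, h4⟩ hyz hd]
      · have e1 := hgap y _ ⟨h3, h2.le⟩ ⟨by linarith, le_rfl⟩ h2.le (by linarith)
        have e2 := ih _ _ z (hr _ hr1 le_rfl) (hr z hz h4.le) h4.le (by linarith)
        linarith [abs_sub_le (fatMap T κ y) (fatMap T κ (gapMid x k + halfGap k)) (fatMap T κ z)]
    · rcases le_or_gt z (gapMid x k + halfGap k) with h4 | h4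
      · have e1 := hgap _ z ⟨le_rfl, by linarith⟩ ⟨h1.le, h4⟩ h1.le (by linarith)
        have e2 := ih _ y _ (hl y hy h3.le) (hl _ hl1 le_rfl) h3.le (by linarith)
        linarith [abs_sub_le (fatMap T κ y) (fatMap T κ (gapMid x k - halfGap k)) (fatMap T κ z)]
      · linarith

theorem IsModulus.abs_fatMap_sub_le (hκ : IsModulus T κ) {N n : ℕ} (hN : n + 2 ≤ κ N) {y z : ℝ}
    (hy : y ∈ Icc (0 : ℝ) 1) (hz : z ∈ Icc (0 : ℝ) 1)
    (hd : |y - z| ≤ 1 / 2 ^ (3 * N + n + 9)) :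
    |fatMap T κ y - fatMap T κ z| ≤ 1 / 2 ^ (n + 1) := by
  wlog hyz : y ≤ z generalizing y z
  · rw [abs_sub_comm]
    exact this hz hy (by rwa [abs_sub_comm]) (le_of_not_ge hyz)
  have h4 : (4 : ℝ) ^ N = 2 ^ (2 * N) := by rw [pow_mul]; norm_num
  have hδ : (1 : ℝ) / 2 ^ (3 * N + n + 9) < 1 / 32 * (1 / 4) ^ N := by
    rw [one_div_pow, h4, one_div_mul_one_div]
    have : (32 : ℝ) * 2 ^ (2 * N) = 2 ^ (2 * N + 5) := by rw [pow_add]; norm_num; ring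
    rw [this]
    exact one_div_lt_one_div_of_lt (by positivity) (pow_lt_pow_right₀ (by norm_num) (by omega))
  rw [← fatCell_zero fun _ => true] at hy hz
  rw [abs_sub_comm, abs_of_nonneg (by linarith)] at hd
  refine (hκ.abs_fatMap_sub_le_aux hδ N 0 (by simp) _ y z hy hz hyz hd).trans ?_
  have h1 : (fatLen (κ N) : ℝ) ≤ 1 / 2 ^ (n + 2) := by
    refine (fatLen_le _).trans ?_
    rw [one_div_pow]
    exact one_div_le_one_div_of_le (by positivity) (pow_le_pow_right₀ (by norm_num) hN)
  have h2 : (N : ℝ) ≤ 2 ^ N := by exact_mod_cast Nat.lt_two_pow_self.le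
  have h3 : (N : ℝ) * (128 * 4 ^ N * (1 / 2 ^ (3 * N + n + 9))) ≤ 1 / 2 ^ (n + 2) := by
    calc (N : ℝ) * (128 * 4 ^ N * (1 / 2 ^ (3 * N + n + 9)))
        ≤ 2 ^ N * (128 * 4 ^ N * (1 / 2 ^ (3 * N + n + 9))) := by gcongr
      _ = 1 / 2 ^ (n + 2) := by
        rw [h4]
        have : (2 : ℝ) ^ (3 * N + n + 9) = 2 ^ N * 2 ^ (2 * N) * 2 ^ (n + 2) * 128 := by
          rw [← pow_add, ← pow_add, show (128 : ℝ) = 2 ^ 7 by norm_num, ← pow_add]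
          congr 1; ring
        rw [this]
        field_simp
  have : (1 : ℝ) / 2 ^ (n + 1) = 1 / 2 ^ (n + 2) + 1 / 2 ^ (n + 2) := by
    rw [pow_succ (2 : ℝ) (n + 1)]; field_simp; norm_num
  rw [this]
  exact add_le_add h1 h3

end Extension

/-- The extension of `fatMap` to the real line, constant outside of `[0, 1]`. -/
noncomputable def fatExt (T : (ℕ → Bool) → (ℕ → Bool)) (κ : ℕ → ℕ) (y : ℝ) : ℝ :=
  fatMap T κ (max 0 (min y 1))

theorem clip_mem_Icc (y : ℝ) : max 0 (min y 1) ∈ Icc (0 : ℝ) 1 :=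
  ⟨le_max_left _ _, max_le zero_le_one (min_le_right _ _)⟩

theorem clip_of_mem {y : ℝ} (hy : y ∈ Icc (0 : ℝ) 1) : max 0 (min y 1) = y := by
  rw [min_eq_left hy.2, max_eq_right hy.1]

theorem abs_clip_sub_le (y z : ℝ) : |max 0 (min y 1) - max 0 (min z 1)| ≤ |y - z| := by
  have h := abs_max_sub_max_le_max (0 : ℝ) (min y 1) 0 (min z 1)
  have h' := abs_min_sub_min_le_max y 1 z 1
  simp only [sub_self, abs_zero, abs_nonneg, max_eq_right, max_eq_left] at h h'
  exact h.trans h'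

theorem fatCell_subset_Icc (x : ℕ → Bool) (n : ℕ) : fatCell x n ⊆ Icc 0 1 := by
  rw [← fatCell_zero x]
  exact fatCell_antitone x n.zero_le

theorem volume_fatCell (x : ℕ → Bool) (n : ℕ) :
    volume (fatCell x n) = ENNReal.ofReal (fatLen n) := by
  rw [fatCell, Real.volume_Icc, add_sub_cancel_left]

theorem volume_fatGap (x : ℕ → Bool) (n : ℕ) :
    volume (fatGap x n) = ENNReal.ofReal (1 / 32 * (1 / 4) ^ n) := by
  rw [fatGap_eq, Real.volume_Ioo, halfGap_cast]
  congr 1; ring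

theorem fatCell_subset_union (x : ℕ → Bool) (n : ℕ) : fatCell x n ⊆
    fatGap x n ∪ fatCell (splice x n false) (n + 1) ∪ fatCell (splice x n true) (n + 1) := by
  intro y hy
  have hs : ∀ b, (fatLeft (splice x n b) (n + 1) : ℝ) =
      fatLeft x n + if b = true then (fatStep n : ℝ) else 0 := by
    intro b
    rw [fatLeft_succ, fatLeft_congr fun i hi => splice_of_lt x b hi]
    simp [splice]
  rw [union_assoc]
  have h3 := fatStep_cast n
  by_cases hg : y ∈ fatGap x n
  · exact Or.inl hg
  right
  by_cases h : y ≤ fatLeft x n + fatLen (n + 1)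
  · left
    rw [fatCell, hs]
    simp only [Bool.false_eq_true, if_false, add_zero]
    exact ⟨hy.1, h⟩
  · right
    have h2 : (fatLeft x n : ℝ) + fatStep n ≤ y := not_lt.1 fun h' => hg ⟨not_le.1 h, h'⟩
    rw [fatCell, hs, if_pos rfl]
    exact ⟨h2, by linarith [hy.2]⟩

theorem volume_inter_lowGaps_le {E : Set ℝ} {s : ℝ≥0∞}
    (hE : ∀ x n, volume (E ∩ fatGap x n) ≤ s * volume (fatGap x n)) (j : ℕ) :
    ∀ x k, volume (E ∩ {y ∈ fatCell x k | ∃ m < k + j, y ∈ fatGap (fatAddr y) m}) ≤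
      s * ENNReal.ofReal (1 / 16 * (1 / 4) ^ k) := by
  induction j with
  | zero =>
    intro x k
    have : E ∩ {y ∈ fatCell x k | ∃ m < k + 0, y ∈ fatGap (fatAddr y) m} = ∅ := by
      ext y
      refine iff_of_false ?_ (notMem_empty y)
      rintro ⟨-, hy, m, hm, h⟩
      exact absurd (gap_level_ge h hy) (by omega)
    rw [this, measure_empty]
    exact zero_le
  | succ j ih =>
    intro x k
    have hsub : E ∩ {y ∈ fatCell x k | ∃ m < k + (j + 1), y ∈ fatGap (fatAddr y) m} ⊆
        (E ∩ fatGap x k) ∪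
        (E ∩ {y ∈ fatCell (splice x k false) (k + 1) |
          ∃ m < k + 1 + j, y ∈ fatGap (fatAddr y) m}) ∪
        (E ∩ {y ∈ fatCell (splice x k true) (k + 1) |
          ∃ m < k + 1 + j, y ∈ fatGap (fatAddr y) m}) := by
      rintro y ⟨hy, hc, m, hm, hg⟩
      have hm' : m < k + 1 + j := by omega
      rcases fatCell_subset_union x k hc with (h | h) | h
      · exact Or.inl (Or.inl ⟨hy, h⟩)
      · exact Or.inl (Or.inr ⟨hy, h, m, hm', hg⟩)
      · exact Or.inr ⟨hy, h, m, hm', hg⟩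
    calc _ ≤ _ := measure_mono hsub
      _ ≤ _ := measure_union_le _ _
      _ ≤ _ := add_le_add_left (measure_union_le _ _) _
      _ ≤ s * ENNReal.ofReal (1 / 32 * (1 / 4) ^ k) +
          s * ENNReal.ofReal (1 / 16 * (1 / 4) ^ (k + 1)) +
          s * ENNReal.ofReal (1 / 16 * (1 / 4) ^ (k + 1)) :=
        add_le_add (add_le_add (volume_fatGap x k ▸ hE x k) (ih _ _)) (ih _ _)
      _ = s * ENNReal.ofReal (1 / 16 * (1 / 4) ^ k) := by
        rw [← mul_add, ← mul_add, ← ENNReal.ofReal_add (by positivity) (by positivity),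
          ← ENNReal.ofReal_add (by positivity) (by positivity)]
        congr 2
        ring

theorem volume_diff_range_inter_cell_le {E : Set ℝ} {s : ℝ≥0∞}
    (hE : ∀ x n, volume (E ∩ fatGap x n) ≤ s * volume (fatGap x n)) (x : ℕ → Bool) (k : ℕ) :
    volume ((E \ range fatPoint) ∩ fatCell x k) ≤
      s * ENNReal.ofReal (1 / 16 * (1 / 4) ^ k) := by
  have hsub : (E \ range fatPoint) ∩ fatCell x k ⊆
      ⋃ j, E ∩ {y ∈ fatCell x k | ∃ m < k + j, y ∈ fatGap (fatAddr y) m} := by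
    rintro y ⟨⟨hy, hn⟩, hc⟩
    rcases mem_range_or_gap (fatCell_subset_Icc x k hc) with h | ⟨n, hg⟩
    · exact absurd ⟨_, h.symm⟩ hn
    · exact mem_iUnion.2 ⟨n + 1, hy, hc, n, by omega, hg⟩
  refine (measure_mono hsub).trans ?_
  rw [Monotone.measure_iUnion]
  · exact iSup_le fun j => volume_inter_lowGaps_le hE j x k
  · intro i j hij y hy
    obtain ⟨hy, hc, m, hm, hg⟩ := hy
    exact ⟨hy, hc, m, by omega, hg⟩

theorem volume_preimage_affine (c : ℝ) {d : ℝ} (hd : d ≠ 0) (S : Set ℝ) :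
    volume ((fun y => c + d * y) ⁻¹' S) = ENNReal.ofReal |d⁻¹| * volume S := by
  rw [show (fun y => c + d * y) ⁻¹' S = (fun y => d * y) ⁻¹' ((fun y => c + y) ⁻¹' S) from rfl,
    Real.volume_preimage_mul_left hd, measure_preimage_add]

section Measure

variable {T : (ℕ → Bool) → (ℕ → Bool)} {κ : ℕ → ℕ}

theorem fatExt_of_mem {y : ℝ} (hy : y ∈ Icc (0 : ℝ) 1) : fatExt T κ y = fatMap T κ y := by
  rw [fatExt, clip_of_mem hy]

theorem fatExt_point (x : ℕ → Bool) : fatExt T κ (fatPoint x) = fatPoint (T x) := by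
  rw [fatExt_of_mem (fatPoint_mem_Icc x), fatMap_point]

theorem IsModulus.mapsTo_Icc (hκ : IsModulus T κ)
    : MapsTo (fatExt T κ) (Icc 0 1) (Icc 0 1) := fun y hy => by
  rw [fatExt_of_mem hy]
  exact hκ.fatMap_mem_Icc hy

theorem IsModulus.continuous_fatExt (hκ : IsModulus T κ) : Continuous (fatExt T κ) := by
  rw [Metric.continuous_iff]
  intro y ε hε
  obtain ⟨n, hn⟩ := exists_pow_lt_of_lt_one hε (show (1 / 2 : ℝ) < 1 by norm_num)
  obtain ⟨N, hN⟩ := hκ.unbounded (n + 2)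
  refine ⟨1 / 2 ^ (3 * N + n + 9), by positivity, fun z hz => ?_⟩
  refine (hκ.abs_fatMap_sub_le hN (clip_mem_Icc z) (clip_mem_Icc y)
    ((abs_clip_sub_le z y).trans (le_of_lt hz))).trans_lt (lt_of_le_of_lt ?_ hn)
  rw [one_div_pow]
  exact one_div_le_one_div_of_le (by positivity) (pow_le_pow_right₀ (by norm_num) (by omega))

theorem IsModulus.volume_preimage_inter_gap_le (hκ : IsModulus T κ)
    (x : ℕ → Bool) (n : ℕ) (S : Set ℝ) :
    volume (fatExt T κ ⁻¹' S ∩ fatGap x n) ≤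
      ENNReal.ofReal (2 * halfGap n / (3 / 16 * fatLen (κ n))) *
        volume (S ∩ fatCell (T x) (κ n)) := by
  set e : ℝ := ((peak T κ x n : ℚ) : ℝ)
  set h : ℝ := ((halfGap n : ℚ) : ℝ)
  have hh : 0 < h := halfGap_pos n
  have hlen := fatLen_pos (κ n)
  have hV := le_abs_point_sub_peak (T := T) (κ := κ) x n
  set V : Bool → ℝ := fun b => fatPoint (T (splice x n b))
  set m : ℝ := ((gapMid x n : ℚ) : ℝ)
  let sg : Bool → ℝ := fun b => if b = true then 1 else -1
  let d : Bool → ℝ := fun b => sg b * ((V b - e) / h)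
  have hsg : ∀ b, |sg b| = 1 := by intro b; cases b <;> simp [sg]
  have hdabs : ∀ b, |d b| = |V b - e| / h := by
    intro b; rw [abs_mul, hsg, one_mul, abs_div, abs_of_pos hh]
  have hVpos : ∀ b, 0 < |V b - e| := fun b => lt_of_lt_of_le (by positivity) (hV b)
  have hd : ∀ b, d b ≠ 0 := fun b => abs_pos.1 (by rw [hdabs]; exact div_pos (hVpos b) hh)
  have hsub : fatExt T κ ⁻¹' S ∩ fatGap x n ⊆
      ⋃ b : Bool, (fun y => (e - d b * m) + d b * y) ⁻¹' (S ∩ fatCell (T x) (κ n)) := by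
    rintro y ⟨hy, hg⟩
    have hyc := fatCell_subset_Icc _ _ (fatGap_subset_cell x n hg)
    rw [mem_preimage, fatExt_of_mem hyc, fatMap_of_gap hg] at hy
    have hmem : tent T κ x n y ∈ S ∩ fatCell (T x) (κ n) :=
      ⟨hy, hκ.tent_mem (fatGap_subset_closedGap x n hg)⟩
    rw [mem_iUnion]
    rcases le_total y m with hm | hm
    · refine ⟨false, ?_⟩
      rw [tent, tentValue_of_nonpos (div_nonpos_of_nonpos_of_nonneg (by simpa using hm) hh.le)]
        at hmem
      rw [mem_preimage]
      convert hmem using 1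
      simp only [d, sg, V, e, h, m]
      simp
      ring
    · refine ⟨true, ?_⟩
      rw [tent, tentValue_of_nonneg (div_nonneg (by simpa using hm) hh.le)] at hmem
      rw [mem_preimage]
      convert hmem using 1
      simp only [d, sg, V, e, h, m]
      simp
      ring
  have hle : ∀ b, ENNReal.ofReal |(d b)⁻¹| ≤ ENNReal.ofReal (h / (3 / 16 * fatLen (κ n))) := by
    intro b
    apply ENNReal.ofReal_le_ofReal
    rw [abs_inv, hdabs, inv_div]
    exact div_le_div_of_nonneg_left hh.le (by positivity) (hV b)
  calc _ ≤ _ := measure_mono hsub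
    _ ≤ _ := measure_iUnion_le _
    _ ≤ ∑' _ : Bool, ENNReal.ofReal (h / (3 / 16 * fatLen (κ n))) *
          volume (S ∩ fatCell (T x) (κ n)) := by
        refine ENNReal.tsum_le_tsum fun b => ?_
        rw [volume_preimage_affine _ (hd b)]
        exact mul_left_mono (hle b)
    _ = _ := by
        rw [tsum_bool, ← add_mul, ← ENNReal.ofReal_add (by positivity) (by positivity)]
        congr 2
        ring

theorem IsModulus.volume_preimage_diff_range (hκ : IsModulus T κ) {S : Set ℝ} (hS : volume S = 0) :
    volume ((fatExt T κ ⁻¹' S \ range fatPoint) ∩ Icc 0 1) = 0 := by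
  have h := volume_diff_range_inter_cell_le (E := fatExt T κ ⁻¹' S) (s := 0) (fun x n => ?_)
    (fun _ => true) 0
  · rwa [fatCell_zero, zero_mul, nonpos_iff_eq_zero] at h
  · refine (hκ.volume_preimage_inter_gap_le x n S).trans ?_
    rw [measure_mono_null inter_subset_left hS, mul_zero, zero_mul]

theorem IsModulus.volume_inter_gap_le_pow (hκ : IsModulus T κ)
    {E : Set ℝ} (hE : Disjoint E (range fatPoint))
    (hmap : MapsTo (fatExt T κ) E E) (j : ℕ) :
    ∀ x n, volume (E ∩ fatGap x n) ≤ ENNReal.ofReal (16 / 45) ^ j * volume (fatGap x n) := by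
  induction j with
  | zero =>
    intro x n
    rw [pow_zero, one_mul]
    exact measure_mono inter_subset_right
  | succ j ih =>
    intro x n
    have h1 := volume_diff_range_inter_cell_le ih (T x) (κ n)
    rw [hE.sdiff_eq_left] at h1
    calc volume (E ∩ fatGap x n) ≤ volume (fatExt T κ ⁻¹' E ∩ fatGap x n) :=
          measure_mono (inter_subset_inter_left _ hmap)
      _ ≤ _ := hκ.volume_preimage_inter_gap_le x n E
      _ ≤ ENNReal.ofReal (2 * halfGap n / (3 / 16 * fatLen (κ n))) *
          (ENNReal.ofReal (16 / 45) ^ j * ENNReal.ofReal (1 / 16 * (1 / 4) ^ κ n)) := by gcongr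
      _ = ENNReal.ofReal (16 / 45) ^ j * ENNReal.ofReal
          (2 * halfGap n / (3 / 16 * fatLen (κ n)) * (1 / 16 * (1 / 4) ^ κ n)) := by
        rw [ENNReal.ofReal_mul (p := 2 * halfGap n / (3 / 16 * fatLen (κ n)))]
        · ring
        · have := halfGap_pos n
          have := fatLen_pos (κ n)
          positivity
      _ ≤ ENNReal.ofReal (16 / 45) ^ j * ENNReal.ofReal
          (16 / 45 * (1 / 32 * (1 / 4) ^ n)) := by
        gcongr ENNReal.ofReal (16 / 45) ^ j * ENNReal.ofReal ?_
        have h2 := le_fatLen (κ n)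
        have h3 : (1 / 4 : ℝ) ^ κ n ≤ (1 / 2) ^ κ n := by gcongr; norm_num
        have h4 := fatLen_pos (κ n)
        rw [halfGap_cast, div_mul_eq_mul_div, div_le_iff₀ (by positivity)]
        have h5 : (0 : ℝ) < (1 / 4) ^ n := by positivity
        have h6 : 15 / 16 * (1 / 4 : ℝ) ^ κ n ≤ fatLen (κ n) := by linarith
        nlinarith [mul_le_mul_of_nonneg_left h6 h5.le]
      _ = _ := by
        rw [volume_fatGap, ENNReal.ofReal_mul (by norm_num), pow_succ, mul_assoc]

theorem IsModulus.volume_eq_zero_of_avoids (hκ : IsModulus T κ)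
    {E : Set ℝ} (hE : Disjoint E (range fatPoint))
    (hmap : MapsTo (fatExt T κ) E E) (h01 : E ⊆ Icc 0 1) : volume E = 0 := by
  have h0 : ∀ x n, volume (E ∩ fatGap x n) ≤ 0 * volume (fatGap x n) := by
    intro x n
    have hlt : ENNReal.ofReal (16 / 45) < 1 := by
      rw [ENNReal.ofReal_lt_one]; norm_num
    have ht := ENNReal.Tendsto.mul_const (b := volume (fatGap x n))
      (ENNReal.tendsto_pow_atTop_nhds_zero_of_lt_one hlt)
      (Or.inr (by rw [volume_fatGap]; exact ENNReal.ofReal_ne_top))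
    exact ge_of_tendsto' ht fun j => hκ.volume_inter_gap_le_pow hE hmap j x n
  have h := volume_diff_range_inter_cell_le h0 (fun _ => true) 0
  rwa [fatCell_zero, zero_mul, nonpos_iff_eq_zero, hE.sdiff_eq_left,
    inter_eq_left.2 h01] at h

/-- Almost every orbit enters the fat Cantor set, and does so outside of a given null set. -/
theorem IsModulus.ae_exists_mem (hκ : IsModulus T κ) {P : Set ℝ} (hP : volume P = 0) :
    ∀ᵐ y ∂(volume.restrict (Icc (0 : ℝ) 1)),
      ∃ n, (fatExt T κ)^[n] y ∈ range fatPoint \ P := by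
  have hB : ∀ n, volume {y ∈ Icc (0 : ℝ) 1 | (fatExt T κ)^[n] y ∈ P ∧
      ∀ i < n, (fatExt T κ)^[i] y ∉ range fatPoint} = 0 := by
    intro n
    induction n with
    | zero => exact measure_mono_null (fun y hy => hy.2.1) hP
    | succ n ih =>
      refine measure_mono_null ?_ (hκ.volume_preimage_diff_range ih)
      rintro y ⟨hy, hyP, hi⟩
      refine ⟨⟨⟨hκ.mapsTo_Icc hy, hyP, fun i hin => ?_⟩, hi 0 n.succ_pos⟩, hy⟩
      exact hi (i + 1) (by omega)
  have hE : volume {y ∈ Icc (0 : ℝ) 1 | ∀ i, (fatExt T κ)^[i] y ∉ range fatPoint} = 0 := by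
    refine hκ.volume_eq_zero_of_avoids ?_ ?_ fun y hy => hy.1
    · rw [Set.disjoint_left]
      exact fun y hy => hy.2 0
    · exact fun y hy => ⟨hκ.mapsTo_Icc hy.1, fun i => hy.2 (i + 1)⟩
  rw [ae_restrict_iff' measurableSet_Icc]
  have hB' := measure_iUnion_null hB
  have := measure_union_null hE hB'
  rw [← compl_mem_ae_iff] at this
  filter_upwards [this] with y hy hy01
  classical
  by_contra hno
  apply hy
  by_cases hex : ∃ i, (fatExt T κ)^[i] y ∈ range fatPoint
  · refine Or.inr (mem_iUnion.2 ⟨Nat.find hex, hy01, ?_, fun i hi => Nat.find_min hex hi⟩)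
    by_contra hnP
    exact hno ⟨_, Nat.find_spec hex, hnP⟩
  · exact Or.inl ⟨hy01, fun i hi => hex ⟨i, hi⟩⟩

end Measure

/-! ### Transport of attractors -/

section Transport

theorem volume_image_le_of_isOpen {lam : Measure (ℕ → Bool)}
    (hlam : ∀ w : List Bool, lam (cyl w) = (2 : ℝ≥0∞)⁻¹ ^ w.length) {U : Set (ℕ → Bool)}
    (hU : IsOpen U) : volume (fatPoint '' U) ≤ lam U := by
  classical
  let r : (n : ℕ) → (Fin n → Bool) → Set (ℕ → Bool) := fun n w => {x | ∀ i : Fin n, x i = w i}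
  have hr : ∀ n w, r n w = cyl (List.ofFn w) := by
    intro n w
    ext x
    constructor
    · intro h i
      rw [List.get_ofFn]
      exact h (Fin.cast (by simp) i)
    · intro h i
      have := h (Fin.cast (by simp) i)
      rw [List.get_ofFn] at this
      exact this
  have hrlam : ∀ n w, lam (r n w) = (2 : ℝ≥0∞)⁻¹ ^ n := by
    intro n w; rw [hr, hlam, List.length_ofFn]
  have hrvol : ∀ n w, volume (fatPoint '' r n w) ≤ (2 : ℝ≥0∞)⁻¹ ^ n := by
    intro n w
    have hsub : fatPoint '' r n w ⊆ fatCell (fun i => if h : i < n then w ⟨i, h⟩ else true) n := by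
      rintro _ ⟨x, hx, rfl⟩
      rw [← fatCell_congr (x := x)]
      · exact fatPoint_mem_cell x n
      · intro i hi
        rw [dif_pos hi]
        exact hx ⟨i, hi⟩
    refine (measure_mono hsub).trans ?_
    rw [volume_fatCell]
    refine (ENNReal.ofReal_le_ofReal (fatLen_le n)).trans ?_
    rw [ENNReal.ofReal_pow (by norm_num), one_div, ENNReal.ofReal_inv_of_pos (by norm_num)]
    simp
  have hrmeas : ∀ n w, MeasurableSet (r n w) := by
    intro n w
    have : r n w = ⋂ i : Fin n, (fun x : ℕ → Bool => x i) ⁻¹' {w i} := by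
      ext x; simp [r]
    rw [this]
    exact MeasurableSet.iInter fun i => measurable_pi_apply _ (measurableSet_singleton _)
  let V : ℕ → Set (ℕ → Bool) := fun n => ⋃ w ∈ {w : Fin n → Bool | r n w ⊆ U}.toFinset, r n w
  have hVU : ∀ n, V n ⊆ U := by
    intro n x hx
    obtain ⟨w, hw, hx⟩ := mem_iUnion₂.1 hx
    exact (by simpa using hw : r n w ⊆ U) hx
  have hmem : ∀ n x, x ∈ V n ↔ ∀ z : ℕ → Bool, (∀ i < n, x i = z i) → z ∈ U := by
    intro n x
    constructor
    · intro hx z hz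
      obtain ⟨w, hw, hx⟩ := mem_iUnion₂.1 hx
      exact (by simpa using hw : r n w ⊆ U) fun i => by rw [← hz i i.2, hx i]
    · intro h
      refine mem_iUnion₂.2 ⟨fun i => x i, ?_, fun i => rfl⟩
      simp only [mem_toFinset]
      exact fun z hz => h z fun i hi => (hz ⟨i, hi⟩).symm
  have hVvol : ∀ n, volume (fatPoint '' V n) ≤ lam (V n) := by
    intro n
    rw [image_iUnion₂]
    refine (measure_biUnion_finset_le _ _).trans ?_
    rw [measure_biUnion_finset]
    · exact Finset.sum_le_sum fun w _ => (hrvol n w).trans (hrlam n w).ge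
    · intro w _ w' _ hne
      refine Set.disjoint_left.2 fun x hx hx' => hne (funext fun i => ?_)
      rw [← hx i, ← hx' i]
    · exact fun w _ => hrmeas n w
  have hmono : Monotone V := by
    intro m n hmn x hx
    rw [hmem] at hx ⊢
    exact fun z hz => hx z fun i hi => hz i (hi.trans_le hmn)
  have hUV : fatPoint '' U = ⋃ n, fatPoint '' V n := by
    rw [← image_iUnion]
    congr 1
    refine Subset.antisymm (fun x hx => ?_) (iUnion_subset hVU)
    obtain ⟨n, hn⟩ := exists_cylinder_subset (hU.mem_nhds hx)
    exact mem_iUnion.2 ⟨n, (hmem n x).2 hn⟩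
  rw [hUV, Monotone.measure_iUnion fun m n hmn => image_mono (hmono hmn)]
  exact iSup_le fun n => (hVvol n).trans (measure_mono (hVU n))

theorem volume_image_eq_zero {lam : Measure (ℕ → Bool)} [IsProbabilityMeasure lam]
    (hlam : ∀ w : List Bool, lam (cyl w) = (2 : ℝ≥0∞)⁻¹ ^ w.length) {N : Set (ℕ → Bool)}
    (hN : lam N = 0) : volume (fatPoint '' N) = 0 := by
  refine le_antisymm (ENNReal.le_of_forall_pos_le_add fun ε hε _ => ?_) zero_le
  obtain ⟨U, hNU, hU, hlt⟩ := N.exists_isOpen_lt_of_lt (μ := lam) (ε : ℝ≥0∞)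
    (by rw [hN]; exact_mod_cast hε)
  rw [zero_add]
  exact (measure_mono (image_mono hNU)).trans
    ((volume_image_le_of_isOpen hlam hU).trans hlt.le)

theorem omegaSet_iterate {X : Type*} [TopologicalSpace X] (f : X → X) (n : ℕ) (y : X) :
    omegaSet f (f^[n] y) = omegaSet f y := by
  have h : (fun k => f^[k] (f^[n] y)) = (fun k => f^[k] y) ∘ (· + n) := by
    funext k
    rw [Function.comp, Function.iterate_add_apply]
  ext p
  change MapClusterPt p atTop _ ↔ MapClusterPt p atTop _
  rw [h, MapClusterPt, ← map_map, map_add_atTop_eq_nat]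
  rfl

theorem measurableSet_realm {T : (ℕ → Bool) → (ℕ → Bool)} (hT : Measurable T)
    {A : Set (ℕ → Bool)} (hA : IsClosed A) : MeasurableSet (realm T A) := by
  have hc : ∀ w : List Bool, IsClopen (cyl w) := by
    intro w
    have : cyl w = ⋂ i : Fin w.length, (fun x : ℕ → Bool => x i) ⁻¹' {w.get i} := by
      ext x; simp [cyl]
    rw [this]
    exact isClopen_iInter_of_finite fun i =>
      (isClopen_discrete _).preimage (continuous_apply _)
  have h : realm T A = ⋂ w ∈ {w : List Bool | Disjoint (cyl w) A},
      {x | ∀ᶠ n in atTop, T^[n] x ∉ cyl w} := by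
    ext x
    simp only [mem_iInter]
    constructor
    · intro hx w hw
      by_contra hfr
      have hfr : ∃ᶠ n in atTop, T^[n] x ∈ cyl w := by
        simpa [Filter.Frequently] using hfr
      obtain ⟨p, hp, hcl⟩ := (hc w).1.isCompact.exists_mapClusterPt_of_frequently hfr
      exact Set.disjoint_left.1 hw hp (hx hcl)
    · intro hx p hp
      by_contra hpA
      obtain ⟨n, hn⟩ := exists_cylinder_subset (hA.isOpen_compl.mem_nhds hpA)
      have hpw : p ∈ cyl (List.ofFn fun i : Fin n => p i) := by
        intro i
        rw [List.get_ofFn]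
        rfl
      have hw : Disjoint (cyl (List.ofFn fun i : Fin n => p i)) A := by
        refine Set.disjoint_left.2 fun z hz => hn z fun i hi => ?_
        have := hz (Fin.cast (by simp) (⟨i, hi⟩ : Fin n))
        rw [List.get_ofFn] at this
        exact this.symm
      obtain ⟨k, hk, hk'⟩ := ((hp.frequently ((hc _).2.mem_nhds hpw)).and_eventually
        (hx _ hw)).exists
      exact hk' hk
  rw [h]
  refine MeasurableSet.biInter (to_countable _) fun w _ => ?_
  simp only [eventually_atTop]
  have : {x | ∃ a, ∀ b ≥ a, T^[b] x ∉ cyl w} =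
      ⋃ a, ⋂ b, ⋂ _ : b ≥ a, (T^[b]) ⁻¹' (cyl w)ᶜ := by
    ext x; simp
  rw [this]
  exact MeasurableSet.iUnion fun a => MeasurableSet.iInter fun b => MeasurableSet.iInter fun _ =>
    hT.iterate b (hc w).2.measurableSet.compl

theorem integral_empMeasure_s17 {X : Type*} [TopologicalSpace X] [MeasurableSpace X] [BorelSpace X]
    [SecondCountableTopology X] (T : X → X) (x : X) (n : ℕ) {φ : X → ℝ} (hφ : Continuous φ) :
    ∫ z, φ z ∂(empMeasure T x n) = birkhoffAverage ℝ T φ n x := by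
  have hm := hφ.measurable.stronglyMeasurable
  rw [empMeasure, integral_smul_measure, integral_finsetSum_measure, birkhoffAverage,
    birkhoffSum, ENNReal.toReal_inv, ENNReal.toReal_natCast]
  · congr 1
    exact Finset.sum_congr rfl fun i _ => integral_dirac' _ _ hm
  · intro i _
    exact integrable_dirac' hm (by simp)

theorem tendsto_birkhoffAverage_of_iterate {X : Type*} (f : X → X) (g : X → ℝ) {y : X}
    (hb : Bornology.IsBounded (range fun k => g (f^[k] y))) (n : ℕ) {c : ℝ}
    (h : Tendsto (fun N => birkhoffAverage ℝ f g N (f^[n] y)) atTop (𝓝 c)) :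
    Tendsto (fun N => birkhoffAverage ℝ f g N y) atTop (𝓝 c) := by
  induction n with
  | zero => exact h
  | succ n ih =>
    apply ih
    have hb' : Bornology.IsBounded (range fun k => g (f^[k] (f^[n] y))) := by
      refine hb.subset ?_
      rintro _ ⟨k, rfl⟩
      exact ⟨k + n, by simp only [Function.iterate_add_apply]⟩
    have h1 := tendsto_birkhoffAverage_apply_sub_birkhoffAverage ℝ hb'
    have h2 := h.sub h1
    rw [sub_zero] at h2
    refine h2.congr fun N => ?_
    rw [← Function.iterate_succ_apply' f n y, sub_sub_cancel]

theorem measSupport_map {μ : Measure (ℕ → Bool)} :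
    measSupport (μ.map fatPoint) = fatPoint '' measSupport μ := by
  have hemb := isClosedEmbedding_fatPoint
  have hm := continuous_fatPoint.measurable
  ext p
  constructor
  · intro hp
    have hpr : p ∈ range fatPoint := by
      by_contra hpr
      have := hp _ hemb.isClosed_range.isOpen_compl hpr
      rw [Measure.map_apply hm hemb.isClosed_range.isOpen_compl.measurableSet] at this
      simp at this
    obtain ⟨z, rfl⟩ := hpr
    refine ⟨z, fun V hV hz => ?_, rfl⟩
    obtain ⟨U, hU, rfl⟩ := hemb.isInducing.isOpen_iff.1 hV
    rw [← Measure.map_apply hm hU.measurableSet]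
    exact hp U hU hz
  · rintro ⟨z, hz, rfl⟩ U hU hzU
    rw [Measure.map_apply hm hU.measurableSet]
    exact hz _ (hU.preimage continuous_fatPoint) hzU

variable {T : (ℕ → Bool) → (ℕ → Bool)} {κ : ℕ → ℕ}

theorem fatExt_iterate_point (n : ℕ) (x : ℕ → Bool) :
    (fatExt T κ)^[n] (fatPoint x) = fatPoint (T^[n] x) := by
  have h : Function.Semiconj fatPoint T (fatExt T κ) := fun x => (fatExt_point x).symm
  exact ((h.iterate_right n) x).symm

theorem omegaSet_point (x : ℕ → Bool) :
    omegaSet (fatExt T κ) (fatPoint x) = fatPoint '' omegaSet T x := by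
  have hemb := isClosedEmbedding_fatPoint
  have h : (fun n => (fatExt T κ)^[n] (fatPoint x)) = fatPoint ∘ fun n => T^[n] x :=
    funext fun n => fatExt_iterate_point n x
  ext p
  constructor
  · intro hp
    have hp : MapClusterPt p atTop (fatPoint ∘ fun n => T^[n] x) := h ▸ hp
    have hpr : p ∈ range fatPoint := by
      by_contra hpr
      obtain ⟨n, hn⟩ := (hp.frequently (hemb.isClosed_range.isOpen_compl.mem_nhds hpr)).exists
      exact hn ⟨_, rfl⟩
    obtain ⟨z, rfl⟩ := hpr
    exact ⟨z, (hemb.isInducing.mapClusterPt_iff (l := map (fun n => T^[n] x) atTop)).1 hp, rfl⟩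
  · rintro ⟨z, hz, rfl⟩
    change MapClusterPt _ _ _
    rw [h]
    exact (hemb.isInducing.mapClusterPt_iff (l := map (fun n => T^[n] x) atTop)).2 hz

theorem IsModulus.continuous (hκ : IsModulus T κ) : Continuous T := by
  refine continuous_pi fun j => continuous_iff_continuousAt.2 fun x => ?_
  obtain ⟨n, hn⟩ := hκ.unbounded (j + 1)
  refine ContinuousAt.congr (f := fun _ => T x j) continuousAt_const ?_
  filter_upwards [cylinder_mem_nhds x n] with z hz
  exact hκ.agree n x z hz j hn

theorem IsModulus.ae_omegaSet_subset (hκ : IsModulus T κ) :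
    ∀ᵐ y ∂(volume.restrict (Icc (0 : ℝ) 1)), omegaSet (fatExt T κ) y ⊆ range fatPoint := by
  filter_upwards [hκ.ae_exists_mem (measure_empty (μ := volume))] with y hy
  obtain ⟨n, ⟨x, hx⟩, -⟩ := hy
  rw [← omegaSet_iterate _ n, ← hx, omegaSet_point]
  exact image_subset_range _ _

/-- Almost every orbit passes through the point of an address outside of a given null set. -/
theorem IsModulus.ae_exists_point (hκ : IsModulus T κ)
    {lam : Measure (ℕ → Bool)} [IsProbabilityMeasure lam]
    (hlam : ∀ w : List Bool, lam (cyl w) = (2 : ℝ≥0∞)⁻¹ ^ w.length) {p : (ℕ → Bool) → Prop}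
    (hp : ∀ᵐ x ∂lam, p x) :
    ∀ᵐ y ∂(volume.restrict (Icc (0 : ℝ) 1)),
      ∃ n x, (fatExt T κ)^[n] y = fatPoint x ∧ p x := by
  filter_upwards [hκ.ae_exists_mem (volume_image_eq_zero hlam (ae_iff.1 hp))] with y hy
  obtain ⟨n, ⟨x, hx⟩, hn⟩ := hy
  refine ⟨n, x, hx.symm, ?_⟩
  by_contra hpx
  exact hn ⟨x, hpx, hx⟩

theorem IsModulus.isMetricAttractor (hκ : IsModulus T κ)
    {lam : Measure (ℕ → Bool)} [IsProbabilityMeasure lam]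
    (hlam : ∀ w : List Bool, lam (cyl w) = (2 : ℝ≥0∞)⁻¹ ^ w.length) {A : Set (ℕ → Bool)}
    (hA : IsMetricAttractor T lam A) :
    IsMetricAttractor (fatExt T κ) (volume.restrict (Icc (0 : ℝ) 1)) (fatPoint '' A) := by
  obtain ⟨hcl, hmap, hone, hmin⟩ := hA
  refine ⟨isClosedEmbedding_fatPoint.isClosedMap _ hcl, ?_, ?_, ?_⟩
  · rintro _ ⟨x, hx, rfl⟩
    exact ⟨T x, hmap hx, (fatExt_point x).symm⟩
  · have hae : ∀ᵐ x ∂lam, x ∈ realm T A :=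
      (mem_ae_iff_prob_eq_one (measurableSet_realm hκ.continuous.measurable hcl)).2 hone
    have h : realm (fatExt T κ) (fatPoint '' A) =ᵐ[volume.restrict (Icc (0 : ℝ) 1)] univ := by
      rw [eventuallyEq_univ]
      filter_upwards [hκ.ae_exists_point hlam hae] with y ⟨n, x, hx, hr⟩
      change omegaSet _ _ ⊆ _
      rw [← omegaSet_iterate _ n, hx, omegaSet_point]
      exact image_mono hr
    rw [measure_congr h]
    simp
  · intro A' hA' hss
    have hcl' : IsClosed (fatPoint ⁻¹' A') := hA'.preimage continuous_fatPoint
    have hss' : fatPoint ⁻¹' A' ⊂ A := by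
      refine ⟨fun x hx => ?_, fun h => hss.2 ?_⟩
      · obtain ⟨z, hz, hzx⟩ := hss.1 hx
        rwa [← fatPoint_injective hzx]
      · rintro _ ⟨x, hx, rfl⟩
        exact h hx
    have hae : ∀ᵐ x ∂lam, x ∉ realm T (fatPoint ⁻¹' A') :=
      measure_eq_zero_iff_ae_notMem.1 (hmin _ hcl' hss')
    rw [measure_eq_zero_iff_ae_notMem]
    filter_upwards [hκ.ae_exists_point hlam hae] with y ⟨n, x, hx, hr⟩ hy
    apply hr
    change omegaSet _ _ ⊆ _ at hy
    rw [← omegaSet_iterate _ n, hx, omegaSet_point] at hy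
    exact image_subset_iff.1 hy

theorem IsModulus.isStatAttractor (hκ : IsModulus T κ)
    {lam : Measure (ℕ → Bool)} [IsProbabilityMeasure lam]
    (hlam : ∀ w : List Bool, lam (cyl w) = (2 : ℝ≥0∞)⁻¹ ^ w.length) {A : Set (ℕ → Bool)}
    (hA : IsStatAttractor T lam A) :
    IsStatAttractor (fatExt T κ) (volume.restrict (Icc (0 : ℝ) 1)) (fatPoint '' A) := by
  obtain ⟨hcl, μ, hμ, hinv, hsupp, hae⟩ := hA
  have hm := continuous_fatPoint.measurable
  refine ⟨isClosedEmbedding_fatPoint.isClosedMap _ hcl, μ.map fatPoint,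
    Measure.isProbabilityMeasure_map hm.aemeasurable, ?_, by rw [measSupport_map, hsupp], ?_⟩
  · have hcomp : fatExt T κ ∘ fatPoint = fatPoint ∘ T := funext fatExt_point
    rw [Measure.map_map hκ.continuous_fatExt.measurable hm, hcomp,
      ← Measure.map_map hm hκ.continuous.measurable, hinv]
  · filter_upwards [hκ.ae_exists_point hlam hae, ae_restrict_mem measurableSet_Icc]
      with y ⟨n, x, hx, hw⟩ hy φ
    rw [integral_map hm.aemeasurable φ.continuous.aestronglyMeasurable]
    simp only [integral_empMeasure_s17 _ _ _ φ.continuous]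
    refine tendsto_birkhoffAverage_of_iterate _ _ ?_ n ?_
    · refine ((isCompact_Icc (a := (0 : ℝ)) (b := 1)).image φ.continuous).isBounded.subset ?_
      rintro _ ⟨k, rfl⟩
      exact ⟨_, hκ.mapsTo_Icc.iterate k hy, rfl⟩
    · have h := hw (φ.comp ⟨fatPoint, continuous_fatPoint⟩)
      simp only [integral_empMeasure_s17 _ _ _ (ContinuousMap.continuous _)] at h
      rw [hx]
      refine h.congr fun N => ?_
      simp only [birkhoffAverage, birkhoffSum, fatExt_iterate_point]
      rfl

end Transport

/-! ### Computability of the construction -/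

/-- The sequence beginning with `w` and constantly equal to `b` afterwards. -/
def wordSeq (w : List Bool) (b : Bool) : ℕ → Bool := fun i => w.getD i b

/-- The word of the first `n` digits of `x`. -/
def prefixWord (x : ℕ → Bool) (n : ℕ) : List Bool := (List.range n).map x

theorem length_prefixWord (x : ℕ → Bool) (n : ℕ) : (prefixWord x n).length = n := by
  simp [prefixWord]

theorem wordSeq_prefixWord (x : ℕ → Bool) {n : ℕ} (b : Bool) :
    ∀ i < n, wordSeq (prefixWord x n) b i = x i := by
  intro i hi
  simp [wordSeq, prefixWord, List.getD_eq_getElem?_getD, hi]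

theorem ofFn_eq_prefixWord (x : ℕ → Bool) (n : ℕ) :
    (List.ofFn fun i : Fin n => x i) = prefixWord x n := by
  apply List.ext_getElem <;> simp [prefixWord]

theorem splice_wordSeq (w : List Bool) (a b : Bool) :
    splice (wordSeq w a) w.length b = wordSeq (w ++ [b]) (!b) := by
  funext i
  simp only [splice, wordSeq, List.getD_eq_getElem?_getD]
  rcases lt_trichotomy i w.length with h | h | h
  · rw [if_pos h, List.getElem?_append_left h]
    simp [h]
  · subst h
    simp
  · rw [if_neg (by omega), if_neg (by omega), List.getElem?_eq_none (by simp; omega)]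
    rfl

section Computable

variable {A : Type*} [Primcodable A]

theorem computable_wordSeq {w : A → List Bool} (hw : Computable w) (b : Bool) :
    Computable₂ fun a => wordSeq (w a) b :=
  (Primrec.list_getD b).to_comp.comp (hw.comp Computable.fst) Computable.snd

theorem computable_fatLen {n : A → ℕ} (hn : Computable n) : Computable fun a => fatLen (n a) :=
  computable_rat_div (computable_rat_add
    (computable_rat_mul (Computable.const 15) (computable_rat_pow _ hn))
    (computable_rat_pow _ hn)) (Computable.const 16)

theorem computable_fatStep {n : A → ℕ} (hn : Computable n) : Computable fun a => fatStep (n a) :=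
  computable_rat_sub (computable_fatLen hn) (computable_fatLen (Computable.succ.comp hn))

theorem computable_fatLeft {X : A → ℕ → Bool} (hX : Computable₂ X) {n : A → ℕ}
    (hn : Computable n) : Computable fun a => fatLeft (X a) (n a) := by
  have h : Computable₂ fun (a : A) (i : ℕ) => if X a i = true then fatStep i else 0 := by
    refine computable_ite (c := fun p : A × ℕ => X p.1 p.2 = true) ?_
      (computable_fatStep Computable.snd) (Computable.const 0)
    exact Computable.of_eq (f := fun p : A × ℕ => X p.1 p.2) hX fun p => by simp
  exact (computable_rat_sum h).comp Computable.id hn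

theorem computable_halfGap {n : A → ℕ} (hn : Computable n) : Computable fun a => halfGap (n a) :=
  computable_rat_mul (Computable.const _) (computable_rat_pow _ hn)

theorem computable_tentValue {e a b u : A → ℚ} (he : Computable e) (ha : Computable a)
    (hb : Computable b) (hu : Computable u) :
    Computable fun x => tentValue (e x) (a x) (b x) (u x) :=
  computable_rat_add (computable_rat_add he (computable_rat_mul (computable_rat_sub ha he)
    (computable_rat_div (computable_rat_sub (computable_rat_abs hu) hu) (Computable.const 2))))
    (computable_rat_mul (computable_rat_sub hb he)
    (computable_rat_div (computable_rat_add (computable_rat_abs hu) hu) (Computable.const 2)))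

theorem computable_farFrom {lo len a b : A → ℚ} (hlo : Computable lo) (hlen : Computable len)
    (ha : Computable a) (hb : Computable b) :
    Computable fun x => farFrom (lo x) (len x) (a x) (b x) := by
  have hq := computable_rat_div hlen (Computable.const 4)
  have hmid := computable_rat_add hlo (computable_rat_div hlen (Computable.const 2))
  have hfar : ∀ {v c : A → ℚ}, Computable v → Computable c →
      Computable fun x => decide (len x / 4 ≤ |v x - c x|) := fun hv hc =>
    computable_rat_le hq (computable_rat_abs (computable_rat_sub hv hc))
  exact computable_ite (computable_decide_and (hfar ha hlo) (hfar hb hlo)) hlo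
    (computable_ite (computable_decide_and (hfar ha hmid) (hfar hb hmid)) hmid
      (computable_rat_add hlo hlen))

end Computable

/-- A modulus of continuity read off a computable modulus of dependence. -/
def modulus (α : ℕ → ℕ) : ℕ → ℕ
  | 0 => 0
  | k + 1 => if α (modulus α k) < k + 1 then modulus α k + 1 else modulus α k

theorem computable_modulus {α : ℕ → ℕ} (hα : Computable α) : Computable (modulus α) := by
  refine (Computable.nat_rec (f := fun k : ℕ => k) (g := fun _ => 0)
    (h := fun _ p => if α p.2 < p.1 + 1 then p.2 + 1 else p.2) Computable.id
    (Computable.const 0) ?_).of_eq fun n => ?_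
  · have h1 : Computable fun p : ℕ × ℕ × ℕ => p.2.1 := Computable.fst.comp Computable.snd
    have h2 : Computable fun p : ℕ × ℕ × ℕ => p.2.2 := Computable.snd.comp Computable.snd
    exact computable_ite (computable_nat_lt (hα.comp h2) (Computable.succ.comp h1))
      (Computable.succ.comp h2) h2
  · induction n with
    | zero => rfl
    | succ n ih => rw [modulus, ← ih]

theorem lt_of_lt_modulus (α : ℕ → ℕ) {j k : ℕ} (h : j < modulus α k) : α j < k := by
  induction k with
  | zero => exact absurd h (Nat.not_lt_zero j)
  | succ k ih =>
    rw [modulus] at h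
    split_ifs at h with hc
    · rcases Nat.lt_succ_iff_lt_or_eq.1 h with h | rfl
      · exact (ih h).trans k.lt_succ_self
      · exact hc
    · exact (ih h).trans k.lt_succ_self

theorem monotone_modulus (α : ℕ → ℕ) : Monotone (modulus α) :=
  monotone_nat_of_le_succ fun k => by
    rw [modulus]; split_ifs <;> omega

theorem exists_le_modulus (α : ℕ → ℕ) (m : ℕ) : ∃ k, m ≤ modulus α k := by
  induction m with
  | zero => exact ⟨0, zero_le⟩
  | succ m ih =>
    obtain ⟨k, hk⟩ := ih
    have hk' := hk.trans (monotone_modulus α (le_max_left k (α m)))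
    rcases hk'.eq_or_lt with h | h
    · refine ⟨max k (α m) + 1, ?_⟩
      rw [modulus, ← h, if_pos (Nat.lt_succ_of_le (le_max_right _ _))]
    · exact ⟨_, h⟩

theorem sigmaOne_of_exists {I B : Type*} [Primcodable I] [Primcodable B] {S : Set I}
    {R : I → B → Bool} (hR : Computable₂ R) (h : ∀ i, i ∈ S ↔ ∃ b, R i b = true) :
    SigmaOne S := by
  have hc : Computable₂ fun (p : I × ℕ) (b : B) => R p.1 b :=
    hR.comp (Computable.fst.comp Computable.fst) Computable.snd
  have hd : Computable fun p : I × ℕ => (Encodable.decode p.2 : Option B) :=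
    Computable.decode.comp Computable.snd
  refine ⟨_, Computable.option_casesOn hd (Computable.const false) hc, fun i => ?_⟩
  rw [h]
  constructor
  · rintro ⟨b, hb⟩
    exact ⟨Encodable.encode b, by simpa using hb⟩
  · rintro ⟨a, ha⟩
    cases hd : Encodable.decode (α := B) a with
    | none => simp [hd] at ha
    | some b => exact ⟨b, by simpa [hd] using ha⟩

theorem zero_mem_range : (0 : ℝ) ∈ range fatPoint := by
  rcases mem_range_or_gap (left_mem_Icc.2 zero_le_one) with h | ⟨n, h⟩
  · exact ⟨_, h.symm⟩
  · have h1 := fatLeft_mono (fatAddr 0) n.zero_le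
    simp only [fatLeft_zero, Rat.cast_zero] at h1
    linarith [h.1, fatLen_pos (n + 1)]

theorem perfect_range_fatPoint : Perfect (range fatPoint) := by
  refine ⟨isClosedEmbedding_fatPoint.isClosed_range, ?_⟩
  rintro _ ⟨x, rfl⟩
  rw [accPt_iff_nhds]
  intro U hU
  obtain ⟨n, hn⟩ := exists_cylinder_subset (continuous_fatPoint.continuousAt hU)
  refine ⟨fatPoint (Function.update x n (!x n)), ⟨hn _ fun i hi => ?_, _, rfl⟩, fun h => ?_⟩
  · rw [Function.update_of_ne hi.ne]
  · have := congrFun (fatPoint_injective h) n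
    simp at this

theorem isTotallyDisconnected_range_fatPoint : IsTotallyDisconnected (range fatPoint) :=
  isClosedEmbedding_fatPoint.isEmbedding.isTotallyDisconnected_range.2 inferInstance

theorem computableCantorRealMap_fatPoint : ComputableCantorRealMap fatPoint := by
  refine ⟨fun n => n, fun p => fatLeft (wordSeq p.2 true) p.1, Computable.id,
    computable_fatLeft (computable_wordSeq Computable.snd true) Computable.fst, fun x n => ?_⟩
  have h : fatLeft (wordSeq (List.ofFn fun i : Fin (n + 1) => x i) true) n = fatLeft x n := by
    rw [ofFn_eq_prefixWord]
    exact fatLeft_congr fun i hi => wordSeq_prefixWord x true i (hi.trans n.lt_succ_self)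
  simp only [h]
  refine (abs_sub_le_of_mem_cell (fatPoint_mem_cell x n) (fatLeft_mem_cell x n)).trans ?_
  rw [← one_div_pow]
  exact fatLen_le n

theorem computableClosedReal_range_fatPoint : ComputableClosedReal (range fatPoint) := by
  have h1 : Computable fun p : (ℚ × ℚ) × List Bool => p.1.1 := Computable.fst.comp Computable.fst
  have h2 : Computable fun p : (ℚ × ℚ) × List Bool => p.1.2 := Computable.snd.comp Computable.fst
  have hlen : Computable fun p : (ℚ × ℚ) × List Bool => p.2.length :=
    Computable.list_length.comp Computable.snd
  have hleft := computable_fatLeft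
    (computable_wordSeq (Computable.snd (α := ℚ × ℚ) (β := List Bool)) true) hlen
  constructor
  · refine sigmaOne_of_exists (B := List Bool) (R := fun p w => decide (p.1 < p.2 ∧
      p.1 < fatLeft (wordSeq w true) w.length ∧
      fatLeft (wordSeq w true) w.length + fatLen w.length < p.2)) ?_ fun p => ?_
    · exact computable_decide_and (computable_rat_lt h1 h2) (computable_decide_and
        (computable_rat_lt h1 hleft)
        (computable_rat_lt (computable_rat_add hleft (computable_fatLen hlen)) h2))
    · simp only [decide_eq_true_eq]
      constructor
      · rintro ⟨hp, _, hy, x, rfl⟩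
        obtain ⟨ε, hε, hball⟩ := Metric.mem_nhds_iff.1 (isOpen_Ioo.mem_nhds hy)
        obtain ⟨n, hn⟩ := ((tendsto_order.1 tendsto_fatLen).2 ε hε).exists
        have hcell : fatCell x n ⊆ Ioo (p.1 : ℝ) p.2 := fun z hz =>
          hball (lt_of_le_of_lt (abs_sub_le_of_mem_cell hz (fatPoint_mem_cell x n)) hn)
        have ha := (hcell (left_mem_Icc.2 (by linarith [fatLen_pos n]))).1
        have hb := (hcell (right_mem_Icc.2 (by linarith [fatLen_pos n]))).2
        refine ⟨prefixWord x n, hp, ?_⟩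
        rw [length_prefixWord, fatLeft_congr (wordSeq_prefixWord x true)]
        exact ⟨by exact_mod_cast ha, by exact_mod_cast hb⟩
      · rintro ⟨w, hp, ha, hb⟩
        have ha : (p.1 : ℝ) < fatLeft (wordSeq w true) w.length := by exact_mod_cast ha
        have hb : (fatLeft (wordSeq w true) w.length + fatLen w.length : ℝ) < p.2 := by
          exact_mod_cast hb
        have h := fatPoint_mem_cell (wordSeq w true) w.length
        exact ⟨hp, _, ⟨ha.trans_le h.1, h.2.trans_lt hb⟩, _, rfl⟩
  · refine sigmaOne_of_exists (B := List Bool) (R := fun p w => decide (p.1 < p.2 ∧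
      (p.2 < 0 ∨ 1 < p.1 ∨ (fatLeft (wordSeq w true) w.length + fatLen (w.length + 1) < p.1 ∧
      p.2 < fatLeft (wordSeq w true) w.length + fatStep w.length)))) ?_ fun p => ?_
    · exact computable_decide_and (computable_rat_lt h1 h2) (computable_decide_or
        (computable_rat_lt h2 (Computable.const 0)) (computable_decide_or
        (computable_rat_lt (Computable.const 1) h1) (computable_decide_and
        (computable_rat_lt
          (computable_rat_add hleft (computable_fatLen (Computable.succ.comp hlen))) h1)
        (computable_rat_lt h2 (computable_rat_add hleft (computable_fatStep hlen))))))
    · simp only [decide_eq_true_eq]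
      constructor
      · rintro ⟨hp, hK⟩
        have hno : ∀ y ∈ range fatPoint, y ∉ Icc (p.1 : ℝ) p.2 := fun y hy hy' =>
          (hK.subset ⟨hy', hy⟩ : y ∈ (∅ : Set ℝ))
        by_cases h0 : p.2 < 0
        · exact ⟨[], hp, Or.inl h0⟩
        by_cases h1 : 1 < p.1
        · exact ⟨[], hp, Or.inr (Or.inl h1)⟩
        have h0 : (0 : ℝ) ≤ p.2 := by exact_mod_cast not_lt.1 h0
        have h1 : (p.1 : ℝ) ≤ 1 := by exact_mod_cast not_lt.1 h1
        have hp' : (p.1 : ℝ) < p.2 := by exact_mod_cast hp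
        have h01 : (p.1 : ℝ) ∈ Icc (0 : ℝ) 1 :=
          ⟨le_of_not_gt fun h => hno 0 zero_mem_range ⟨h.le, h0⟩, h1⟩
        rcases mem_range_or_gap h01 with h | ⟨n, h⟩
        · exact absurd ⟨le_rfl, hp'.le⟩ (hno _ ⟨_, h.symm⟩)
        · have hb : (p.2 : ℝ) < fatLeft (fatAddr p.1) n + fatStep n := by
            by_contra hb
            exact hno _ ⟨_, fatPoint_splice_true _ n⟩ ⟨h.2.le, not_lt.1 hb⟩
          have ha := h.1
          refine ⟨prefixWord (fatAddr p.1) n, hp, Or.inr (Or.inr ?_)⟩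
          rw [length_prefixWord, fatLeft_congr (wordSeq_prefixWord _ true)]
          exact ⟨by exact_mod_cast ha, by exact_mod_cast hb⟩
      · rintro ⟨w, hp, h⟩
        refine ⟨hp, ?_⟩
        rw [← disjoint_iff_inter_eq_empty, Set.disjoint_left]
        rintro _ hy ⟨x, rfl⟩
        have hx := fatPoint_mem_Icc x
        rcases h with h | h | ⟨ha, hb⟩
        · have h : (p.2 : ℝ) < 0 := by exact_mod_cast h
          linarith [hx.1, hy.2]
        · have h : (1 : ℝ) < p.1 := by exact_mod_cast h
          linarith [hx.2, hy.1]
        · have ha : (fatLeft (wordSeq w true) w.length + fatLen (w.length + 1) : ℝ) < p.1 := by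
            exact_mod_cast ha
          have hb : (p.2 : ℝ) < fatLeft (wordSeq w true) w.length + fatStep w.length := by
            exact_mod_cast hb
          exact notMem_range_of_mem_gap (x := wordSeq w true) (n := w.length)
            ⟨ha.trans_le hy.1, hy.2.trans_lt hb⟩ ⟨x, rfl⟩

/-- The cell of `w` contains `q` and is mapped into a cell of level `n + 1`. -/
abbrev nearWord (κ : ℕ → ℕ) (q : ℚ) (n : ℕ) (w : List Bool) : Prop :=
  fatLeft (wordSeq w true) w.length ≤ q ∧
    q ≤ fatLeft (wordSeq w true) w.length + fatLen w.length ∧ n + 1 ≤ κ w.length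

/-- The gap of the cell of `w` contains `q`. -/
abbrev gapWord (q : ℚ) (w : List Bool) : Prop :=
  fatLeft (wordSeq w true) w.length + fatLen (w.length + 1) < q ∧
    q < fatLeft (wordSeq w true) w.length + fatStep w.length

/-- Rational approximation of `fatMap T κ q` computed from a word `w` locating `q`. -/
def approx (T : (ℕ → Bool) → (ℕ → Bool)) (κ : ℕ → ℕ) (q : ℚ) (n : ℕ) (w : List Bool) : ℚ :=
  if nearWord κ q n w then fatLeft (T (wordSeq w true)) (κ w.length)
  else tentValue (peak T κ (wordSeq w true) w.length)
    (fatLeft (T (splice (wordSeq w true) w.length false)) (n + 1))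
    (fatLeft (T (splice (wordSeq w true) w.length true)) (n + 1))
    ((q - gapMid (wordSeq w true) w.length) / halfGap w.length)

section Dynamics

variable {T : (ℕ → Bool) → (ℕ → Bool)} {α : ℕ → ℕ} {β : ℕ → List Bool → Bool}

theorem isModulus_modulus
    (hT : ∀ (x : ℕ → Bool) (n : ℕ), T x n = β n (List.ofFn fun i : Fin (α n + 1) => x i)) :
    IsModulus T (modulus α) where
  agree n x z h j hj := by
    have hα := lt_of_lt_modulus α hj
    rw [hT, hT]
    congr 2
    funext i
    exact h i (by omega)
  mono := monotone_modulus α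
  unbounded := exists_le_modulus α

variable {A : Type*} [Primcodable A]

theorem computable_map_wordSeq (hα : Computable α) (hβ : Computable₂ β)
    (hT : ∀ (x : ℕ → Bool) (n : ℕ), T x n = β n (List.ofFn fun i : Fin (α n + 1) => x i))
    {w : A → List Bool} (hw : Computable w) (b : Bool) :
    Computable₂ fun a => T (wordSeq (w a) b) := by
  have hp : Primrec fun p : List Bool × ℕ => prefixWord (wordSeq p.1 b) p.2 :=
    Primrec.list_map (Primrec.list_range.comp Primrec.snd)
      ((Primrec.list_getD b).comp (Primrec.fst.comp Primrec.fst) Primrec.snd)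
  have h : Computable fun p : A × ℕ =>
      β p.2 (prefixWord (wordSeq (w p.1) b) (α p.2 + 1)) :=
    hβ.comp Computable.snd (hp.to_comp.comp (Computable.pair (hw.comp Computable.fst)
      (Computable.succ.comp (hα.comp Computable.snd))))
  exact h.of_eq fun p => by
    change _ = T (wordSeq (w p.1) b) p.2
    rw [hT, ofFn_eq_prefixWord]

theorem IsModulus.abs_fatMap_sub_approx_le {κ : ℕ → ℕ} (hκ : IsModulus T κ) {q : ℚ} {n : ℕ}
    {w : List Bool} (h : nearWord κ q n w ∨ gapWord q w) :
    |fatMap T κ q - approx T κ q n w| ≤ 1 / 2 ^ (n + 1) := by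
  by_cases hc : nearWord κ q n w
  · rw [approx, if_pos hc]
    obtain ⟨h1, h2, h3⟩ := hc
    have hq : (q : ℝ) ∈ fatCell (wordSeq w true) w.length :=
      ⟨by exact_mod_cast h1, by exact_mod_cast h2⟩
    refine (abs_sub_le_of_mem_cell (hκ.fatMap_mem_cell hq) (fatLeft_mem_cell _ _)).trans ?_
    refine (fatLen_le _).trans ?_
    rw [one_div_pow]
    exact one_div_le_one_div_of_le (by positivity) (pow_le_pow_right₀ (by norm_num) h3)
  · rw [approx, if_neg hc]
    obtain ⟨h1, h2⟩ := h.resolve_left hc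
    have hq : (q : ℝ) ∈ fatGap (wordSeq w true) w.length :=
      ⟨by exact_mod_cast h1, by exact_mod_cast h2⟩
    rw [fatMap_of_gap hq, tent, tentValue_cast]
    push_cast
    have hclose : ∀ x, |fatPoint x - fatLeft x (n + 1)| ≤ 1 / 2 ^ (n + 1) := fun x => by
      rw [← one_div_pow]
      exact (abs_sub_le_of_mem_cell (fatPoint_mem_cell x _) (fatLeft_mem_cell x _)).trans
        (fatLen_le _)
    exact abs_tentValue_sub_le_of_endpoints (hclose _) (hclose _)
      (abs_rescale_le (fatGap_subset_closedGap _ _ hq))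

theorem exists_nearWord_or_gapWord {κ : ℕ → ℕ} (hκ : IsModulus T κ) {q : ℚ}
    (hq : (q : ℝ) ∈ Icc (0 : ℝ) 1) (n : ℕ) : ∃ w, nearWord κ q n w ∨ gapWord q w := by
  obtain ⟨k, hk⟩ := hκ.unbounded (n + 1)
  have hw := fun m => fatLeft_congr (wordSeq_prefixWord (fatAddr q) (n := m) true)
  rcases mem_cell_or_gap hq k with ⟨h1, h2⟩ | ⟨m, -, h1, h2⟩
  · refine ⟨prefixWord (fatAddr q) k, Or.inl ?_⟩
    rw [nearWord, length_prefixWord, hw]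
    exact ⟨by exact_mod_cast h1, by exact_mod_cast h2, hk⟩
  · refine ⟨prefixWord (fatAddr q) m, Or.inr ?_⟩
    rw [gapWord, length_prefixWord, hw]
    exact ⟨by exact_mod_cast h1, by exact_mod_cast h2⟩

section Search

variable {q : A → ℚ} {n : A → ℕ} {w : A → List Bool} {κ : ℕ → ℕ}

theorem computable_nearWord (hκ : Computable κ) (hq : Computable q) (hn : Computable n)
    (hw : Computable w) : Computable fun a => decide (nearWord κ (q a) (n a) (w a)) := by
  have hlen := Computable.list_length.comp hw
  have hleft := computable_fatLeft (computable_wordSeq hw true) hlen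
  exact computable_decide_and (computable_rat_le hleft hq) (computable_decide_and
    (computable_rat_le hq (computable_rat_add hleft (computable_fatLen hlen)))
    (computable_nat_le (Computable.succ.comp hn) (hκ.comp hlen)))

theorem computable_gapWord (hq : Computable q) (hw : Computable w) :
    Computable fun a => decide (gapWord (q a) (w a)) := by
  have hlen := Computable.list_length.comp hw
  have hleft := computable_fatLeft (computable_wordSeq hw true) hlen
  exact computable_decide_and
    (computable_rat_lt (computable_rat_add hleft
      (computable_fatLen (Computable.succ.comp hlen))) hq)
    (computable_rat_lt hq (computable_rat_add hleft (computable_fatStep hlen)))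

theorem computable_approx (hα : Computable α) (hβ : Computable₂ β)
    (hT : ∀ (x : ℕ → Bool) (n : ℕ), T x n = β n (List.ofFn fun i : Fin (α n + 1) => x i))
    (hκ : Computable κ) (hq : Computable q) (hn : Computable n) (hw : Computable w) :
    Computable fun a => approx T κ (q a) (n a) (w a) := by
  have hlen := Computable.list_length.comp hw
  have hleft := computable_fatLeft (computable_wordSeq hw true) hlen
  have hκlen := hκ.comp hlen
  have hside : ∀ b, Computable₂ fun a => T (splice (wordSeq (w a) true) (w a).length b) :=
    fun b => by
      simp only [splice_wordSeq]
      exact computable_map_wordSeq hα hβ hT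
        (Computable.list_append.comp hw (Computable.const [b])) (!b)
  have hκ4 := computable_nat_add hκlen (Computable.const 4)
  refine computable_ite (computable_nearWord hκ hq hn hw)
    (computable_fatLeft (computable_map_wordSeq hα hβ hT hw true) hκlen) ?_
  exact computable_tentValue
    (computable_farFrom (computable_fatLeft (hside false) hκlen) (computable_fatLen hκlen)
      (computable_fatLeft (hside false) hκ4) (computable_fatLeft (hside true) hκ4))
    (computable_fatLeft (hside false) (Computable.succ.comp hn))
    (computable_fatLeft (hside true) (Computable.succ.comp hn))
    (computable_rat_div (computable_rat_sub hq (computable_rat_add hleft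
      (computable_rat_div (computable_fatLen hlen) (Computable.const 2))))
      (computable_halfGap hlen))

end Search

theorem computableRealMap_fatExt (hα : Computable α) (hβ : Computable₂ β)
    (hT : ∀ (x : ℕ → Bool) (n : ℕ), T x n = β n (List.ofFn fun i : Fin (α n + 1) => x i)) :
    ComputableRealMap (fatExt T (modulus α)) := by
  have hκ := isModulus_modulus hT
  have hκc := computable_modulus hα
  obtain ⟨N, hN, hNκ⟩ := exists_computable_choice
    (R := fun n k => decide (n + 2 ≤ modulus α k))
    (computable_nat_le (computable_nat_add Computable.fst (Computable.const 2))
      (hκc.comp Computable.snd)) fun n => by simpa using hκ.unbounded (n + 2)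
  have hclip : Computable fun q : ℚ => max 0 (min q 1) := by
    refine (computable_ite (c := fun q : ℚ => q ≤ 0)
      (computable_rat_le Computable.id (Computable.const 0)) (Computable.const (0 : ℚ))
      (computable_ite (c := fun q : ℚ => q ≤ 1)
        (computable_rat_le Computable.id (Computable.const 1)) Computable.id
        (Computable.const (1 : ℚ)))).of_eq fun q => ?_
    grind
  have hclip1 : Computable fun p : ℚ × ℕ => max 0 (min p.1 1) := hclip.comp Computable.fst
  have hmem : ∀ q : ℚ, ((max 0 (min q 1) : ℚ) : ℝ) ∈ Icc (0 : ℝ) 1 := fun q => by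
    push_cast; exact clip_mem_Icc _
  obtain ⟨W, hW, hWspec⟩ := exists_computable_choice (A := ℚ × ℕ) (B := List Bool)
    (R := fun p w => decide (nearWord (modulus α) (max 0 (min p.1 1)) p.2 w ∨
      gapWord (max 0 (min p.1 1)) w))
    (computable_decide_or
      (computable_nearWord hκc (hclip1.comp Computable.fst)
        (Computable.snd.comp Computable.fst) Computable.snd)
      (computable_gapWord (hclip1.comp Computable.fst) Computable.snd))
    fun p => by
      simp only [decide_eq_true_eq]
      exact exists_nearWord_or_gapWord hκ (hmem p.1) p.2
  refine ⟨fun n => 3 * N n + n + 9,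
    fun p => approx T (modulus α) (max 0 (min p.1 1)) p.2 (W p),
    computable_nat_add (computable_nat_add (computable_nat_mul (Computable.const 3) hN)
      Computable.id) (Computable.const 9),
    computable_approx hα hβ hT hκc hclip1 Computable.snd hW, fun x hx q n hxq => ?_⟩
  have h1 := hκ.abs_fatMap_sub_approx_le (of_decide_eq_true (hWspec (q, n)))
  have h2 : |x - ((max 0 (min q 1) : ℚ) : ℝ)| ≤ |x - q| := by
    push_cast
    nth_rewrite 1 [← clip_of_mem hx]
    exact abs_clip_sub_le x q
  have h3 := hκ.abs_fatMap_sub_le (of_decide_eq_true (hNκ n)) hx (hmem q) (h2.trans hxq)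
  rw [fatExt_of_mem hx]
  have h4 : (1 : ℝ) / 2 ^ n = 1 / 2 ^ (n + 1) + 1 / 2 ^ (n + 1) := by
    rw [pow_succ]; field_simp; norm_num
  rw [h4]
  exact (abs_sub_le _ _ _).trans (add_le_add h3 h1)

end Dynamics

/-- Embedding of any computable Cantor-space dynamics into a computable interval map through a
computable fat Cantor set, preserving metric and statistical attractors. -/
theorem stmt17 {T : (ℕ → Bool) → (ℕ → Bool)} (hT : CantorComputable T) :
    ∃ (C : Set ℝ) (φ : (ℕ → Bool) → ℝ) (f : ℝ → ℝ),
      -- C is a computable Cantor subset of [0,1]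
      C ⊆ Set.Icc 0 1 ∧ C.Nonempty ∧ IsCompact C ∧ Perfect C ∧
      IsTotallyDisconnected C ∧ ComputableClosedReal C ∧
      -- φ is a computable homeomorphism of Cantor space onto C
      Continuous φ ∧ Function.Injective φ ∧ Set.range φ = C ∧
      ComputableCantorRealMap φ ∧
      -- f is a computable self-map of [0,1] preserving C
      ComputableRealMap f ∧ Set.MapsTo f (Set.Icc 0 1) (Set.Icc 0 1) ∧
      Set.MapsTo f C C ∧
      -- (1) φ conjugates T to f on C
      (∀ x : ℕ → Bool, φ (T x) = f (φ x)) ∧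
      -- (2) Lebesgue-a.e. point of [0,1] has ω-limit set inside C
      (∀ᵐ x ∂(volume.restrict (Set.Icc (0:ℝ) 1)), omegaSet f x ⊆ C) ∧
      -- (3) φ transports metric and statistical attractors
      (∀ lam : Measure (ℕ → Bool), IsProbabilityMeasure lam →
        (∀ w : List Bool, lam (cyl w) = (2 : ℝ≥0∞)⁻¹ ^ w.length) →
        ∀ A : Set (ℕ → Bool),
          (IsMetricAttractor T lam A →
            IsMetricAttractor f (volume.restrict (Set.Icc (0:ℝ) 1)) (φ '' A)) ∧
          (IsStatAttractor T lam A →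
            IsStatAttractor f (volume.restrict (Set.Icc (0:ℝ) 1)) (φ '' A))) := by
  obtain ⟨α, β, hα, hβ, h⟩ := hT
  have hκ := isModulus_modulus h
  refine ⟨range fatPoint, fatPoint, fatExt T (modulus α), ?_, range_nonempty _,
    isCompact_range continuous_fatPoint, perfect_range_fatPoint,
    isTotallyDisconnected_range_fatPoint, computableClosedReal_range_fatPoint,
    continuous_fatPoint, fatPoint_injective, rfl, computableCantorRealMap_fatPoint,
    computableRealMap_fatExt hα hβ h, hκ.mapsTo_Icc, ?_, fun x => (fatExt_point x).symm,
    hκ.ae_omegaSet_subset, fun lam _ hlam A =>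
      ⟨hκ.isMetricAttractor hlam, hκ.isStatAttractor hlam⟩⟩
  · rintro _ ⟨x, rfl⟩
    exact fatPoint_mem_Icc x
  · rintro _ ⟨x, rfl⟩
    exact ⟨T x, (fatExt_point x).symm⟩
end
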